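/- Assume additionally that φ(x) → 0 as |x| → ∞ and that a is normalized by ∫_{ℝ^d} a(x) dx = (∫_Γ exp[(s−1) Σ_{u∈γ} φ(u)] μ(dγ))^{−1}. Then for every f ∈ C_0(ℝ^d), with F(γ) := e^{⟨f,γ⟩}, one has H_ε^+ F → H_0^+ F in L²(Γ,μ) as ε → 0+. -/

import Mathlib

open MeasureTheory Set Filter
open scoped ENNReal NNReal BigOperators Topology Classical

noncomputable section

abbrev EucSp (d : ℕ) := EuclideanSpace ℝ (Fin d)

/-- The configuration space `Γ` over `ℝ^d`: locally finite subsets. -/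
def Config (d : ℕ) : Type :=
  {γ : Set (EucSp d) // ∀ Λ : Set (EucSp d), IsCompact Λ → (γ ∩ Λ).Finite}

/-- The σ-algebra on `Γ` generated by the maps `γ ↦ |γ ∩ B|`, `B` Borel. -/
instance Config.instMS (d : ℕ) : MeasurableSpace (Config d) :=
  ⨆ (B : Set (EucSp d)) (_ : MeasurableSet B),
    MeasurableSpace.comap (fun γ : Config d => (γ.1 ∩ B).encard) (⊤ : MeasurableSpace ℕ∞)

/-- `γ ∪ {x}`. -/
def Config.ins {d : ℕ} (γ : Config d) (x : EucSp d) : Config d :=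
  ⟨insert x γ.1, fun Λ hΛ => ((γ.2 Λ hΛ).insert x).subset fun y hy => by
    rcases hy with ⟨h1, h2⟩
    rcases h1 with rfl | h1
    · exact Set.mem_insert _ _
    · exact Set.mem_insert_of_mem _ ⟨h1, h2⟩⟩

/-- `γ ∖ {x}`. -/
def Config.del {d : ℕ} (γ : Config d) (x : EucSp d) : Config d :=
  ⟨γ.1 \ {x}, fun Λ hΛ => (γ.2 Λ hΛ).subset fun y hy => ⟨hy.1.1, hy.2⟩⟩

/-- The pairing `⟨f, γ⟩ = ∑_{x ∈ γ} f x`. -/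
def cpair {d : ℕ} (f : EucSp d → ℝ) (γ : Config d) : ℝ := ∑' x : γ.1, f x.1

/-- `exp : [-∞,∞] → [0,∞]`. -/
def eexp (x : EReal) : ℝ≥0∞ :=
  if x = ⊤ then ⊤ else if x = ⊥ then 0 else ENNReal.ofReal (Real.exp x.toReal)

/-- real-valued exponential of an extended real (with `exp(±∞)` sent to junk value `0`). -/
def rexp (x : EReal) : ℝ := (eexp x).toReal

/-- The relative energy `E(x,γ) = ∑_{y ∈ γ} φ(x-y)` if absolutely convergent, `+∞` otherwise. -/
def energy {d : ℕ} (φ : EucSp d → EReal) (x : EucSp d) (γ : Set (EucSp d)) : EReal :=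
  if (∀ y ∈ γ, φ (x - y) ≠ ⊤) ∧ Summable (fun y : γ => (φ (x - y.1)).toReal)
  then (((∑' y : γ, (φ (x - y.1)).toReal) : ℝ) : EReal)
  else ⊤

/-- `∑_{u ∈ γ} φ(u)` if absolutely convergent, `+∞` otherwise. -/
def totPhi {d : ℕ} (φ : EucSp d → EReal) (γ : Set (EucSp d)) : EReal :=
  if (∀ y ∈ γ, φ y ≠ ⊤) ∧ Summable (fun y : γ => (φ y.1).toReal)
  then (((∑' y : γ, (φ y.1).toReal) : ℝ) : EReal)
  else ⊤

/-- A pair potential: Borel, even, with `φ(x) ∈ ℝ` off the origin. -/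
structure IsPairPotential {d : ℕ} (φ : EucSp d → EReal) : Prop where
  meas : Measurable φ
  even : ∀ x : EucSp d, x ≠ 0 → φ (-x) = φ x
  finite_off : ∀ x : EucSp d, x ≠ 0 → φ x ≠ ⊤
  ne_bot : ∀ x, φ x ≠ ⊥

/-- Stability (S): `∑_{{x,y} ⊆ η} φ(x-y) ≥ -B|η|` for all finite `η`
(stated with the sum over ordered pairs, which doubles both sides). -/
def Stable {d : ℕ} (φ : EucSp d → EReal) (B : ℝ) : Prop :=
  ∀ η : Finset (EucSp d),
    ((-(2 * B * η.card) : ℝ) : EReal) ≤ ∑ p ∈ η.offDiag, φ (p.1 - p.2)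

/-- Low activity–high temperature (LA-HT): `∫ |e^{-φ} - 1| z dx < (2 e^{1+2B})⁻¹`. -/
def LAHT {d : ℕ} (φ : EucSp d → EReal) (z B : ℝ) : Prop :=
  ∫⁻ x : EucSp d, ENNReal.ofReal (|rexp (-(φ x)) - 1| * z)
    < ENNReal.ofReal (2 * Real.exp (1 + 2 * B))⁻¹

/-- The Georgii–Nguyen–Zessin identity characterizing `μ ∈ G(z,φ)`. -/
def GNZ {d : ℕ} (z : ℝ) (φ : EucSp d → EReal) (μ : Measure (Config d)) : Prop :=
  ∀ F : Config d → EucSp d → ℝ≥0∞,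
    Measurable (Function.uncurry F) →
    ∫⁻ γ, ∑' x : γ.1, F γ x.1 ∂μ
      = ∫⁻ γ, ∫⁻ x, ENNReal.ofReal z * eexp (-(energy φ x γ.1)) * F (γ.ins x) x ∂volume ∂μ


/-- Ordered `n`-tuples of distinct points of `γ`. -/
def injTuples {d : ℕ} (n : ℕ) (γ : Set (EucSp d)) : Set (Fin n → EucSp d) :=
  {p | Function.Injective p ∧ ∀ i, p i ∈ γ}

/-- `(k_μ^{(n)})` is the family of correlation functions of `μ`: each `k n` is measurable,
nonnegative and symmetric, and for every measurable symmetric `f : (ℝ^d)^n → [0,∞]`,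
`∫_Γ ∑_{{x_1,…,x_n} ⊆ γ} f dμ = (1/n!) ∫ f·kₙ dx` (stated equivalently via the sum over
ordered tuples of distinct points, which absorbs the factor `1/n!`). -/
def HasCorrFns {d : ℕ} (μ : Measure (Config d)) (k : ∀ n : ℕ, (Fin n → EucSp d) → ℝ) : Prop :=
  (∀ n : ℕ, Measurable (k n) ∧ (∀ x, 0 ≤ k n x) ∧
      ∀ (σ : Equiv.Perm (Fin n)) (x : Fin n → EucSp d), k n (x ∘ σ) = k n x) ∧
  ∀ n : ℕ, 0 < n → ∀ f : (Fin n → EucSp d) → ℝ≥0∞, Measurable f →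
    (∀ (σ : Equiv.Perm (Fin n)) (x : Fin n → EucSp d), f (x ∘ σ) = f x) →
    ∫⁻ γ, ∑' p : injTuples n γ.1, f p.1 ∂μ
      = ∫⁻ x : Fin n → EucSp d, f x * ENNReal.ofReal (k n x)

/-- The Ruelle bound `k^{(n)} ≤ ξⁿ`. -/
def RuelleBound {d : ℕ} (k : ∀ n : ℕ, (Fin n → EucSp d) → ℝ) (ξ : ℝ) : Prop :=
  ∀ n : ℕ, 0 < n → ∀ x : Fin n → EucSp d, k n x ≤ ξ ^ n

/-- Translation invariance of a family of functions on tuples. -/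
def TransInvFns {d : ℕ} (k : ∀ n : ℕ, (Fin n → EucSp d) → ℝ) : Prop :=
  ∀ (n : ℕ) (a : EucSp d) (x : Fin n → EucSp d), k n (fun i => x i + a) = k n x

/-- `P` is a partition of `{0,…,n-1}` into nonempty pairwise disjoint blocks. -/
def IsPartOfUniv {n : ℕ} (P : Finset (Finset (Fin n))) : Prop :=
  (∀ b ∈ P, b.Nonempty) ∧ (P : Set (Finset (Fin n))).PairwiseDisjoint id ∧
    P.sup id = Finset.univ

/-- `u` is the family of Ursell functions of `k`:
`k(η) = ∑ u(η_1) ⋯ u(η_j)`, summing over all partitions of `η`. -/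
def IsUrsell {d : ℕ} (k u : ∀ n : ℕ, (Fin n → EucSp d) → ℝ) : Prop :=
  ∀ n : ℕ, 0 < n → ∀ x : Fin n → EucSp d,
    k n x = ∑ P : Finset (Finset (Fin n)),
      if IsPartOfUniv P then ∏ b ∈ P, u b.card (fun i => x (b.orderIsoOfFin rfl i).1) else 0

/-- `f ∈ C_0(ℝ^d)`: continuous with compact support. -/
def IsC0 {d : ℕ} (f : EucSp d → ℝ) : Prop := Continuous f ∧ HasCompactSupport f

/-- Cylinder functions `FC_b(C_0(ℝ^d),Γ)`. -/
def Cyl {d : ℕ} (F : Config d → ℝ) : Prop :=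
  ∃ (N : ℕ) (f : Fin N → EucSp d → ℝ) (g : (Fin N → ℝ) → ℝ),
    (∀ i, IsC0 (f i)) ∧ Continuous g ∧ (∃ C, ∀ y, |g y| ≤ C) ∧
    ∀ γ, F γ = g fun i => cpair (f i) γ

/-- `(D_x^- F)(γ) = F(γ∖x) - F(γ)`. -/
def Dminus {d : ℕ} (F : Config d → ℝ) (x : EucSp d) (γ : Config d) : ℝ := F (γ.del x) - F γ

/-- `(D_x^+ F)(γ) = F(γ∪x) - F(γ)`. -/
def Dplus {d : ℕ} (F : Config d → ℝ) (x : EucSp d) (γ : Config d) : ℝ := F (γ.ins x) - F γ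

/-- `(D_{xy}^{-+} F)(γ) = F(γ∖x∪y) - F(γ)`. -/
def Dpm {d : ℕ} (F : Config d → ℝ) (x y : EucSp d) (γ : Config d) : ℝ :=
  F ((γ.del x).ins y) - F γ

/-- The Glauber bilinear form `E_G`. -/
def glauberForm {d : ℕ} (s : ℝ) (φ : EucSp d → EReal) (μ : Measure (Config d))
    (F G : Config d → ℝ) : ℝ :=
  ∫ γ, (∑' x : γ.1,
      rexp ((s : EReal) * energy φ x.1 (γ.1 \ {x.1})) * Dminus F x.1 γ * Dminus G x.1 γ) ∂μ

/-- The Kawasaki bilinear form `E_K`. -/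
def kawasakiForm {d : ℕ} (s : ℝ) (a : EucSp d → ℝ) (φ : EucSp d → EReal)
    (μ : Measure (Config d)) (F G : Config d → ℝ) : ℝ :=
  (1 / 2) * ∫ γ, (∑' x : γ.1, ∫ y : EucSp d,
      a (x.1 - y) *
        rexp ((s : EReal) * energy φ x.1 (γ.1 \ {x.1}) +
          ((s - 1 : ℝ) : EReal) * energy φ y (γ.1 \ {x.1})) *
        Dpm F x.1 y γ * Dpm G x.1 y γ) ∂μ

/-- The Glauber generator `H_G`. -/
def HG {d : ℕ} (s z : ℝ) (φ : EucSp d → EReal) (F : Config d → ℝ) (γ : Config d) : ℝ :=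
  -(∑' x : γ.1, rexp ((s : EReal) * energy φ x.1 (γ.1 \ {x.1})) * Dminus F x.1 γ)
    - ∫ x : EucSp d, z * rexp (((s - 1 : ℝ) : EReal) * energy φ x γ.1) * Dplus F x γ

/-- The Kawasaki generator `H_K`. -/
def HK {d : ℕ} (s : ℝ) (a : EucSp d → ℝ) (φ : EucSp d → EReal) (F : Config d → ℝ)
    (γ : Config d) : ℝ :=
  -(∑' x : γ.1, ∫ y : EucSp d,
      a (x.1 - y) * rexp ((s : EReal) * energy φ x.1 (γ.1 \ {x.1}) +
        ((s - 1 : ℝ) : EReal) * energy φ y (γ.1 \ {x.1})) * Dpm F x.1 y γ)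

/-- The scaled jump kernel `a_ε(x) = ε^d a(ε x)`. -/
def aScaled {d : ℕ} (a : EucSp d → ℝ) (ε : ℝ) (x : EucSp d) : ℝ := ε ^ d * a (ε • x)

/-- `H_ε^-` (death part of the Kawasaki generator with kernel `aa`). -/
def HepsMinus {d : ℕ} (s : ℝ) (aa : EucSp d → ℝ) (φ : EucSp d → EReal)
    (F : Config d → ℝ) (γ : Config d) : ℝ :=
  -(∑' x : γ.1, Dminus F x.1 γ * ∫ y : EucSp d,
      aa (x.1 - y) * rexp ((s : EReal) * energy φ x.1 (γ.1 \ {x.1}) +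
        ((s - 1 : ℝ) : EReal) * energy φ y (γ.1 \ {x.1})))

/-- `H_ε^+` (birth part of the Kawasaki generator with kernel `aa`). -/
def HepsPlus {d : ℕ} (s : ℝ) (aa : EucSp d → ℝ) (φ : EucSp d → EReal)
    (F : Config d → ℝ) (γ : Config d) : ℝ :=
  -(∑' x : γ.1, ∫ y : EucSp d,
      aa (x.1 - y) * rexp ((s : EReal) * energy φ x.1 (γ.1 \ {x.1}) +
        ((s - 1 : ℝ) : EReal) * energy φ y (γ.1 \ {x.1})) * Dplus F y (γ.del x.1))

/-- `H_0^-` (death part of the Glauber generator). -/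
def H0Minus {d : ℕ} (s : ℝ) (φ : EucSp d → EReal) (F : Config d → ℝ) (γ : Config d) : ℝ :=
  -(∑' x : γ.1, rexp ((s : EReal) * energy φ x.1 (γ.1 \ {x.1})) * Dminus F x.1 γ)

/-- `H_0^+` (birth part of the Glauber generator). -/
def H0Plus {d : ℕ} (s z : ℝ) (φ : EucSp d → EReal) (F : Config d → ℝ) (γ : Config d) : ℝ :=
  -∫ x : EucSp d, z * rexp (((s - 1 : ℝ) : EReal) * energy φ x γ.1) * Dplus F x γ

/-- The standing assumptions of the paper: `s ∈ [0,1/2]`, a stable pair potential in the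
low activity–high temperature regime, bounded outside a ball, and `μ` the Gibbs measure
from Ruelle's theorem with its correlation and Ursell functions. -/
structure Setting (d : ℕ) (s z B ξ : ℝ) (φ : EucSp d → EReal) (μ : Measure (Config d))
    (k u : ∀ n : ℕ, (Fin n → EucSp d) → ℝ) : Prop where
  hd : 0 < d
  hs0 : 0 ≤ s
  hs1 : s ≤ 1 / 2
  pp : IsPairPotential φ
  hB : 0 ≤ B
  stable : Stable φ B
  hz : 0 < z
  laht : LAHT φ z B
  bddOutside : ∃ R C : ℝ, ∀ x : EucSp d, R ≤ ‖x‖ → ∃ r : ℝ, φ x = (r : EReal) ∧ |r| ≤ C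
  prob : IsProbabilityMeasure μ
  gnz : GNZ z φ μ
  corr : HasCorrFns μ k
  ti : TransInvFns k
  hξ : 0 < ξ
  ruelle : RuelleBound k ξ
  ursell : IsUrsell k u
  ursellInt : ∀ m : ℕ,
    Integrable (fun y : Fin (m + 1) → EucSp d => u (m + 2) (Fin.cons 0 y)) volume

/-- The jump kernel `a`: bounded, nonnegative, even, integrable. -/
structure GoodA {d : ℕ} (a : EucSp d → ℝ) : Prop where
  meas : Measurable a
  nonneg : ∀ x, 0 ≤ a x
  bdd : ∃ C, ∀ x, a x ≤ C
  even : ∀ x, a (-x) = a x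
  int : Integrable a volume

/-- `φ(x) → 0` as `|x| → ∞`. -/
def PhiVanishes {d : ℕ} (φ : EucSp d → EReal) : Prop :=
  Tendsto φ (cocompact (EucSp d)) (nhds (0 : EReal))

/-- The normalization `∫ a dx = (∫_Γ exp[(s-1) ∑_{u∈γ} φ(u)] dμ(γ))⁻¹`. -/
def NormalizedA {d : ℕ} (s : ℝ) (a : EucSp d → ℝ) (φ : EucSp d → EReal)
    (μ : Measure (Config d)) : Prop :=
  (∫ x : EucSp d, a x) = (∫ γ, rexp (((s - 1 : ℝ) : EReal) * totPhi φ γ.1) ∂μ)⁻¹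

section ConfigMeasurability

variable {d : ℕ}

instance Config.countable_coe (γ : Config d) : Countable γ.1 := by
  have h : γ.1 = ⋃ n : ℕ, γ.1 ∩ Metric.closedBall 0 n := by
    rw [← inter_iUnion, Metric.iUnion_closedBall_nat, inter_univ]
  have : γ.1.Countable := by
    rw [h]
    exact countable_iUnion fun n => (γ.2 _ (isCompact_closedBall _ _)).countable
  exact this.to_subtype

/-- The counting measure of a configuration. -/
def ptMeas (γ : Config d) : Measure (EucSp d) := Measure.sum fun x : γ.1 => Measure.dirac x.1

lemma lintegral_ptMeas (γ : Config d) (G : EucSp d → ℝ≥0∞) :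
    ∫⁻ x, G x ∂(ptMeas γ) = ∑' x : γ.1, G x.1 := by
  simp [ptMeas, lintegral_sum_measure]

lemma ptMeas_apply (γ : Config d) {B : Set (EucSp d)} (hB : MeasurableSet B) :
    ptMeas γ B = ∑' x : γ.1, B.indicator (fun _ => (1 : ℝ≥0∞)) x.1 := by
  rw [← lintegral_indicator_one hB, lintegral_ptMeas]; rfl

lemma ptMeas_eq_encard (γ : Config d) {B : Set (EucSp d)} (hB : MeasurableSet B) :
    ptMeas γ B = ((γ.1 ∩ B).encard : ℝ≥0∞) := by
  rw [ptMeas_apply γ hB, ← ENNReal.tsum_set_one, tsum_subtype (γ.1 ∩ B) (fun _ => (1 : ℝ≥0∞)),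
    tsum_subtype γ.1 (B.indicator (fun _ => (1 : ℝ≥0∞))), Set.indicator_indicator]

lemma measurable_encard_inter {B : Set (EucSp d)} (hB : MeasurableSet B) :
    Measurable[Config.instMS d, ⊤] (fun γ : Config d => (γ.1 ∩ B).encard) := by
  have : MeasurableSpace.comap (fun γ : Config d => (γ.1 ∩ B).encard) (⊤ : MeasurableSpace ℕ∞)
      ≤ Config.instMS d :=
    le_iSup₂_of_le (f := fun (B : Set (EucSp d)) (_ : MeasurableSet B) =>
      MeasurableSpace.comap (fun γ : Config d => (γ.1 ∩ B).encard) (⊤ : MeasurableSpace ℕ∞))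
      B hB le_rfl
  exact fun s hs => this _ ⟨s, hs, rfl⟩

lemma measurable_ptMeas : Measurable (ptMeas : Config d → Measure (EucSp d)) := by
  refine Measure.measurable_of_measurable_coe _ fun B hB => ?_
  simp_rw [ptMeas_eq_encard _ hB]
  intro s _
  exact measurable_encard_inter hB (t := ENat.toENNReal ⁻¹' s) trivial

lemma measurable_config_of_ptMeas {α : Type*} [MeasurableSpace α] {Γ : α → Config d}
    (h : ∀ B, MeasurableSet B → Measurable fun a => ptMeas (Γ a) B) : Measurable Γ := by
  have key : ∀ B : Set (EucSp d), MeasurableSet B → ‹MeasurableSpace α› ≥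
      MeasurableSpace.comap Γ (MeasurableSpace.comap (fun γ : Config d => (γ.1 ∩ B).encard) ⊤) := by
    rintro B hB _ ⟨_, ⟨s, -, rfl⟩, rfl⟩
    have hs : MeasurableSet (ENat.toENNReal '' s) := (s.to_countable.image _).measurableSet
    convert h B hB hs using 1
    ext a
    simp only [mem_preimage, mem_image, ptMeas_eq_encard _ hB, ENat.toENNReal_inj,
      exists_eq_right]
  rw [measurable_iff_comap_le]
  unfold Config.instMS
  simp only [MeasurableSpace.comap_iSup]
  exact iSup₂_le key

/-- The counting measures as a kernel. -/
def ptKernel (d : ℕ) : ProbabilityTheory.Kernel (Config d) (EucSp d) := ⟨ptMeas, measurable_ptMeas⟩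

lemma ptKernel_apply (γ : Config d) : ptKernel d γ = ptMeas γ := rfl

/-- Points whose norm lies in `[n, n+1)`. -/
def shell (d n : ℕ) : Set (EucSp d) := {x | ⌊‖x‖⌋₊ = n}

lemma measurableSet_shell (n : ℕ) : MeasurableSet (shell d n) :=
  (Nat.measurable_floor.comp measurable_norm) (measurableSet_singleton n)

lemma ptMeas_shell_lt_top (γ : Config d) (n : ℕ) : ptMeas γ (shell d n) < ⊤ := by
  rw [ptMeas_eq_encard _ (measurableSet_shell n), ENat.toENNReal_lt_top]
  refine ((γ.2 (Metric.closedBall 0 (n + 1)) (isCompact_closedBall _ _)).subset ?_).encard_lt_top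
  refine inter_subset_inter_right _ fun x hx => ?_
  rw [mem_closedBall_zero_iff, ← (show ⌊‖x‖⌋₊ = n from hx)]
  exact (Nat.lt_floor_add_one _).le

lemma kernel_eq_sum_restrict_fiber {α β : Type*} [MeasurableSpace α] [MeasurableSpace β]
    (κ : ProbabilityTheory.Kernel α β) {s : ℕ → Set β} (hs : ∀ n, MeasurableSet (s n))
    (hd : Pairwise (Function.onFun Disjoint s)) (hU : ⋃ n, s n = univ) :
    κ = ProbabilityTheory.Kernel.sum fun n => κ.restrict (hs n) := by
  ext1 a
  rw [ProbabilityTheory.Kernel.sum_apply]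
  simp_rw [ProbabilityTheory.Kernel.restrict_apply]
  rw [← Measure.restrict_iUnion hd hs, hU, Measure.restrict_univ]

instance ptKernel_isSFinite : ProbabilityTheory.IsSFiniteKernel (ptKernel d) := by
  have hsh : ptKernel d = ProbabilityTheory.Kernel.sum fun n =>
      (ptKernel d).restrict (measurableSet_shell n) := by
    refine kernel_eq_sum_restrict_fiber _ _ ?_ ?_
    · intro m n hmn
      exact Set.disjoint_left.2 fun x hx hx' => hmn (hx.symm.trans hx')
    · exact eq_univ_of_forall fun x => mem_iUnion.2 ⟨⌊‖x‖⌋₊, rfl⟩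
  rw [hsh]
  refine ProbabilityTheory.Kernel.isSFiniteKernel_sum (hκs := fun n => ?_)
  set κ := (ptKernel d).restrict (measurableSet_shell n) with hκ
  have hfin : ∀ γ, κ γ univ < ⊤ := fun γ => by
    rw [hκ, ProbabilityTheory.Kernel.restrict_apply, Measure.restrict_apply_univ]
    exact ptMeas_shell_lt_top γ n
  let t : ℕ → Set (Config d) := fun m => {γ | ⌊(κ γ univ).toReal⌋₊ = m}
  have hmeas : Measurable fun γ => ⌊(κ γ univ).toReal⌋₊ :=
    Nat.measurable_floor.comp (κ.measurable_coe MeasurableSet.univ).ennreal_toReal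
  have ht : ∀ m, MeasurableSet (t m) := fun m => hmeas (measurableSet_singleton m)
  have hsum : κ = ProbabilityTheory.Kernel.sum fun m =>
      ProbabilityTheory.Kernel.piecewise (ht m) κ 0 := by
    ext1 γ
    refine Measure.ext fun B hB => ?_
    rw [ProbabilityTheory.Kernel.sum_apply' _ _ hB]
    rw [tsum_eq_single ⌊(κ γ univ).toReal⌋₊]
    · rw [ProbabilityTheory.Kernel.piecewise_apply, if_pos (by rfl)]
    · intro m hm
      rw [ProbabilityTheory.Kernel.piecewise_apply, if_neg (fun h : γ ∈ t m => hm (Eq.symm h))]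
      simp
  rw [hsum]
  refine ProbabilityTheory.Kernel.isSFiniteKernel_sum (hκs := fun m => ?_)
  have : ProbabilityTheory.IsFiniteKernel (ProbabilityTheory.Kernel.piecewise (ht m) κ 0) := by
    refine ⟨⟨m + 1, by exact_mod_cast ENNReal.natCast_lt_top (m + 1), fun γ => ?_⟩⟩
    rw [ProbabilityTheory.Kernel.piecewise_apply]
    split_ifs with h
    · have h1 := (Nat.lt_floor_add_one (κ γ univ).toReal).le
      rw [show ⌊(κ γ univ).toReal⌋₊ = m from h] at h1
      rw [← ENNReal.ofReal_toReal (hfin γ).ne]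
      refine (ENNReal.ofReal_le_ofReal h1).trans_eq ?_
      rw [ENNReal.ofReal_add (by positivity) zero_le_one]; simp
    · simp
  infer_instance

lemma measurable_tsum_config {α : Type*} [MeasurableSpace α] {Γ : α → Config d}
    (hΓ : Measurable Γ) {G : α → EucSp d → ℝ≥0∞} (hG : Measurable (Function.uncurry G)) :
    Measurable fun a => ∑' u : (Γ a).1, G a u.1 := by
  have := Measurable.lintegral_kernel_prod_right (κ := (ptKernel d).comap Γ hΓ) hG
  simpa only [ProbabilityTheory.Kernel.comap_apply, ptKernel_apply, lintegral_ptMeas] using this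

lemma measurableSet_summable_config {α : Type*} [MeasurableSpace α] {Γ : α → Config d}
    (hΓ : Measurable Γ) {G : α → EucSp d → ℝ} (hG : Measurable (Function.uncurry G)) :
    MeasurableSet {a | Summable fun u : (Γ a).1 => G a u.1} := by
  have : {a | Summable fun u : (Γ a).1 => G a u.1} =
      {a | ∑' u : (Γ a).1, ENNReal.ofReal |G a u.1| < ⊤} := by
    ext a
    simp only [mem_ofPred_eq]
    constructor
    · intro h
      exact h.abs.tsum_ofReal_lt_top
    · intro h
      have := ENNReal.summable_toReal h.ne
      refine Summable.of_abs ?_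
      simpa [ENNReal.toReal_ofReal] using this
  rw [this]
  exact (measurable_tsum_config hΓ (G := fun a u => ENNReal.ofReal |G a u|)
    (by exact (measurable_norm.comp hG).ennreal_ofReal)) measurableSet_Iio

lemma measurable_tsum_config_real {α : Type*} [MeasurableSpace α] {Γ : α → Config d}
    (hΓ : Measurable Γ) {G : α → EucSp d → ℝ} (hG : Measurable (Function.uncurry G)) :
    Measurable fun a => ∑' u : (Γ a).1, G a u.1 := by
  have : (fun a => ∑' u : (Γ a).1, G a u.1) = fun a =>
      if Summable (fun u : (Γ a).1 => G a u.1) then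
        (∑' u : (Γ a).1, ENNReal.ofReal (G a u.1)).toReal -
          (∑' u : (Γ a).1, ENNReal.ofReal (-G a u.1)).toReal else 0 := by
    ext a
    split_ifs with h
    · have h1 : Summable fun u : (Γ a).1 => max (G a u.1) 0 :=
        Summable.of_nonneg_of_le (fun _ => le_max_right _ _)
          (fun _ => max_le (le_abs_self _) (abs_nonneg _)) h.abs
      have h2 : Summable fun u : (Γ a).1 => max (-G a u.1) 0 :=
        Summable.of_nonneg_of_le (fun _ => le_max_right _ _)
          (fun _ => max_le (neg_le_abs _) (abs_nonneg _)) h.abs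
      rw [ENNReal.tsum_toReal_eq (fun _ => ENNReal.ofReal_ne_top),
        ENNReal.tsum_toReal_eq (fun _ => ENNReal.ofReal_ne_top)]
      simp_rw [ENNReal.toReal_ofReal']
      rw [← h1.tsum_sub h2]
      congr 1; ext u
      rcases le_total (G a u.1) 0 with h | h
      · rw [max_eq_right h, max_eq_left (by linarith)]; ring
      · rw [max_eq_left h, max_eq_right (by linarith)]; ring
    · exact tsum_eq_zero_of_not_summable h
  rw [this]
  refine Measurable.ite (measurableSet_summable_config hΓ hG) (Measurable.sub ?_ ?_)
    measurable_const
  · exact (measurable_tsum_config hΓ (G := fun a u => ENNReal.ofReal (G a u))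
      hG.ennreal_ofReal).ennreal_toReal
  · exact (measurable_tsum_config hΓ (G := fun a u => ENNReal.ofReal (-G a u))
      hG.neg.ennreal_ofReal).ennreal_toReal

lemma measurableSet_mem_config :
    MeasurableSet {q : Config d × EucSp d | q.2 ∈ q.1.1} := by
  have h := measurable_tsum_config (α := Config d × EucSp d) measurable_fst
    (G := fun q u => ({q | q.1 = q.2} : Set (EucSp d × EucSp d)).indicator 1 (q.2, u))
    (((measurable_one.indicator measurableSet_diagonal)).comp
      ((measurable_snd.comp measurable_fst).prodMk measurable_snd))
  have : {q : Config d × EucSp d | q.2 ∈ q.1.1} = {q | ∑' u : q.1.1,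
      ({q | q.1 = q.2} : Set (EucSp d × EucSp d)).indicator (1 : EucSp d × EucSp d → ℝ≥0∞) (q.2, u.1) ≠ 0} := by
    ext ⟨γ, x⟩
    simp only [mem_ofPred_eq, ne_eq, ENNReal.tsum_eq_zero, not_forall]
    constructor
    · intro hx
      exact ⟨⟨x, hx⟩, by simp⟩
    · rintro ⟨⟨u, hu⟩, h⟩
      by_contra hx
      apply h
      apply Set.indicator_of_notMem
      rintro (rfl : x = u)
      exact hx hu
  rw [this]
  exact h (measurableSet_singleton 0).compl

lemma tsum_ins (γ : Config d) {x : EucSp d} (hx : x ∉ γ.1) (G : EucSp d → ℝ≥0∞) :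
    ∑' u : (γ.ins x).1, G u.1 = G x + ∑' u : γ.1, G u.1 := by
  have h : (γ.ins x).1 = {x} ∪ γ.1 := rfl
  rw [h, ENNReal.summable.tsum_union_disjoint (f := G) (by simpa using hx) ENNReal.summable]
  simp

lemma ins_of_mem (γ : Config d) {x : EucSp d} (hx : x ∈ γ.1) : γ.ins x = γ :=
  Subtype.ext (Set.insert_eq_of_mem hx)

lemma measurable_ins : Measurable fun q : Config d × EucSp d => q.1.ins q.2 := by
  refine measurable_config_of_ptMeas fun B hB => ?_
  have : (fun q : Config d × EucSp d => ptMeas (q.1.ins q.2) B) = fun q =>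
      (if q.2 ∈ q.1.1 then 0 else B.indicator (fun _ => (1 : ℝ≥0∞)) q.2) + ptMeas q.1 B := by
    ext ⟨γ, x⟩
    simp only
    split_ifs with h
    · rw [ins_of_mem γ h, zero_add]
    · rw [ptMeas_apply _ hB, ptMeas_apply _ hB, tsum_ins γ h]
  rw [this]
  refine Measurable.add (Measurable.ite measurableSet_mem_config measurable_const ?_) ?_
  · exact (measurable_const.indicator hB).comp measurable_snd
  · exact ((Measure.measurable_coe hB).comp measurable_ptMeas).comp measurable_fst

lemma tsum_del (γ : Config d) (x : EucSp d) (G : EucSp d → ℝ≥0∞) :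
    ∑' u : (γ.del x).1, G u.1 = ∑' u : γ.1, ({x}ᶜ : Set (EucSp d)).indicator G u.1 := by
  have h : (γ.del x).1 = γ.1 ∩ {x}ᶜ := rfl
  rw [h, tsum_subtype (γ.1 ∩ {x}ᶜ) G, tsum_subtype γ.1 (({x}ᶜ : Set (EucSp d)).indicator G),
    Set.indicator_indicator]

lemma measurable_del : Measurable fun q : Config d × EucSp d => q.1.del q.2 := by
  refine measurable_config_of_ptMeas fun B hB => ?_
  simp_rw [ptMeas_apply _ hB, tsum_del]
  refine measurable_tsum_config measurable_fst
    (G := fun (q : Config d × EucSp d) u => ({q.2}ᶜ : Set (EucSp d)).indicator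
      (B.indicator fun _ => (1 : ℝ≥0∞)) u) ?_
  have : (Function.uncurry fun (q : Config d × EucSp d) u => ({q.2}ᶜ : Set (EucSp d)).indicator
      (B.indicator fun _ => (1 : ℝ≥0∞)) u) = fun r : (Config d × EucSp d) × EucSp d =>
      if r.2 = r.1.2 then 0 else B.indicator (fun _ => (1 : ℝ≥0∞)) r.2 := by
    ext r
    simp only [Function.uncurry, Set.indicator_apply, mem_compl_iff, mem_singleton_iff]
    split_ifs <;> simp_all
  rw [this]
  refine Measurable.ite ?_ measurable_const ((measurable_const.indicator hB).comp measurable_snd)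
  exact measurableSet_eq_fun measurable_snd (measurable_snd.comp measurable_fst)

lemma del_ins (γ : Config d) {x : EucSp d} (hx : x ∉ γ.1) : (γ.ins x).del x = γ := by
  apply Subtype.ext
  change insert x γ.1 \ {x} = γ.1
  simp [hx]

lemma ins_del_of_ne (γ : Config d) {x y : EucSp d} (h : x ≠ y) :
    (γ.ins x).del y = (γ.del y).ins x := by
  apply Subtype.ext
  change insert x γ.1 \ {y} = insert x (γ.1 \ {y})
  rw [Set.insert_sdiff_of_notMem]
  simpa using h

lemma volume_config (γ : Config d) (hd : 0 < d) : (volume : Measure (EucSp d)) γ.1 = 0 := by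
  have : Nonempty (Fin d) := ⟨⟨0, hd⟩⟩
  exact (Set.countable_coe_iff.1 γ.countable_coe).measure_zero _

lemma ae_notMem_config (hd : 0 < d) (γ : Config d) :
    ∀ᵐ x ∂(volume : Measure (EucSp d)), x ∉ γ.1 :=
  measure_eq_zero_iff_ae_notMem.1 (volume_config γ hd)

end ConfigMeasurability

section TupleSums

variable {d : ℕ}

lemma measurable_tsum_tuples (n : ℕ) : ∀ {α : Type} [MeasurableSpace α] {Γ : α → Config d}
    (_ : Measurable Γ) {G : α → (Fin n → EucSp d) → ℝ≥0∞} (_ : Measurable (Function.uncurry G)),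
    Measurable fun a => ∑' p : Fin n → (Γ a).1, G a (fun i => (p i).1) := by
  induction n with
  | zero =>
    intro α _ Γ hΓ G hG
    have : (fun a => ∑' p : Fin 0 → (Γ a).1, G a (fun i => (p i).1)) = fun a => G a Fin.elim0 := by
      ext a
      rw [tsum_fintype, Fintype.sum_unique]
      congr 1
      exact Subsingleton.elim _ _
    rw [this]
    exact hG.comp (measurable_id.prodMk measurable_const)
  | succ n ih =>
    intro α _ Γ hΓ G hG
    have h1 := ih (α := α × EucSp d) (hΓ.comp measurable_fst)
      (G := fun q p => G q.1 (Fin.cons q.2 p)) (by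
        refine hG.comp ((measurable_fst.comp measurable_fst).prodMk ?_)
        refine measurable_pi_iff.2 fun i => ?_
        refine Fin.cases ?_ (fun j => ?_) i
        · exact measurable_snd.comp measurable_fst
        · exact (measurable_pi_apply j).comp measurable_snd)
    have h2 := measurable_tsum_config hΓ (G := fun a u => ∑' p : Fin n → (Γ a).1,
      G a (Fin.cons u fun i => (p i).1)) h1
    convert h2 using 2 with a
    rw [← (Fin.consEquiv fun _ => ((Γ a).1 : Type)).tsum_eq, ENNReal.tsum_prod']
    congr 1; ext u; congr 1; ext p; congr 1; ext i : 1
    refine Fin.cases ?_ (fun j => ?_) i <;> simp [Fin.consEquiv]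

/-- Tuples of distinct points of `γ` as injective maps into `γ`. -/
def injTuplesEquiv (n : ℕ) (γ : Set (EucSp d)) :
    {p : Fin n → γ | Function.Injective p} ≃ injTuples n γ where
  toFun p := ⟨fun i => (p.1 i).1, Subtype.val_injective.comp p.2, fun i => (p.1 i).2⟩
  invFun p := ⟨fun i => ⟨p.1 i, p.2.2 i⟩, fun _ _ h => p.2.1 (congrArg Subtype.val h)⟩
  left_inv _ := rfl
  right_inv _ := rfl

lemma tsum_injTuples (n : ℕ) (γ : Set (EucSp d)) (f : (Fin n → EucSp d) → ℝ≥0∞) :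
    ∑' p : injTuples n γ, f p.1 =
      ∑' p : Fin n → γ, {x | Function.Injective x}.indicator f (fun i => (p i).1) := by
  rw [← (injTuplesEquiv n γ).tsum_eq]
  change ∑' p : {p : Fin n → γ | Function.Injective p}, (fun p => f fun i => (p i).1) p.1 = _
  rw [tsum_subtype {p : Fin n → γ | Function.Injective p} (fun p => f fun i => (p i).1)]
  congr 1; ext p
  simp only [Set.indicator_apply, mem_ofPred_eq]
  have : Function.Injective (fun i => (p i).1) ↔ Function.Injective p :=
    Subtype.val_injective.of_comp_iff p
  simp [this]

lemma measurableSet_injective (n : ℕ) :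
    MeasurableSet {x : Fin n → EucSp d | Function.Injective x} := by
  have : {x : Fin n → EucSp d | Function.Injective x} =
      ⋂ i, ⋂ j, {x | x i = x j → i = j} := by
    ext x; simp [Function.Injective]
  rw [this]
  refine MeasurableSet.iInter fun i => MeasurableSet.iInter fun j => ?_
  by_cases h : i = j
  · simp [h]
  · simp only [h, imp_false]
    exact (measurableSet_eq_fun (measurable_pi_apply i) (measurable_pi_apply j)).compl

lemma measurable_tsum_injTuples {n : ℕ} {f : (Fin n → EucSp d) → ℝ≥0∞} (hf : Measurable f) :
    Measurable fun γ : Config d => ∑' p : injTuples n γ.1, f p.1 := by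
  simp_rw [tsum_injTuples]
  exact measurable_tsum_tuples n measurable_id
    (G := fun _ => {x | Function.Injective x}.indicator f)
    ((hf.indicator (measurableSet_injective n)).comp measurable_snd)

/-- An injective tuple is an enumeration of its range. -/
def sigmaEnumMap (n : ℕ) (V : Type*) :
    (Σ S : {S : Finset V // S.card = n}, Fin n ≃ S.1) → {p : Fin n → V | Function.Injective p} :=
  fun q => ⟨fun i => (q.2 i).1, Subtype.val_injective.comp q.2.injective⟩

lemma sigmaEnumMap_bijective (n : ℕ) (V : Type*) : Function.Bijective (sigmaEnumMap n V) := by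
  constructor
  · rintro ⟨⟨S, hS⟩, e⟩ ⟨⟨S', hS'⟩, e'⟩ h
    have h1 : ∀ i, (e i).1 = (e' i).1 := fun i => congrFun (congrArg Subtype.val h) i
    have hSS : S = S' := by
      ext v
      constructor
      · intro hv
        have := h1 (e.symm ⟨v, hv⟩)
        rw [e.apply_symm_apply] at this
        simp only at this
        rw [this]; exact (e' _).2
      · intro hv
        have := h1 (e'.symm ⟨v, hv⟩)
        rw [e'.apply_symm_apply] at this
        simp only at this
        rw [← this]; exact (e _).2
    subst hSS
    have : e = e' := Equiv.ext fun i => Subtype.ext (h1 i)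
    subst this
    rfl
  · rintro ⟨p, hp⟩
    have hp' : Function.Injective p := hp
    refine ⟨⟨⟨Finset.univ.image p, by simp [Finset.card_image_of_injective _ hp']⟩,
      Equiv.ofBijective (fun i => ⟨p i, by simp⟩) ⟨fun i j h => hp' (congrArg Subtype.val h), ?_⟩⟩,
      rfl⟩
    rintro ⟨v, hv⟩
    obtain ⟨i, -, rfl⟩ := Finset.mem_image.1 hv
    exact ⟨i, rfl⟩

lemma tsum_injTuples_prod (n : ℕ) (γ : Set (EucSp d)) (θ : ℝ → ℝ≥0∞) (w : EucSp d → ℝ) :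
    ∑' p : injTuples n γ, θ (∏ i, w (p.1 i)) =
      n.factorial * ∑' S : {S : Finset γ // S.card = n}, θ (∏ u ∈ S.1, w u.1) := by
  rw [← (injTuplesEquiv n γ).tsum_eq,
    ← (Equiv.ofBijective _ (sigmaEnumMap_bijective n γ)).tsum_eq, ENNReal.tsum_sigma',
    ← ENNReal.tsum_mul_left]
  congr 1; ext ⟨S, hS⟩
  have : ∀ e : Fin n ≃ S, θ (∏ i, w (((injTuplesEquiv n γ)
      ((Equiv.ofBijective _ (sigmaEnumMap_bijective n γ)) ⟨⟨S, hS⟩, e⟩)).1 i)) =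
      θ (∏ u ∈ S, w u.1) := by
    intro e
    congr 1
    rw [← Finset.prod_coe_sort S (fun u => w u.1)]
    exact Equiv.prod_comp e (fun u : S => w u.1.1)
  simp_rw [this]
  rw [tsum_fintype, Finset.sum_const, Finset.card_univ, nsmul_eq_mul,
    Fintype.card_equiv (Fintype.equivFinOfCardEq (by simp [hS])).symm]
  simp

lemma tsum_finset_eq_tsum_card {V : Type*} (F : Finset V → ℝ≥0∞) :
    ∑' S, F S = ∑' n : ℕ, ∑' S : {S : Finset V // S.card = n}, F S.1 := by
  rw [← (Equiv.sigmaFiberEquiv (Finset.card : Finset V → ℕ)).tsum_eq, ENNReal.tsum_sigma']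
  rfl

lemma tsum_finset_prod_eq (γ : Set (EucSp d)) (θ : ℝ → ℝ≥0∞) (w : EucSp d → ℝ) :
    ∑' S : Finset γ, θ (∏ u ∈ S, w u.1) =
      ∑' n : ℕ, (n.factorial : ℝ≥0∞)⁻¹ * ∑' p : injTuples n γ, θ (∏ i, w (p.1 i)) := by
  rw [tsum_finset_eq_tsum_card]
  congr 1; ext n
  rw [tsum_injTuples_prod, ← mul_assoc, ENNReal.inv_mul_cancel, one_mul]
  · exact_mod_cast n.factorial_ne_zero
  · exact ENNReal.natCast_ne_top _

end TupleSums

section Correlation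

variable {d : ℕ}

/-- Correlation functions of a probability measure obeying the Ruelle bound, with the convention
that the correlation function of order zero equals one. -/
structure CorrData (μ : Measure (Config d)) (k : ∀ n : ℕ, (Fin n → EucSp d) → ℝ) (ξ : ℝ) :
    Prop where
  prob : IsProbabilityMeasure μ
  meas : ∀ n, Measurable (k n)
  nonneg : ∀ n x, 0 ≤ k n x
  bound : ∀ n x, k n x ≤ ξ ^ n
  xi_pos : 0 < ξ
  zero : ∀ x, k 0 x = 1
  ti : TransInvFns k
  corr : ∀ n, ∀ f : (Fin n → EucSp d) → ℝ≥0∞, Measurable f →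
    (∀ (σ : Equiv.Perm (Fin n)) (x : Fin n → EucSp d), f (x ∘ σ) = f x) →
    ∫⁻ γ, ∑' p : injTuples n γ.1, f p.1 ∂μ
      = ∫⁻ x : Fin n → EucSp d, f x * ENNReal.ofReal (k n x)

/-- Replace the value at order zero by one. -/
def normK (k : ∀ n : ℕ, (Fin n → EucSp d) → ℝ) : ∀ n : ℕ, (Fin n → EucSp d) → ℝ :=
  fun n x => if n = 0 then 1 else k n x

lemma normK_of_pos (k : ∀ n : ℕ, (Fin n → EucSp d) → ℝ) {n : ℕ} (hn : 0 < n) :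
    normK k n = k n := by
  ext x; simp [normK, hn.ne']

lemma Setting.corrData {s z B ξ : ℝ} {φ : EucSp d → EReal} {μ : Measure (Config d)}
    {k u : ∀ n : ℕ, (Fin n → EucSp d) → ℝ} (h : Setting d s z B ξ φ μ k u) :
    CorrData μ (normK k) ξ where
  prob := h.prob
  meas n := by
    rcases n.eq_zero_or_pos with rfl | hn
    · exact measurable_const
    · rw [normK_of_pos k hn]; exact (h.corr.1 n).1
  nonneg n x := by
    rcases n.eq_zero_or_pos with rfl | hn
    · simp [normK]
    · rw [normK_of_pos k hn]; exact (h.corr.1 n).2.1 x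
  bound n x := by
    rcases n.eq_zero_or_pos with rfl | hn
    · simp [normK]
    · rw [normK_of_pos k hn]; exact h.ruelle n hn x
  xi_pos := h.hξ
  zero x := by simp [normK]
  ti n a x := by
    rcases n.eq_zero_or_pos with rfl | hn
    · simp [normK]
    · rw [normK_of_pos k hn]; exact h.ti n a x
  corr n f hf hs := by
    rcases n.eq_zero_or_pos with rfl | hn
    · have := h.prob
      have h1 : ∀ γ : Config d, ∑' p : injTuples 0 γ.1, f p.1 = f default := by
        intro γ
        have : Unique (injTuples 0 γ.1) :=
          { default := ⟨default, fun i => i.elim0, fun i => i.elim0⟩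
            uniq := fun p => Subtype.ext (Subsingleton.elim _ _) }
        rw [tsum_fintype, Fintype.sum_unique]
        congr 1
        exact Subsingleton.elim _ _
      simp_rw [h1]
      rw [lintegral_const, measure_univ, mul_one]
      have h2 : ∀ x : Fin 0 → EucSp d, f x * ENNReal.ofReal (normK k 0 x) = f default := by
        intro x
        rw [Subsingleton.elim x default]; simp [normK]
      simp_rw [h2]
      rw [lintegral_const, volume_pi, Measure.pi_univ]
      simp
    · rw [normK_of_pos k hn]; exact h.corr.2 n hn f hf hs

/-- The Ruelle-type expansion of `∫ ∏_{u ∈ γ} (1 + g u) μ(dγ)`. -/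
def Zexp (k : ∀ n : ℕ, (Fin n → EucSp d) → ℝ) (g : EucSp d → ℝ) : ℝ :=
  ∑' n : ℕ, (n.factorial : ℝ)⁻¹ * ∫ x : Fin n → EucSp d, (∏ i, g (x i)) * k n x

variable {μ : Measure (Config d)} {k : ∀ n : ℕ, (Fin n → EucSp d) → ℝ} {ξ : ℝ}

lemma CorrData.integrable_term (h : CorrData μ k ξ) (n : ℕ) {F : (Fin n → EucSp d) → ℝ}
    (hF : Integrable F) : Integrable fun x => F x * k n x := by
  refine hF.mul_bdd (c := ξ ^ n) (h.meas n).aestronglyMeasurable (ae_of_all _ fun x => ?_)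
  rw [Real.norm_of_nonneg (h.nonneg n x)]
  exact h.bound n x

lemma integrable_tensor {g : EucSp d → ℝ} (hg : Integrable g) (n : ℕ) :
    Integrable fun x : Fin n → EucSp d => ∏ i, g (x i) := by
  rw [volume_pi]
  exact Integrable.fintype_prod (f := fun _ => g) fun _ => hg

lemma CorrData.lintegral_finset_prod (h : CorrData μ k ξ) {g : EucSp d → ℝ} (hg : Measurable g)
    {θ : ℝ → ℝ≥0∞} (hθ : Measurable θ) :
    ∫⁻ γ, ∑' S : Finset γ.1, θ (∏ u ∈ S, g u.1) ∂μ =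
      ∑' n : ℕ, (n.factorial : ℝ≥0∞)⁻¹ *
        ∫⁻ x : Fin n → EucSp d, θ (∏ i, g (x i)) * ENNReal.ofReal (k n x) := by
  have hm : ∀ n, Measurable fun x : Fin n → EucSp d => θ (∏ i, g (x i)) := fun n =>
    hθ.comp (Finset.measurable_prod _ fun i _ => hg.comp (measurable_pi_apply i))
  simp_rw [tsum_finset_prod_eq]
  rw [lintegral_tsum fun n =>
    ((measurable_tsum_injTuples (hm n)).const_mul _).aemeasurable]
  congr 1; ext n
  rw [lintegral_const_mul _ (measurable_tsum_injTuples (hm n)), h.corr n _ (hm n)]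
  intro σ x
  congr 1
  exact Equiv.prod_comp σ fun i => g (x i)

lemma measurable_tsum_finset_prod {g : EucSp d → ℝ} (hg : Measurable g)
    {θ : ℝ → ℝ≥0∞} (hθ : Measurable θ) :
    Measurable fun γ : Config d => ∑' S : Finset γ.1, θ (∏ u ∈ S, g u.1) := by
  simp_rw [tsum_finset_prod_eq]
  refine Measurable.tsum fun n => ?_
  have : Measurable fun x : Fin n → EucSp d => θ (∏ i, g (x i)) :=
    hθ.comp (Finset.measurable_prod _ fun i _ => hg.comp (measurable_pi_apply i))
  exact (measurable_tsum_injTuples this).const_mul _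

lemma CorrData.norm_term_le (h : CorrData μ k ξ) {g : EucSp d → ℝ} (hgi : Integrable g) (n : ℕ) :
    ∫ x : Fin n → EucSp d, |(∏ i, g (x i)) * k n x| ≤ (ξ * ∫ x, |g x|) ^ n := by
  have h1 : ∫ x : Fin n → EucSp d, ∏ i, |g (x i)| = (∫ x, |g x|) ^ n := by
    rw [integral_fintype_prod_volume_eq_pow (fun x => |g x|), Fintype.card_fin]
  rw [mul_pow, ← h1, ← integral_const_mul]
  refine integral_mono (h.integrable_term n (integrable_tensor hgi n)).abs
    ((integrable_tensor hgi.abs n).const_mul _) fun x => ?_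
  simp only
  rw [abs_mul, Finset.abs_prod, abs_of_nonneg (h.nonneg n x), mul_comm]
  exact mul_le_mul_of_nonneg_right (h.bound n x) (Finset.prod_nonneg fun _ _ => abs_nonneg _)

lemma CorrData.lintegral_finset_abs_le (h : CorrData μ k ξ) {g : EucSp d → ℝ} (hg : Measurable g)
    (hgi : Integrable g) :
    ∫⁻ γ, ∑' S : Finset γ.1, ENNReal.ofReal |∏ u ∈ S, g u.1| ∂μ ≤
      ENNReal.ofReal (Real.exp (ξ * ∫ x, |g x|)) := by
  rw [h.lintegral_finset_prod hg (θ := fun t => ENNReal.ofReal |t|)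
    (measurable_norm.ennreal_ofReal), Real.exp_eq_exp_ℝ, NormedSpace.exp_eq_tsum_div,
    ENNReal.ofReal_tsum_of_nonneg (fun n => div_nonneg (pow_nonneg (mul_nonneg h.xi_pos.le
      (integral_nonneg fun _ => abs_nonneg _)) _) (by positivity))
      (NormedSpace.expSeries_div_summable (ξ * ∫ x, |g x|))]
  refine ENNReal.tsum_le_tsum fun n => ?_
  have h1 : ∫⁻ x : Fin n → EucSp d, ENNReal.ofReal |∏ i, g (x i)| * ENNReal.ofReal (k n x) =
      ENNReal.ofReal (∫ x : Fin n → EucSp d, |(∏ i, g (x i)) * k n x|) := by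
    rw [ofReal_integral_eq_lintegral_ofReal
      (h.integrable_term n (integrable_tensor hgi n)).abs (ae_of_all _ fun _ => abs_nonneg _)]
    congr 1; ext x
    rw [abs_mul, abs_of_nonneg (h.nonneg n x), ENNReal.ofReal_mul (abs_nonneg _)]
  rw [h1, div_eq_inv_mul, ENNReal.ofReal_mul (by positivity),
    ENNReal.ofReal_inv_of_pos (by positivity), ENNReal.ofReal_natCast]
  gcongr
  exact h.norm_term_le hgi n

lemma exp_tsum_le_tsum_finset {V : Type*} (b : V → ℝ) :
    ENNReal.ofReal (Real.exp (∑' v, b v)) ≤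
      ∑' S : Finset V, ENNReal.ofReal |∏ v ∈ S, (Real.exp (b v) - 1)| := by
  set R := ∑' S : Finset V, ENNReal.ofReal |∏ v ∈ S, (Real.exp (b v) - 1)| with hR
  rcases eq_or_ne R ⊤ with htop | htop
  · rw [htop]; exact le_top
  have habs : Summable fun S : Finset V => |∏ v ∈ S, (Real.exp (b v) - 1)| := by
    have := ENNReal.summable_toReal htop
    simpa [ENNReal.toReal_ofReal] using this
  by_cases hb : Summable b
  · have h1 := hasProd_one_add_of_hasSum_prod habs.of_abs.hasSum
    have h2 : HasProd (fun v => 1 + (Real.exp (b v) - 1)) (Real.exp (∑' v, b v)) := by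
      simpa [Function.comp_def] using hb.hasSum.rexp
    rw [h2.unique h1, hR, ← ENNReal.ofReal_tsum_of_nonneg (fun _ => abs_nonneg _) habs]
    refine ENNReal.ofReal_le_ofReal ?_
    exact habs.of_abs.tsum_le_tsum (fun _ => le_abs_self _) habs
  · rw [tsum_eq_zero_of_not_summable hb]
    refine le_trans ?_ (ENNReal.le_tsum ∅)
    simp

/-- The exponential moment bound. -/
lemma CorrData.lintegral_exp_le (h : CorrData μ k ξ) {b : EucSp d → ℝ} (hb : Measurable b)
    (hbi : Integrable fun x => Real.exp (b x) - 1) :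
    ∫⁻ γ, ENNReal.ofReal (Real.exp (∑' u : γ.1, b u.1)) ∂μ ≤
      ENNReal.ofReal (Real.exp (ξ * ∫ x, |Real.exp (b x) - 1|)) :=
  (lintegral_mono fun _ => exp_tsum_le_tsum_finset _).trans
    (h.lintegral_finset_abs_le (hb.exp.sub_const 1) hbi)

lemma CorrData.integral_exp_eq (h : CorrData μ k ξ) {b : EucSp d → ℝ} (hb : Measurable b)
    (hbi : Integrable fun x => Real.exp (b x) - 1)
    (hs : ∀ᵐ γ ∂μ, Summable fun u : γ.1 => b u.1) :
    ∫ γ, Real.exp (∑' u : γ.1, b u.1) ∂μ = Zexp k fun x => Real.exp (b x) - 1 := by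
  set g : EucSp d → ℝ := fun x => Real.exp (b x) - 1 with hg
  have hgm : Measurable g := hb.exp.sub_const 1
  have hfin := (h.lintegral_finset_abs_le hgm hbi).trans_lt ENNReal.ofReal_lt_top
  have hle : ∀ (γ : Config d) (S : Finset γ.1), ENNReal.ofReal (∏ u ∈ S, g u.1) ≤
      ENNReal.ofReal |∏ u ∈ S, g u.1| := fun γ S => ENNReal.ofReal_le_ofReal (le_abs_self _)
  have hle' : ∀ (γ : Config d) (S : Finset γ.1), ENNReal.ofReal (-∏ u ∈ S, g u.1) ≤
      ENNReal.ofReal |∏ u ∈ S, g u.1| := fun γ S => ENNReal.ofReal_le_ofReal (neg_le_abs _)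
  have hm1 := measurable_tsum_finset_prod hgm (θ := ENNReal.ofReal) ENNReal.measurable_ofReal
  have hm2 := measurable_tsum_finset_prod hgm (θ := fun t => ENNReal.ofReal (-t))
    (measurable_neg.ennreal_ofReal)
  have hm3 := measurable_tsum_finset_prod hgm (θ := fun t => ENNReal.ofReal |t|)
    (measurable_norm.ennreal_ofReal)
  have hf1 : ∫⁻ γ, ∑' S : Finset γ.1, ENNReal.ofReal (∏ u ∈ S, g u.1) ∂μ < ⊤ :=
    (lintegral_mono fun γ => ENNReal.tsum_le_tsum (hle γ)).trans_lt hfin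
  have hf2 : ∫⁻ γ, ∑' S : Finset γ.1, ENNReal.ofReal (-∏ u ∈ S, g u.1) ∂μ < ⊤ :=
    (lintegral_mono fun γ => ENNReal.tsum_le_tsum (hle' γ)).trans_lt hfin
  have hae : ∀ᵐ γ ∂μ, Real.exp (∑' u : γ.1, b u.1) =
      (∑' S : Finset γ.1, ENNReal.ofReal (∏ u ∈ S, g u.1)).toReal -
        (∑' S : Finset γ.1, ENNReal.ofReal (-∏ u ∈ S, g u.1)).toReal := by
    filter_upwards [hs, ae_lt_top hm3 hfin.ne] with γ hγ hγ3
    have habs : Summable fun S : Finset γ.1 => |∏ v ∈ S, g v.1| := by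
      have := ENNReal.summable_toReal hγ3.ne
      simpa [ENNReal.toReal_ofReal] using this
    have h1 := hasProd_one_add_of_hasSum_prod habs.of_abs.hasSum
    have h2 : HasProd (fun v : γ.1 => 1 + g v.1) (Real.exp (∑' v : γ.1, b v.1)) := by
      simpa [Function.comp_def, hg] using hγ.hasSum.rexp
    rw [h2.unique h1, ENNReal.tsum_toReal_eq (fun _ => ENNReal.ofReal_ne_top),
      ENNReal.tsum_toReal_eq (fun _ => ENNReal.ofReal_ne_top), ← Summable.tsum_sub]
    · congr 1; ext S
      rw [ENNReal.toReal_ofReal', ENNReal.toReal_ofReal']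
      rcases le_total (∏ u ∈ S, g u.1) 0 with h | h
      · rw [max_eq_right h, max_eq_left (by linarith)]; ring
      · rw [max_eq_left h, max_eq_right (by linarith)]; ring
    · exact ENNReal.summable_toReal ((ENNReal.tsum_le_tsum (hle γ)).trans_lt hγ3).ne
    · exact ENNReal.summable_toReal ((ENNReal.tsum_le_tsum (hle' γ)).trans_lt hγ3).ne
  rw [integral_congr_ae hae, integral_sub
    (integrable_toReal_of_lintegral_ne_top hm1.aemeasurable hf1.ne)
    (integrable_toReal_of_lintegral_ne_top hm2.aemeasurable hf2.ne),
    integral_toReal hm1.aemeasurable (ae_lt_top hm1 hf1.ne),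
    integral_toReal hm2.aemeasurable (ae_lt_top hm2 hf2.ne)]
  have e1 := h.lintegral_finset_prod hgm (θ := ENNReal.ofReal) ENNReal.measurable_ofReal
  have e2 := h.lintegral_finset_prod hgm (θ := fun t => ENNReal.ofReal (-t))
    (measurable_neg.ennreal_ofReal)
  rw [e1] at hf1 ⊢
  rw [e2] at hf2 ⊢
  rw [ENNReal.tsum_toReal_eq (fun n => (ENNReal.le_tsum n |>.trans_lt hf1).ne),
    ENNReal.tsum_toReal_eq (fun n => (ENNReal.le_tsum n |>.trans_lt hf2).ne), ← Summable.tsum_sub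
      (ENNReal.summable_toReal hf1.ne) (ENNReal.summable_toReal hf2.ne), Zexp]
  congr 1; ext n
  rw [integral_eq_lintegral_pos_part_sub_lintegral_neg_part
    (h.integrable_term n (integrable_tensor hbi n)), ENNReal.toReal_mul, ENNReal.toReal_mul,
    ← mul_sub, ENNReal.toReal_inv, ENNReal.toReal_natCast]
  simp_rw [← neg_mul, ENNReal.ofReal_mul' (h.nonneg n _)]

lemma integrable_exp_of_lintegral_lt_top {X : Config d → ℝ} (hX : Measurable X)
    (h : ∫⁻ γ, ENNReal.ofReal (Real.exp (X γ)) ∂μ < ⊤) : Integrable (fun γ => Real.exp (X γ)) μ := by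
  refine ⟨hX.exp.aestronglyMeasurable, ?_⟩
  rw [hasFiniteIntegral_iff_ofReal (ae_of_all _ fun _ => (Real.exp_pos _).le)]
  exact h

lemma CorrData.lintegral_tsum (h : CorrData μ k ξ) {F : EucSp d → ℝ≥0∞} (hF : Measurable F) :
    ∫⁻ γ, ∑' u : γ.1, F u.1 ∂μ ≤ ENNReal.ofReal ξ * ∫⁻ x, F x := by
  have h1 := h.corr 1 (fun x => F (x 0)) (hF.comp (measurable_pi_apply 0)) (by
    intro σ x
    rw [Function.comp, Subsingleton.elim (σ 0) 0])
  have h2 : ∀ γ : Config d, ∑' p : injTuples 1 γ.1, F (p.1 0) = ∑' u : γ.1, F u.1 := by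
    intro γ
    let e : γ.1 ≃ injTuples 1 γ.1 :=
      { toFun := fun u => ⟨fun _ => u.1, fun _ _ _ => Subsingleton.elim _ _, fun _ => u.2⟩
        invFun := fun p => ⟨p.1 0, p.2.2 0⟩
        left_inv := fun _ => rfl
        right_inv := fun p => Subtype.ext (funext fun i => by rw [Subsingleton.elim i 0]) }
    rw [← e.tsum_eq]
    rfl
  simp_rw [h2] at h1
  rw [h1, ← lintegral_const_mul _ hF,
    ← (volume_preserving_funUnique (Fin 1) (EucSp d)).lintegral_comp (hF.const_mul _)]
  refine lintegral_mono fun x => ?_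
  rw [mul_comm]
  gcongr ENNReal.ofReal ?_ * ?_
  · simpa using h.bound 1 x
  · exact le_of_eq rfl

end Correlation

section Partitions

variable {d N : ℕ}

/-- `P` is a partition of `A` into nonempty pairwise disjoint blocks. -/
def IsPartOf (A : Finset (Fin N)) (P : Finset (Finset (Fin N))) : Prop :=
  (∀ b ∈ P, b.Nonempty) ∧ (P : Set (Finset (Fin N))).PairwiseDisjoint id ∧ P.sup id = A

lemma isPartOf_iff {A : Finset (Fin N)} {P : Finset (Finset (Fin N))} :
    IsPartOf A P ↔ (∀ b ∈ P, b.Nonempty) ∧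
      (∀ b ∈ P, ∀ c ∈ P, b ≠ c → Disjoint b c) ∧ ∀ i, i ∈ A ↔ ∃ b ∈ P, i ∈ b := by
  unfold IsPartOf
  refine and_congr Iff.rfl (and_congr ?_ ?_)
  · constructor
    · intro h b hb c hc hbc
      exact h hb hc hbc
    · intro h b hb c hc hbc
      exact h b hb c hc hbc
  · rw [Finset.ext_iff]
    simp only [Finset.mem_sup, id]
    exact forall_congr' fun _ => ⟨Iff.symm, Iff.symm⟩

/-- The Ursell weight of the block `b` at the configuration `x`. -/
def blockU (u : ∀ n : ℕ, (Fin n → EucSp d) → ℝ) (x : Fin N → EucSp d) (b : Finset (Fin N)) : ℝ :=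
  u b.card fun i => x (b.orderEmbOfFin rfl i)

lemma blockU_eq (u : ∀ n : ℕ, (Fin n → EucSp d) → ℝ) (x : Fin N → EucSp d) (b : Finset (Fin N))
    {m : ℕ} (h : b.card = m) : blockU u x b = u m fun i => x (b.orderEmbOfFin h i) := by
  subst h; rfl

/-- The sum of the products of Ursell weights over all partitions of `A`. -/
def partSum (u : ∀ n : ℕ, (Fin n → EucSp d) → ℝ) (x : Fin N → EucSp d) (A : Finset (Fin N)) : ℝ :=
  ∑ P : Finset (Finset (Fin N)), if IsPartOf A P then ∏ b ∈ P, blockU u x b else 0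

lemma blockU_map (u : ∀ n : ℕ, (Fin n → EucSp d) → ℝ) (x : Fin N → EucSp d) {m : ℕ}
    (e : Fin m ↪o Fin N) (b : Finset (Fin m)) :
    blockU u x (b.map e.toEmbedding) = blockU u (fun i => x (e i)) b := by
  rw [blockU_eq u x _ (m := b.card) (by simp), blockU]
  congr 1; ext i : 1
  have := Finset.orderEmbOfFin_unique' (s := b.map e.toEmbedding) (k := b.card) (by simp)
    (f := (b.orderEmbOfFin rfl).trans e) (fun i => by simp)
  rw [← this]; rfl

lemma isPartOf_map {m : ℕ} (e : Fin m ↪o Fin N) (A : Finset (Fin m))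
    (Q : Finset (Finset (Fin m))) :
    IsPartOf (A.map e.toEmbedding) (Q.map (Finset.mapEmbedding e.toEmbedding).toEmbedding) ↔
      IsPartOf A Q := by
  rw [isPartOf_iff, isPartOf_iff]
  have hE : ∀ b : Finset (Fin m), (Finset.mapEmbedding e.toEmbedding).toEmbedding b =
    b.map e.toEmbedding := fun b => rfl
  refine and_congr ?_ (and_congr ?_ ?_)
  · simp [hE]
  · simp only [Finset.forall_mem_map, hE, Finset.disjoint_map]
    simp
  · constructor
    · intro h i
      have := h (e i)
      simpa [hE] using this
    · intro h i
      simp only [Finset.mem_map, h]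
      constructor
      · rintro ⟨j, ⟨b, hb, hj⟩, rfl⟩
        exact ⟨b.map e.toEmbedding, ⟨b, hb, rfl⟩, by simpa using hj⟩
      · rintro ⟨_, ⟨b, hb, rfl⟩, hi⟩
        rw [hE, Finset.mem_map] at hi
        obtain ⟨j, hj, rfl⟩ := hi
        exact ⟨j, ⟨b, hb, hj⟩, rfl⟩

lemma partSum_map (u : ∀ n : ℕ, (Fin n → EucSp d) → ℝ) (x : Fin N → EucSp d) {m : ℕ}
    (e : Fin m ↪o Fin N) (A : Finset (Fin m)) :
    partSum u x (A.map e.toEmbedding) = partSum u (fun i => x (e i)) A := by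
  unfold partSum
  rw [← Finset.sum_filter, ← Finset.sum_filter]
  symm
  refine Finset.sum_bij (fun Q _ => Q.map (Finset.mapEmbedding e.toEmbedding).toEmbedding)
    ?_ ?_ ?_ ?_
  · intro Q hQ
    simpa using (isPartOf_map e A Q).2 (by simpa using hQ)
  · intro Q _ Q' _ h
    exact Finset.map_injective _ h
  · intro P hP
    have hP : IsPartOf (A.map e.toEmbedding) P := by simpa using hP
    have hsub : P ⊆ (Finset.univ : Finset (Finset (Fin m))).map
        (Finset.mapEmbedding e.toEmbedding).toEmbedding := by
      intro b hb
      have : b ⊆ A.map e.toEmbedding := fun i hi => ((isPartOf_iff.1 hP).2.2 i).2 ⟨b, hb, hi⟩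
      obtain ⟨c, -, rfl⟩ := Finset.subset_map_iff.1 this
      exact Finset.mem_map.2 ⟨c, Finset.mem_univ _, rfl⟩
    obtain ⟨Q, -, rfl⟩ := Finset.subset_map_iff.1 hsub
    refine ⟨Q, ?_, rfl⟩
    simpa using (isPartOf_map e A Q).1 hP
  · intro Q _
    rw [Finset.prod_map]
    exact Finset.prod_congr rfl fun b _ => (blockU_map u x e b).symm

/-- Every block of `P` lies in `A` or in its complement. -/
def Unmixed (A : Finset (Fin N)) (P : Finset (Finset (Fin N))) : Prop :=
  ∀ b ∈ P, b ⊆ A ∨ b ⊆ Aᶜ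

lemma sum_unmixed (w : Finset (Fin N) → ℝ) (A : Finset (Fin N)) :
    (∑ P : Finset (Finset (Fin N)), if IsPartOf Finset.univ P ∧ Unmixed A P then
      ∏ b ∈ P, w b else 0) =
    (∑ P : Finset (Finset (Fin N)), if IsPartOf A P then ∏ b ∈ P, w b else 0) *
    (∑ P : Finset (Finset (Fin N)), if IsPartOf Aᶜ P then ∏ b ∈ P, w b else 0) := by
  rw [← Finset.sum_filter, ← Finset.sum_filter, ← Finset.sum_filter, Finset.sum_mul_sum,
    ← Finset.sum_product']
  have key : ∀ P Q : Finset (Finset (Fin N)), IsPartOf A P → IsPartOf Aᶜ Q →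
      ((∀ b ∈ P, b ⊆ A ∧ ¬ b ⊆ Aᶜ) ∧ (∀ b ∈ Q, b ⊆ Aᶜ ∧ ¬ b ⊆ A)) := by
    intro P Q hP hQ
    rw [isPartOf_iff] at hP hQ
    constructor
    · intro b hb
      have h1 : b ⊆ A := fun i hi => (hP.2.2 i).2 ⟨b, hb, hi⟩
      refine ⟨h1, fun h2 => ?_⟩
      obtain ⟨i, hi⟩ := hP.1 b hb
      exact Finset.mem_compl.1 (h2 hi) (h1 hi)
    · intro b hb
      have h1 : b ⊆ Aᶜ := fun i hi => (hQ.2.2 i).2 ⟨b, hb, hi⟩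
      refine ⟨h1, fun h2 => ?_⟩
      obtain ⟨i, hi⟩ := hQ.1 b hb
      exact Finset.mem_compl.1 (h1 hi) (h2 hi)
  have hdisj : ∀ P Q : Finset (Finset (Fin N)), IsPartOf A P → IsPartOf Aᶜ Q → Disjoint P Q := by
    intro P Q hP hQ
    rw [Finset.disjoint_left]
    intro b hb hb'
    exact ((key P Q hP hQ).1 b hb).2 ((key P Q hP hQ).2 b hb').1
  symm
  refine Finset.sum_bij' (fun p _ => p.1 ∪ p.2)
    (fun P _ => (P.filter fun b => b ⊆ A, P.filter fun b => b ⊆ Aᶜ)) ?_ ?_ ?_ ?_ ?_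
  · rintro ⟨P, Q⟩ h
    have h : IsPartOf A P ∧ IsPartOf Aᶜ Q := by simpa using h
    obtain ⟨hk1, hk2⟩ := key P Q h.1 h.2
    simp only [Finset.mem_filter, Finset.mem_univ, true_and]
    obtain ⟨hP, hQ⟩ := h
    rw [isPartOf_iff] at hP hQ ⊢
    have hcross : ∀ b ∈ P, ∀ c ∈ Q, Disjoint b c := fun b hb c hc =>
      Disjoint.mono (hk1 b hb).1 (hk2 c hc).1 disjoint_compl_right
    refine ⟨⟨?_, ?_, ?_⟩, ?_⟩
    · intro b hb
      rcases Finset.mem_union.1 hb with hb | hb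
      exacts [hP.1 b hb, hQ.1 b hb]
    · intro b hb c hc hbc
      rcases Finset.mem_union.1 hb with hb | hb <;> rcases Finset.mem_union.1 hc with hc | hc
      exacts [hP.2.1 b hb c hc hbc, hcross b hb c hc, (hcross c hc b hb).symm,
        hQ.2.1 b hb c hc hbc]
    · intro i
      simp only [Finset.mem_univ, true_iff, Finset.mem_union]
      by_cases hi : i ∈ A
      · obtain ⟨b, hb, h⟩ := (hP.2.2 i).1 hi
        exact ⟨b, Or.inl hb, h⟩
      · obtain ⟨b, hb, h⟩ := (hQ.2.2 i).1 (Finset.mem_compl.2 hi)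
        exact ⟨b, Or.inr hb, h⟩
    · intro b hb
      rcases Finset.mem_union.1 hb with hb | hb
      exacts [Or.inl (hk1 b hb).1, Or.inr (hk2 b hb).1]
  · intro P h
    have h : IsPartOf Finset.univ P ∧ Unmixed A P := by simpa using h
    obtain ⟨hP, hU⟩ := h
    simp only [Finset.mem_product, Finset.mem_filter, Finset.mem_univ, true_and]
    rw [isPartOf_iff] at hP
    have haux : ∀ D : Finset (Fin N), (∀ b ∈ P, b ⊆ D ∨ b ⊆ Dᶜ) →
        IsPartOf D (P.filter fun b => b ⊆ D) := by
      intro D hD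
      rw [isPartOf_iff]
      refine ⟨fun b hb => hP.1 b (Finset.mem_filter.1 hb).1, fun b hb c hc =>
        hP.2.1 b (Finset.mem_filter.1 hb).1 c (Finset.mem_filter.1 hc).1, fun i => ?_⟩
      constructor
      · intro hi
        obtain ⟨b, hb, h⟩ := (hP.2.2 i).1 (Finset.mem_univ _)
        refine ⟨b, Finset.mem_filter.2 ⟨hb, ?_⟩, h⟩
        rcases hD b hb with h1 | h1
        · exact h1
        · exact absurd hi (Finset.mem_compl.1 (h1 h))
      · rintro ⟨b, hb, hi⟩
        exact (Finset.mem_filter.1 hb).2 hi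
    exact ⟨haux A hU, haux Aᶜ fun b hb => by rw [compl_compl]; exact (hU b hb).symm⟩
  · rintro ⟨P, Q⟩ h
    have h : IsPartOf A P ∧ IsPartOf Aᶜ Q := by simpa using h
    obtain ⟨hk1, hk2⟩ := key P Q h.1 h.2
    simp only [Prod.mk.injEq]
    constructor
    · ext b
      simp only [Finset.mem_filter, Finset.mem_union]
      exact ⟨fun hb => hb.1.resolve_right fun hq => (hk2 b hq).2 hb.2,
        fun hb => ⟨Or.inl hb, (hk1 b hb).1⟩⟩
    · ext b
      simp only [Finset.mem_filter, Finset.mem_union]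
      exact ⟨fun hb => hb.1.resolve_left fun hq => (hk1 b hq).2 hb.2,
        fun hb => ⟨Or.inr hb, (hk2 b hb).1⟩⟩
  · intro P h
    have h : IsPartOf Finset.univ P ∧ Unmixed A P := by simpa using h
    ext b
    simp only [Finset.mem_union, Finset.mem_filter]
    exact ⟨fun hb => hb.elim And.left And.left,
      fun hb => (h.2 b hb).imp (fun h => ⟨hb, h⟩) fun h => ⟨hb, h⟩⟩
  · rintro ⟨P, Q⟩ h
    have h : IsPartOf A P ∧ IsPartOf Aᶜ Q := by simpa using h
    exact (Finset.prod_union (hdisj P Q h.1 h.2)).symm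

end Partitions

section UrsellBounds

variable {d : ℕ}

/-- Correlation functions together with their Ursell functions. -/
structure UrsellData (k u : ∀ n : ℕ, (Fin n → EucSp d) → ℝ) : Prop where
  partSum_univ : ∀ n (x : Fin n → EucSp d), k n x = partSum u x Finset.univ
  meas : ∀ n, Measurable (u (n + 1))
  bdd : ∀ n, ∃ C, 0 ≤ C ∧ ∀ x, |u (n + 1) x| ≤ C
  ti : ∀ n (a : EucSp d) (x : Fin (n + 1) → EucSp d), u (n + 1) (fun i => x i + a) = u (n + 1) x
  int : ∀ m, Integrable fun y : Fin (m + 1) → EucSp d => u (m + 2) (Fin.cons 0 y)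

lemma isPartOf_singleton_univ (n : ℕ) :
    IsPartOf (Finset.univ : Finset (Fin (n + 1))) {Finset.univ} := by
  rw [isPartOf_iff]
  simp [Finset.univ_nonempty]

lemma IsPartOf.card_lt {n : ℕ} {P : Finset (Finset (Fin (n + 1)))}
    (hP : IsPartOf Finset.univ P) (hne : P ≠ {Finset.univ}) {b : Finset (Fin (n + 1))}
    (hb : b ∈ P) : ∃ m, b.card = m + 1 ∧ m < n := by
  rw [isPartOf_iff] at hP
  have h1 : 0 < b.card := Finset.card_pos.2 (hP.1 b hb)
  have h2 : b ≠ Finset.univ := by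
    rintro rfl
    refine hne (Finset.eq_singleton_iff_unique_mem.2 ⟨hb, fun c hc => ?_⟩)
    by_contra hcb
    have := hP.2.1 c hc _ hb hcb
    obtain ⟨i, hi⟩ := hP.1 c hc
    exact Finset.disjoint_left.1 this hi (Finset.mem_univ _)
  have h3 : b.card < n + 1 := by
    have := Finset.card_lt_univ_of_notMem (s := b) (x := (by
      classical
      exact (not_forall.1 fun h => h2 (Finset.eq_univ_iff_forall.2 h)).choose))
      ((not_forall.1 fun h => h2 (Finset.eq_univ_iff_forall.2 h)).choose_spec)
    simpa using this
  exact ⟨b.card - 1, by omega, by omega⟩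

lemma eq_sub_of_partSum {k u : ∀ n : ℕ, (Fin n → EucSp d) → ℝ} {n : ℕ}
    {x : Fin (n + 1) → EucSp d} (h : k (n + 1) x = partSum u x Finset.univ) :
    u (n + 1) x = k (n + 1) x - ∑ P ∈ (Finset.univ : Finset (Finset (Finset (Fin (n + 1))))).filter
      (fun P => IsPartOf Finset.univ P ∧ P ≠ {Finset.univ}), ∏ b ∈ P, blockU u x b := by
  have hu : blockU u x Finset.univ = u (n + 1) x := by
    rw [blockU_eq u x Finset.univ (m := n + 1) (by simp)]
    congr 1; ext i : 1
    have := Finset.orderEmbOfFin_unique' (s := (Finset.univ : Finset (Fin (n + 1))))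
      (k := n + 1) (by simp) (f := RelEmbedding.refl _) (fun i => Finset.mem_univ _)
    rw [← this]; rfl
  rw [h, partSum, ← Finset.sum_filter, ← Finset.sum_filter_add_sum_filter_not
    (Finset.univ.filter (IsPartOf Finset.univ)) (fun P => P = {Finset.univ})]
  rw [Finset.filter_filter, Finset.filter_filter, add_sub_cancel_right]
  rw [Finset.sum_eq_single_of_mem {Finset.univ}]
  · simp [hu]
  · simp [isPartOf_singleton_univ]
  · intro P hP hne
    exact absurd (Finset.mem_filter.1 hP).2.2 hne

lemma CorrData.ursellData {μ : Measure (Config d)} {k u : ∀ n : ℕ, (Fin n → EucSp d) → ℝ} {ξ : ℝ}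
    (hk : CorrData μ k ξ) (hu : ∀ n (x : Fin n → EucSp d), k n x = partSum u x Finset.univ)
    (hint : ∀ m, Integrable fun y : Fin (m + 1) → EucSp d => u (m + 2) (Fin.cons 0 y)) :
    UrsellData k u := by
  have key : ∀ n, Measurable (u (n + 1)) ∧ (∃ C, 0 ≤ C ∧ ∀ x, |u (n + 1) x| ≤ C) ∧
      ∀ (a : EucSp d) (x : Fin (n + 1) → EucSp d),
        u (n + 1) (fun i => x i + a) = u (n + 1) x := by
    intro n
    induction n using Nat.strong_induction_on with
    | _ n ih =>
    have hform := fun x => eq_sub_of_partSum (hu (n + 1) x)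
    have hblock : ∀ P ∈ (Finset.univ : Finset (Finset (Finset (Fin (n + 1))))).filter
        (fun P => IsPartOf Finset.univ P ∧ P ≠ {Finset.univ}), ∀ b ∈ P,
        (Measurable fun x : Fin (n + 1) → EucSp d => blockU u x b) ∧
        (∃ C, 0 ≤ C ∧ ∀ x : Fin (n + 1) → EucSp d, |blockU u x b| ≤ C) ∧
        ∀ (a : EucSp d) (x : Fin (n + 1) → EucSp d),
          blockU u (fun i => x i + a) b = blockU u x b := by
      intro P hP b hb
      obtain ⟨m, hm, hmn⟩ := (Finset.mem_filter.1 hP).2.1.card_lt (Finset.mem_filter.1 hP).2.2 hb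
      obtain ⟨h1, ⟨C, hC0, hC⟩, h3⟩ := ih m hmn
      simp_rw [fun x : Fin (n + 1) → EucSp d => blockU_eq u x b hm]
      refine ⟨h1.comp (measurable_pi_lambda _ fun i => measurable_pi_apply _),
        ⟨C, hC0, fun x => hC _⟩, fun a x => h3 a _⟩
    refine ⟨?_, ?_, ?_⟩
    · rw [show u (n + 1) = _ from funext hform]
      exact (hk.meas _).sub (Finset.measurable_sum _ fun P hP =>
        Finset.measurable_prod _ fun b hb => (hblock P hP b hb).1)
    · have : ∀ P ∈ (Finset.univ : Finset (Finset (Finset (Fin (n + 1))))).filter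
          (fun P => IsPartOf Finset.univ P ∧ P ≠ {Finset.univ}), ∃ C, 0 ≤ C ∧
          ∀ x : Fin (n + 1) → EucSp d, |∏ b ∈ P, blockU u x b| ≤ C := by
        intro P hP
        choose! C hC0 hC using fun b hb => (hblock P hP b hb).2.1
        refine ⟨∏ b ∈ P, C b, Finset.prod_nonneg hC0, fun x => ?_⟩
        rw [Finset.abs_prod]
        exact Finset.prod_le_prod (fun _ _ => abs_nonneg _) fun b hb => hC b hb x
      choose! C hC0 hC using this
      refine ⟨ξ ^ (n + 1) + ∑ P ∈ (Finset.univ : Finset (Finset (Finset (Fin (n + 1))))).filter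
          (fun P => IsPartOf Finset.univ P ∧ P ≠ {Finset.univ}), C P,
          add_nonneg (pow_nonneg hk.xi_pos.le _) (Finset.sum_nonneg hC0), fun x => ?_⟩
      rw [hform]
      refine (abs_sub _ _).trans (add_le_add ?_ ?_)
      · rw [abs_of_nonneg (hk.nonneg _ _)]; exact hk.bound _ _
      · exact (Finset.abs_sum_le_sum_abs _ _).trans (Finset.sum_le_sum fun P hP => hC P hP x)
    · intro a x
      rw [hform, hform, hk.ti]
      congr 1
      exact Finset.sum_congr rfl fun P hP => Finset.prod_congr rfl fun b hb =>
        (hblock P hP b hb).2.2 a x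
  exact ⟨hu, fun n => (key n).1, fun n => (key n).2.1, fun n => (key n).2.2, hint⟩

lemma Setting.ursellData {s z B ξ : ℝ} {φ : EucSp d → EReal} {μ : Measure (Config d)}
    {k u : ∀ n : ℕ, (Fin n → EucSp d) → ℝ} (h : Setting d s z B ξ φ μ k u) :
    UrsellData (normK k) u := by
  refine h.corrData.ursellData (fun n x => ?_) h.ursellInt
  rcases n.eq_zero_or_pos with rfl | hn
  · rw [partSum, Finset.sum_eq_single_of_mem ∅ (Finset.mem_univ _)]
    · simp [normK, isPartOf_iff]
    · intro P _ hP
      rw [if_neg]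
      rintro ⟨h1, -⟩
      obtain ⟨b, hb⟩ := Finset.nonempty_iff_ne_empty.2 hP
      obtain ⟨i, -⟩ := h1 b hb
      exact i.elim0
  · rw [normK_of_pos k hn, h.ursell n hn x]
    rfl

end UrsellBounds

section Clustering

variable {d : ℕ}

/-- An integrable bounded function vanishing at infinity. -/
structure MayerFn (g : EucSp d → ℝ) : Prop where
  meas : Measurable g
  int : Integrable g
  bdd : ∃ G, 0 ≤ G ∧ ∀ x, |g x| ≤ G
  van : Tendsto g (Bornology.cobounded (EucSp d)) (𝓝 0)

instance cobounded_isCountablyGenerated :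
    (Bornology.cobounded (EucSp d)).IsCountablyGenerated := by
  rw [← comap_norm_atTop]; infer_instance

lemma measurePreserving_split {N : ℕ} (b : Finset (Fin N)) :
    MeasurePreserving (fun x : Fin N → EucSp d =>
      ((fun i => x (b.orderEmbOfFin rfl i), fun i => x (bᶜ.orderEmbOfFin rfl i)) :
        (Fin b.card → EucSp d) × (Fin bᶜ.card → EucSp d))) := by
  have h1 := volume_preserving_arrowCongr' (finSumEquivOfFinset (s := b) rfl rfl).symm
    (MeasurableEquiv.refl (EucSp d)) (MeasurePreserving.id _)
  have h2 := volume_measurePreserving_sumPiEquivProdPi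
    (fun _ : Fin b.card ⊕ Fin bᶜ.card => EucSp d)
  exact h2.comp h1

lemma lintegral_split {N : ℕ} (b : Finset (Fin N)) {F : (Fin b.card → EucSp d) → ℝ≥0∞}
    {G : (Fin bᶜ.card → EucSp d) → ℝ≥0∞} (hF : Measurable F) (hG : Measurable G) :
    ∫⁻ x : Fin N → EucSp d, F (fun i => x (b.orderEmbOfFin rfl i)) *
      G (fun i => x (bᶜ.orderEmbOfFin rfl i)) = (∫⁻ x, F x) * ∫⁻ x, G x := by
  rw [← lintegral_prod_mul hF.aemeasurable hG.aemeasurable]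
  exact (measurePreserving_split b).lintegral_comp
    ((hF.comp measurable_fst).mul (hG.comp measurable_snd))

lemma integral_split {N : ℕ} (b : Finset (Fin N)) {F : (Fin b.card → EucSp d) → ℝ}
    {G : (Fin bᶜ.card → EucSp d) → ℝ} (hF : Measurable F) (hG : Measurable G) :
    ∫ x : Fin N → EucSp d, F (fun i => x (b.orderEmbOfFin rfl i)) *
      G (fun i => x (bᶜ.orderEmbOfFin rfl i)) = (∫ x, F x) * ∫ x, G x := by
  rw [← integral_prod_mul, ← Measure.volume_eq_prod, ← (measurePreserving_split b).map_eq,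
    integral_map (measurePreserving_split b).measurable.aemeasurable]
  exact ((hF.comp measurable_fst).mul (hG.comp measurable_snd)).aestronglyMeasurable

lemma prod_orderEmb {N : ℕ} {M : Type*} [CommMonoid M] (b : Finset (Fin N)) (h : Fin N → M) :
    ∏ i ∈ b, h i = ∏ i, h (b.orderEmbOfFin rfl i) := by
  conv_lhs => rw [← Finset.map_orderEmbOfFin_univ b rfl, Finset.prod_map]
  rfl

lemma lintegral_tuple_center {m : ℕ} {F : (Fin (m + 1) → EucSp d) → ℝ≥0∞} (hF : Measurable F) :
    ∫⁻ x, F x = ∫⁻ y : Fin m → EucSp d, ∫⁻ t : EucSp d,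
      F (fun i => (Fin.cons 0 y : Fin (m + 1) → EucSp d) i + t) := by
  have hc : Measurable fun p : EucSp d × (Fin m → EucSp d) =>
      (Fin.cons p.1 p.2 : Fin (m + 1) → EucSp d) := by
    refine measurable_pi_lambda _ fun i => ?_
    refine Fin.cases ?_ (fun j => ?_) i
    · simpa using measurable_fst
    · simpa [Function.comp_def] using (measurable_pi_apply j).comp measurable_snd
  have h1 := (volume_preserving_piFinSuccAbove (fun _ : Fin (m + 1) => EucSp d) 0).symm
  have h2 := (h1.lintegral_comp hF).symm
  rw [h2, Measure.volume_eq_prod]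
  have h3 : ∀ p : EucSp d × (Fin m → EucSp d),
      (MeasurableEquiv.piFinSuccAbove (fun _ : Fin (m + 1) => EucSp d) 0).symm p =
        (Fin.cons p.1 p.2 : Fin (m + 1) → EucSp d) := by
    intro p
    simp [MeasurableEquiv.piFinSuccAbove, Fin.insertNthEquiv]
  simp_rw [h3]
  rw [lintegral_prod (fun p => F (Fin.cons p.1 p.2 : Fin (m + 1) → EucSp d))
    (hF.comp hc).aemeasurable]
  have h4 : ∀ t : EucSp d, ∫⁻ y : Fin m → EucSp d, F (Fin.cons t y : Fin (m + 1) → EucSp d) =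
      ∫⁻ y : Fin m → EucSp d, F (fun i => (Fin.cons 0 y : Fin (m + 1) → EucSp d) i + t) := by
    intro t
    rw [← lintegral_add_right_eq_self _ (fun _ : Fin m => t)]
    refine lintegral_congr fun y => ?_
    congr 1; ext i : 1
    refine Fin.cases ?_ (fun j => ?_) i <;> simp
  simp_rw [h4]
  rw [lintegral_lintegral_swap]
  refine (hF.comp (measurable_pi_lambda _ fun i => ?_)).aemeasurable
  refine Measurable.add ?_ measurable_fst
  exact (measurable_pi_apply i).comp (hc.comp (measurable_const.prodMk measurable_snd))

lemma tendsto_sub_cobounded (t : EucSp d) :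
    Tendsto (fun v => t - v) (Bornology.cobounded (EucSp d)) (Bornology.cobounded (EucSp d)) := by
  rw [← tendsto_norm_atTop_iff_cobounded]
  refine tendsto_atTop_mono (f := fun v => ‖v‖ + -‖t‖) (fun v => ?_)
    (tendsto_atTop_add_const_right _ _ tendsto_norm_cobounded_atTop)
  have := norm_sub_norm_le v t
  rw [norm_sub_rev] at this
  linarith

lemma tendsto_pair_lintegral {m : ℕ} {w : (Fin (m + 2) → EucSp d) → ℝ} (hw : Measurable w)
    (hti : ∀ (a : EucSp d) x, w (fun i => x i + a) = w x)
    (hint : Integrable fun y : Fin (m + 1) → EucSp d => w (Fin.cons 0 y))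
    {g : EucSp d → ℝ} (hg : MayerFn g) (i j : Fin (m + 2)) :
    Tendsto (fun v => ∫⁻ x : Fin (m + 2) → EucSp d,
      ‖g (x i)‖ₑ * ‖g (x j - v)‖ₑ * ‖w x‖ₑ) (Bornology.cobounded (EucSp d)) (𝓝 0) := by
  obtain ⟨G, hG0, hG⟩ := hg.bdd
  have hGe : ∀ x, ‖g x‖ₑ ≤ ENNReal.ofReal G := fun x => by
    rw [Real.enorm_eq_ofReal_abs]; exact ENNReal.ofReal_le_ofReal (hG x)
  have hgi : ∀ i : Fin (m + 2), Measurable fun x : Fin (m + 2) → EucSp d => ‖g (x i)‖ₑ :=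
    fun i => (hg.meas.comp (measurable_pi_apply i)).enorm
  have := tendsto_lintegral_filter_of_dominated_convergence
    (μ := (volume : Measure (Fin (m + 2) → EucSp d))) (l := Bornology.cobounded (EucSp d))
    (F := fun v x => ‖g (x i)‖ₑ * ‖g (x j - v)‖ₑ * ‖w x‖ₑ) (f := fun _ => 0)
    (fun x => ‖g (x i)‖ₑ * ENNReal.ofReal G * ‖w x‖ₑ) ?_ ?_ ?_ ?_
  · simpa using this
  · refine Eventually.of_forall fun v => ((hgi i).mul ?_).mul hw.enorm
    have hs : Measurable fun x : Fin (m + 2) → EucSp d => x j - v :=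
      (measurable_pi_apply j).sub measurable_const
    exact (hg.meas.comp hs).enorm
  · refine Eventually.of_forall fun v => ae_of_all _ fun x => ?_
    gcongr
    exact hGe _
  · rw [lintegral_tuple_center (m := m + 1)
      (F := fun x => ‖g (x i)‖ₑ * ENNReal.ofReal G * ‖w x‖ₑ)
      (((hgi i).mul_const _).mul hw.enorm)]
    simp_rw [hti]
    have h1 : ∀ y : Fin (m + 1) → EucSp d, ∫⁻ t : EucSp d,
        ‖g ((Fin.cons 0 y : Fin (m + 2) → EucSp d) i + t)‖ₑ * ENNReal.ofReal G *
          ‖w (Fin.cons 0 y)‖ₑ =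
        (∫⁻ t : EucSp d, ‖g t‖ₑ) * ENNReal.ofReal G * ‖w (Fin.cons 0 y)‖ₑ := by
      intro y
      rw [lintegral_mul_const' _ _ enorm_ne_top, lintegral_mul_const' _ _ ENNReal.ofReal_ne_top,
        lintegral_add_left_eq_self (fun t => ‖g t‖ₑ)]
    simp_rw [h1]
    rw [lintegral_const_mul' _ _ (ENNReal.mul_ne_top hg.int.2.ne ENNReal.ofReal_ne_top)]
    exact ENNReal.mul_ne_top (ENNReal.mul_ne_top hg.int.2.ne ENNReal.ofReal_ne_top) hint.2.ne
  · refine ae_of_all _ fun x => ?_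
    have h1 : Tendsto (fun v => ‖g (x j - v)‖ₑ) (Bornology.cobounded (EucSp d)) (𝓝 0) := by
      have := (hg.van.comp (tendsto_sub_cobounded (x j))).enorm
      simpa using this
    have h2 := ENNReal.Tendsto.mul_const (ENNReal.Tendsto.const_mul h1
      (Or.inr (enorm_ne_top (x := g (x i))))) (Or.inr (enorm_ne_top (x := w x)))
    simpa using h2

lemma enorm_prod' {ι : Type*} (s : Finset ι) (f : ι → ℝ) : ‖∏ i ∈ s, f i‖ₑ = ∏ i ∈ s, ‖f i‖ₑ := by
  simp only [Real.enorm_eq_ofReal_abs, Finset.abs_prod]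
  rw [ENNReal.ofReal_prod_of_nonneg fun _ _ => abs_nonneg _]

lemma lintegral_prod_enorm {n : ℕ} {h : Fin n → EucSp d → ℝ} (hi : ∀ l, Integrable (h l)) :
    ∫⁻ x : Fin n → EucSp d, ∏ l, ‖h l (x l)‖ₑ = ∏ l, ∫⁻ t, ‖h l t‖ₑ := by
  simp_rw [← enorm_prod', ← ofReal_integral_norm_eq_lintegral_enorm (hi _)]
  rw [← ENNReal.ofReal_prod_of_nonneg fun _ _ => integral_nonneg fun _ => norm_nonneg _,
    ← integral_fintype_prod_volume_eq_prod (fun l t => ‖h l t‖),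
    ← ofReal_integral_norm_eq_lintegral_enorm]
  · simp
  · rw [volume_pi]
    exact Integrable.fintype_prod hi

/-- A factor `∏ ρ` containing a mixed Ursell block becomes small. -/
lemma tendsto_mixed {k u : ∀ n : ℕ, (Fin n → EucSp d) → ℝ} (hu : UrsellData k u)
    {g : EucSp d → ℝ} (hg : MayerFn g) {N : ℕ} (A b : Finset (Fin N)) (hbA : ¬ b ⊆ A)
    (hbA' : ¬ b ⊆ Aᶜ) :
    Tendsto (fun v => ∫⁻ x : Fin N → EucSp d,
      (∏ i, ‖if i ∈ A then g (x i) else g (x i - v)‖ₑ) * ‖blockU u x b‖ₑ)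
      (Bornology.cobounded (EucSp d)) (𝓝 0) := by
  obtain ⟨G, hG0, hG⟩ := hg.bdd
  have hGe : ∀ x, ‖g x‖ₑ ≤ ENNReal.ofReal G := fun x => by
    rw [Real.enorm_eq_ofReal_abs]; exact ENNReal.ofReal_le_ofReal (hG x)
  obtain ⟨j, hjb, hjA⟩ := Finset.not_subset.1 hbA
  obtain ⟨i, hib, hiA⟩ := Finset.not_subset.1 hbA'
  rw [Finset.mem_compl, not_not] at hiA
  have hij : i ≠ j := fun h => hjA (h ▸ hiA)
  obtain ⟨m, hm⟩ : ∃ m, b.card = m + 2 :=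
    ⟨b.card - 2, by have := Finset.one_lt_card.2 ⟨i, hib, j, hjb, hij⟩; omega⟩
  set I : ℝ≥0∞ := ∫⁻ x, ‖g x‖ₑ with hI
  have hItop : I ≠ ⊤ := hg.int.2.ne
  obtain ⟨i', rfl⟩ : ∃ i', b.orderEmbOfFin rfl i' = i := by
    have : i ∈ Set.range (b.orderEmbOfFin rfl) := by simpa using hib
    exact this
  obtain ⟨j', rfl⟩ : ∃ j', b.orderEmbOfFin rfl j' = j := by
    have : j ∈ Set.range (b.orderEmbOfFin rfl) := by simpa using hjb
    exact this
  have hij' : i' ≠ j' := fun h => hij (by rw [h])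
  set ρ : EucSp d → Fin N → EucSp d → ℝ≥0∞ := fun v l t =>
    ‖if l ∈ A then g t else g (t - v)‖ₑ with hρ
  have hρm : ∀ v l, Measurable (ρ v l) := by
    intro v l
    by_cases h : l ∈ A
    · simpa [hρ, h] using hg.meas.enorm
    · simpa [hρ, h] using (hg.meas.comp (measurable_id.sub_const v)).enorm
  have hρG : ∀ v l t, ρ v l t ≤ ENNReal.ofReal G := by
    intro v l t
    by_cases h : l ∈ A <;> simp [hρ, h, hGe]
  have hρI : ∀ v l, ∫⁻ t, ρ v l t = I := by
    intro v l
    by_cases h : l ∈ A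
    · simp [hρ, h, hI]
    · simp only [hρ, h, if_false]
      exact lintegral_sub_right_eq_self (fun t => ‖g t‖ₑ) v
  have hucm : Measurable (u b.card) := by rw [hm]; exact hu.meas _
  have hsplit : ∀ v, ∫⁻ x : Fin N → EucSp d, (∏ i, ρ v i (x i)) * ‖blockU u x b‖ₑ =
      (∫⁻ y : Fin b.card → EucSp d, (∏ l, ρ v (b.orderEmbOfFin rfl l) (y l)) * ‖u b.card y‖ₑ) *
        I ^ bᶜ.card := by
    intro v
    have h1 : ∫⁻ y : Fin bᶜ.card → EucSp d, ∏ l, ρ v (bᶜ.orderEmbOfFin rfl l) (y l) =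
        I ^ bᶜ.card := by
      have hi : ∀ l : Fin bᶜ.card, Integrable fun t =>
          if bᶜ.orderEmbOfFin rfl l ∈ A then g t else g (t - v) := by
        intro l
        split_ifs
        exacts [hg.int, hg.int.comp_sub_right v]
      refine (lintegral_prod_enorm hi).trans ?_
      rw [Finset.prod_congr rfl fun l _ => hρI v (bᶜ.orderEmbOfFin rfl l)]
      simp
    rw [← h1, ← lintegral_split b]
    · refine lintegral_congr fun x => ?_
      rw [← Finset.prod_mul_prod_compl b, prod_orderEmb b, prod_orderEmb bᶜ, blockU]
      ring
    · exact (Finset.measurable_prod _ fun l _ => (hρm v _).comp (measurable_pi_apply l)).mul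
        hucm.enorm
    · exact Finset.measurable_prod _ fun l _ => (hρm v _).comp (measurable_pi_apply l)
  have hbound : ∀ v, ∫⁻ x : Fin N → EucSp d, (∏ i, ρ v i (x i)) * ‖blockU u x b‖ₑ ≤
      (ENNReal.ofReal G ^ (b.card - 2) * ∫⁻ y : Fin b.card → EucSp d,
        ‖g (y i')‖ₑ * ‖g (y j' - v)‖ₑ * ‖u b.card y‖ₑ) * I ^ bᶜ.card := by
    intro v
    rw [hsplit, ← lintegral_const_mul']
    swap; · exact ENNReal.pow_ne_top ENNReal.ofReal_ne_top
    refine mul_le_mul_left (lintegral_mono fun y => ?_) _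
    rw [← mul_assoc]
    refine mul_le_mul_left ?_ _
    have hjmem : j' ∈ Finset.univ.erase i' := Finset.mem_erase.2 ⟨hij'.symm, Finset.mem_univ _⟩
    rw [← Finset.mul_prod_erase _ _ (Finset.mem_univ i'), ← Finset.mul_prod_erase _ _ hjmem,
      ← mul_assoc, mul_comm]
    gcongr
    · refine (Finset.prod_le_pow_card _ _ _ fun l _ => hρG v _ _).trans (le_of_eq ?_)
      rw [Finset.card_erase_of_mem hjmem, Finset.card_erase_of_mem (Finset.mem_univ _),
        Finset.card_univ, Fintype.card_fin, Nat.sub_sub]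
    · simp [hρ, hiA]
    · simp [hρ, hjA]
  have hlim : Tendsto (fun v => ∫⁻ y : Fin b.card → EucSp d,
        ‖g (y i')‖ₑ * ‖g (y j' - v)‖ₑ * ‖u b.card y‖ₑ) (Bornology.cobounded (EucSp d)) (𝓝 0) := by
    have hgen : ∀ c (i j : Fin c), c = m + 2 → Tendsto (fun v => ∫⁻ y : Fin c → EucSp d,
        ‖g (y i)‖ₑ * ‖g (y j - v)‖ₑ * ‖u c y‖ₑ) (Bornology.cobounded (EucSp d)) (𝓝 0) := by
      rintro c i j rfl
      exact tendsto_pair_lintegral (hu.meas _) (hu.ti _) (hu.int m) hg i j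
    exact hgen _ i' j' hm
  refine tendsto_of_tendsto_of_tendsto_of_le_of_le tendsto_const_nhds ?_
    (fun _ => zero_le) hbound
  have h1 := ENNReal.Tendsto.mul_const (ENNReal.Tendsto.const_mul hlim
    (Or.inr (ENNReal.pow_ne_top (n := b.card - 2) (ENNReal.ofReal_ne_top (r := G)))))
    (Or.inr (ENNReal.pow_ne_top (n := bᶜ.card) hItop))
  simpa using h1

end Clustering

section ClusterLimit

variable {d : ℕ}

/-- The `n`-th coefficient of `Zexp` without the factorial. -/
def corrInt (k : ∀ n : ℕ, (Fin n → EucSp d) → ℝ) (g : EucSp d → ℝ) (n : ℕ) : ℝ :=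
  ∫ x : Fin n → EucSp d, (∏ i, g (x i)) * k n x

/-- `g` shifted by `v` and multiplied by `1 + g`. -/
def shiftG (g : EucSp d → ℝ) (v x : EucSp d) : ℝ := g (x - v) * (1 + g x)

variable {g : EucSp d → ℝ}

lemma MayerFn.measurable_shiftG (hg : MayerFn g) (v : EucSp d) : Measurable (shiftG g v) :=
  (hg.meas.comp (measurable_id.sub_const v)).mul (hg.meas.const_add 1)

lemma abs_shiftG_le {G : ℝ} (hG : ∀ x, |g x| ≤ G) (v x : EucSp d) :
    |shiftG g v x| ≤ (1 + G) * |g (x - v)| := by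
  rw [shiftG, abs_mul, mul_comm]
  gcongr
  refine (abs_add_le _ _).trans ?_
  rw [abs_one]
  gcongr
  exact hG x

lemma MayerFn.integrable_shiftG (hg : MayerFn g) (v : EucSp d) : Integrable (shiftG g v) := by
  obtain ⟨G, hG0, hG⟩ := hg.bdd
  exact ((hg.int.comp_sub_right v).abs.const_mul (1 + G)).mono'
    (hg.measurable_shiftG v).aestronglyMeasurable (ae_of_all _ fun x => abs_shiftG_le hG v x)

lemma MayerFn.integral_abs_shiftG_le (hg : MayerFn g) {G : ℝ} (hG : ∀ x, |g x| ≤ G)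
    (v : EucSp d) : ∫ x, |shiftG g v x| ≤ (1 + G) * ∫ x, |g x| := by
  have h1 : ∫ x, |g x| = ∫ x, |g (x - v)| := (integral_sub_right_eq_self (fun x => |g x|) v).symm
  rw [h1, ← integral_const_mul]
  exact integral_mono (hg.integrable_shiftG v).abs
    ((hg.int.comp_sub_right v).abs.const_mul (1 + G)) fun x => abs_shiftG_le hG v x

lemma UrsellData.blockU_bdd {k u : ∀ n : ℕ, (Fin n → EucSp d) → ℝ} (hu : UrsellData k u) {N : ℕ}
    {b : Finset (Fin N)} (hb : b.Nonempty) : ∃ C, 0 ≤ C ∧ ∀ x : Fin N → EucSp d,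
      |blockU u x b| ≤ C := by
  obtain ⟨C, hC0, hC⟩ := hu.bdd (b.card - 1)
  have : b.card = (b.card - 1) + 1 := by have := Finset.card_pos.2 hb; omega
  exact ⟨C, hC0, fun x => by rw [blockU_eq u x b this]; exact hC _⟩

lemma corr_sub_eq_mixed {k u : ∀ n : ℕ, (Fin n → EucSp d) → ℝ} (hu : UrsellData k u) {N : ℕ}
    (A : Finset (Fin N)) (x : Fin N → EucSp d) :
    k N x - k A.card (fun i => x (A.orderEmbOfFin rfl i)) *
        k Aᶜ.card (fun i => x (Aᶜ.orderEmbOfFin rfl i)) =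
      ∑ P : Finset (Finset (Fin N)), if IsPartOf Finset.univ P ∧ ¬ Unmixed A P then
        ∏ b ∈ P, blockU u x b else 0 := by
  have hA : ∀ A : Finset (Fin N), k A.card (fun i => x (A.orderEmbOfFin rfl i)) =
      partSum u x A := by
    intro A
    rw [hu.partSum_univ, ← partSum_map]
    congr 1
    exact Finset.map_orderEmbOfFin_univ A rfl
  rw [hA, hA, hu.partSum_univ, partSum, partSum, partSum, ← sum_unmixed, ← Finset.sum_sub_distrib]
  refine Finset.sum_congr rfl fun P _ => ?_
  by_cases h1 : IsPartOf Finset.univ P <;> by_cases h2 : Unmixed A P <;> simp [h1, h2]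

lemma tendsto_mixed_sum {k u : ∀ n : ℕ, (Fin n → EucSp d) → ℝ} (hu : UrsellData k u)
    (hg : MayerFn g) {N : ℕ} (A : Finset (Fin N)) :
    Tendsto (fun v => ∫⁻ x : Fin N → EucSp d,
      ‖(∏ i ∈ A, g (x i)) * ∏ i ∈ Aᶜ, shiftG g v (x i)‖ₑ *
        ‖k N x - k A.card (fun i => x (A.orderEmbOfFin rfl i)) *
          k Aᶜ.card (fun i => x (Aᶜ.orderEmbOfFin rfl i))‖ₑ)
      (Bornology.cobounded (EucSp d)) (𝓝 0) := by
  obtain ⟨G, hG0, hG⟩ := hg.bdd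
  have hW : ∀ v (x : Fin N → EucSp d), ‖(∏ i ∈ A, g (x i)) * ∏ i ∈ Aᶜ, shiftG g v (x i)‖ₑ ≤
      ENNReal.ofReal (1 + G) ^ N * ∏ i, ‖if i ∈ A then g (x i) else g (x i - v)‖ₑ := by
    intro v x
    have h1 : (∏ i ∈ A, g (x i)) * ∏ i ∈ Aᶜ, shiftG g v (x i) =
        ∏ i, if i ∈ A then g (x i) else shiftG g v (x i) := by
      rw [Finset.prod_ite]
      congr 1
      · exact Finset.prod_congr (by simp) fun _ _ => rfl
      · exact Finset.prod_congr (by ext; simp) fun _ _ => rfl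
    have h2 : ENNReal.ofReal (1 + G) ^ N = ∏ i : Fin N, ENNReal.ofReal (1 + G) := by simp
    rw [h1, enorm_prod', h2, ← Finset.prod_mul_distrib]
    refine Finset.prod_le_prod' fun i _ => ?_
    simp only [Real.enorm_eq_ofReal_abs]
    rw [← ENNReal.ofReal_mul (by positivity)]
    refine ENNReal.ofReal_le_ofReal ?_
    split_ifs
    · nlinarith [abs_nonneg (g (x i))]
    · exact abs_shiftG_le hG v _
  have hP : ∀ P : Finset (Finset (Fin N)), ∃ C : ℝ≥0∞, ∃ b : Finset (Fin N), C ≠ ⊤ ∧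
      (IsPartOf Finset.univ P ∧ ¬ Unmixed A P → (¬ b ⊆ A ∧ ¬ b ⊆ Aᶜ) ∧
        ∀ x : Fin N → EucSp d, ‖∏ b ∈ P, blockU u x b‖ₑ ≤ C * ‖blockU u x b‖ₑ) := by
    intro P
    by_cases h : IsPartOf Finset.univ P ∧ ¬ Unmixed A P
    · obtain ⟨b, hb⟩ := not_forall.1 h.2
      obtain ⟨hbP, hb⟩ := Classical.not_imp.1 hb
      choose! C hC0 hC using fun b (hb : b ∈ P) => hu.blockU_bdd (h.1.1 b hb)
      refine ⟨∏ c ∈ P.erase b, ENNReal.ofReal (C c), b,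
        ENNReal.prod_ne_top fun _ _ => ENNReal.ofReal_ne_top, fun _ => ⟨not_or.1 hb, fun x => ?_⟩⟩
      rw [enorm_prod', ← Finset.mul_prod_erase _ _ hbP, mul_comm]
      gcongr with c hc
      rw [Real.enorm_eq_ofReal_abs]
      exact ENNReal.ofReal_le_ofReal (hC c (Finset.mem_of_mem_erase hc) x)
    · exact ⟨0, ∅, ENNReal.zero_ne_top, fun h' => absurd h' h⟩
  choose C b hCtop hCb using hP
  have hbm : ∀ P, IsPartOf Finset.univ P ∧ ¬ Unmixed A P →
      Measurable fun x : Fin N → EucSp d => blockU u x (b P) := by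
    intro P hP
    have hne : (b P).Nonempty := by
      rw [Finset.nonempty_iff_ne_empty]
      intro h0
      exact (hCb P hP).1.1 (by simp [h0])
    have : (b P).card = ((b P).card - 1) + 1 := by have := Finset.card_pos.2 hne; omega
    simp_rw [fun x : Fin N → EucSp d => blockU_eq u x (b P) this]
    exact (hu.meas _).comp (measurable_pi_lambda _ fun i => measurable_pi_apply _)
  have hρm : ∀ v, Measurable fun x : Fin N → EucSp d =>
      ∏ i, ‖if i ∈ A then g (x i) else g (x i - v)‖ₑ := by
    intro v
    refine Finset.measurable_prod _ fun i _ => ?_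
    by_cases h : i ∈ A
    · simpa [h] using (hg.meas.comp (measurable_pi_apply i)).enorm
    · simp only [h, if_false]
      have hs : Measurable fun x : Fin N → EucSp d => x i - v :=
        (measurable_pi_apply i).sub measurable_const
      exact (hg.meas.comp hs).enorm
  have hlim : Tendsto (fun v => ∑ P : Finset (Finset (Fin N)),
      if IsPartOf Finset.univ P ∧ ¬ Unmixed A P then ENNReal.ofReal (1 + G) ^ N * C P *
        ∫⁻ x : Fin N → EucSp d, (∏ i, ‖if i ∈ A then g (x i) else g (x i - v)‖ₑ) *
          ‖blockU u x (b P)‖ₑ else 0) (Bornology.cobounded (EucSp d)) (𝓝 0) := by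
    have : Tendsto (fun v => ∑ P : Finset (Finset (Fin N)),
      if IsPartOf Finset.univ P ∧ ¬ Unmixed A P then ENNReal.ofReal (1 + G) ^ N * C P *
        ∫⁻ x : Fin N → EucSp d, (∏ i, ‖if i ∈ A then g (x i) else g (x i - v)‖ₑ) *
          ‖blockU u x (b P)‖ₑ else 0) (Bornology.cobounded (EucSp d))
        (𝓝 (∑ _ : Finset (Finset (Fin N)), 0)) := by
      refine tendsto_finsetSum _ fun P _ => ?_
      split_ifs with h
      · have h1 := tendsto_mixed hu hg A (b P) (hCb P h).1.1 (hCb P h).1.2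
        have h2 := ENNReal.Tendsto.const_mul h1 (a := ENNReal.ofReal (1 + G) ^ N * C P)
          (Or.inr (ENNReal.mul_ne_top (ENNReal.pow_ne_top ENNReal.ofReal_ne_top) (hCtop P)))
        simpa using h2
      · exact tendsto_const_nhds
    simpa using this
  refine tendsto_of_tendsto_of_tendsto_of_le_of_le tendsto_const_nhds hlim (fun _ => zero_le)
    fun v => ?_
  simp only [corr_sub_eq_mixed hu A]
  calc _ ≤ ∫⁻ x : Fin N → EucSp d, ∑ P : Finset (Finset (Fin N)),
        if IsPartOf Finset.univ P ∧ ¬ Unmixed A P then ENNReal.ofReal (1 + G) ^ N * C P *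
        ((∏ i, ‖if i ∈ A then g (x i) else g (x i - v)‖ₑ) * ‖blockU u x (b P)‖ₑ) else 0 := by
        refine lintegral_mono fun x => ?_
        refine (mul_le_mul' (hW v x) (enorm_sum_le _ _)).trans ?_
        rw [Finset.mul_sum]
        refine Finset.sum_le_sum fun P _ => ?_
        split_ifs with h
        · calc _ ≤ ENNReal.ofReal (1 + G) ^ N *
                (∏ i, ‖if i ∈ A then g (x i) else g (x i - v)‖ₑ) *
                (C P * ‖blockU u x (b P)‖ₑ) := by
                gcongr
                exact (hCb P h).2 x
            _ = _ := by ring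
        · simp
    _ = _ := by
        rw [lintegral_finsetSum']
        · refine Finset.sum_congr rfl fun P _ => ?_
          split_ifs with h
          · rw [lintegral_const_mul]
            exact (hρm v).mul (hbm P h).enorm
          · simp
        · intro P _
          split_ifs with h
          · exact (((hρm v).mul (hbm P h).enorm).const_mul _).aemeasurable
          · exact aemeasurable_const

variable {μ : Measure (Config d)} {k u : ∀ n : ℕ, (Fin n → EucSp d) → ℝ} {ξ : ℝ}

lemma tendsto_add_cobounded (t : EucSp d) :
    Tendsto (fun v => t + v) (Bornology.cobounded (EucSp d)) (Bornology.cobounded (EucSp d)) := by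
  rw [← tendsto_norm_atTop_iff_cobounded]
  refine tendsto_atTop_mono (f := fun v => ‖v‖ + -‖t‖) (fun v => ?_)
    (tendsto_atTop_add_const_right _ _ tendsto_norm_cobounded_atTop)
  have := norm_sub_le (t + v) t
  rw [add_sub_cancel_left] at this
  linarith

lemma CorrData.tendsto_corrInt_shiftG (hk : CorrData μ k ξ) (hg : MayerFn g) (m : ℕ) :
    Tendsto (fun v => corrInt k (shiftG g v) m) (Bornology.cobounded (EucSp d))
      (𝓝 (corrInt k g m)) := by
  obtain ⟨G, hG0, hG⟩ := hg.bdd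
  have h1 : ∀ v, corrInt k (shiftG g v) m =
      ∫ x : Fin m → EucSp d, (∏ i, g (x i) * (1 + g (x i + v))) * k m x := by
    intro v
    rw [corrInt, ← integral_add_right_eq_self _ (fun _ : Fin m => v)]
    refine integral_congr_ae (ae_of_all _ fun x => ?_)
    simp only [shiftG, Pi.add_apply, add_sub_cancel_right]
    congr 1
    exact hk.ti m v x
  simp_rw [h1, corrInt]
  have hint : Integrable fun x : Fin m → EucSp d => (1 + G) ^ m * ‖(∏ i, g (x i)) * k m x‖ :=
    (hk.integrable_term m (integrable_tensor hg.int m)).norm.const_mul _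
  refine tendsto_integral_filter_of_dominated_convergence _ ?_ ?_ hint ?_
  · refine Eventually.of_forall fun v => Measurable.aestronglyMeasurable ?_
    refine Measurable.mul (Finset.measurable_prod _ fun i _ => ?_) (hk.meas m)
    have hs : Measurable fun x : Fin m → EucSp d => x i + v :=
      (measurable_pi_apply i).add measurable_const
    exact (hg.meas.comp (measurable_pi_apply i)).mul ((hg.meas.comp hs).const_add 1)
  · refine Eventually.of_forall fun v => ae_of_all _ fun x => ?_
    rw [norm_mul, norm_mul, ← mul_assoc, Finset.prod_mul_distrib, norm_mul,
      mul_comm ‖∏ i, g (x i)‖]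
    gcongr
    rw [Real.norm_eq_abs, Finset.abs_prod]
    have hconst : (1 + G) ^ m = ∏ _i : Fin m, (1 + G) := by simp
    rw [hconst]
    refine Finset.prod_le_prod (fun _ _ => abs_nonneg _) fun i _ => ?_
    refine (abs_add_le _ _).trans ?_
    rw [abs_one]
    gcongr
    exact hG _
  · refine ae_of_all _ fun x => Tendsto.mul_const _ ?_
    refine tendsto_finsetProd _ fun i _ => ?_
    have := ((hg.van.comp (tendsto_add_cobounded (x i))).const_add 1).const_mul (g (x i))
    simpa using this

lemma CorrData.tendsto_corrInt_subset (hk : CorrData μ k ξ) (hu : UrsellData k u) (hg : MayerFn g)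
    {N : ℕ} (A : Finset (Fin N)) :
    Tendsto (fun v => ∫ x : Fin N → EucSp d,
      ((∏ i ∈ A, g (x i)) * ∏ i ∈ Aᶜ, shiftG g v (x i)) * k N x)
      (Bornology.cobounded (EucSp d)) (𝓝 (corrInt k g A.card * corrInt k g Aᶜ.card)) := by
  set W : EucSp d → (Fin N → EucSp d) → ℝ := fun v x =>
    (∏ i ∈ A, g (x i)) * ∏ i ∈ Aᶜ, shiftG g v (x i) with hW
  have hprod : ∀ v, ∫ x : Fin N → EucSp d, W v x * (k A.card (fun i => x (A.orderEmbOfFin rfl i)) *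
      k Aᶜ.card (fun i => x (Aᶜ.orderEmbOfFin rfl i))) =
      corrInt k g A.card * corrInt k (shiftG g v) Aᶜ.card := by
    intro v
    rw [corrInt, corrInt, ← integral_split A]
    · refine integral_congr_ae (ae_of_all _ fun x => ?_)
      simp only [hW]
      rw [prod_orderEmb A, prod_orderEmb Aᶜ]
      ring
    · exact (Finset.measurable_prod _ fun i _ => hg.meas.comp (measurable_pi_apply i)).mul
        (hk.meas _)
    · exact (Finset.measurable_prod _ fun i _ =>
        (hg.measurable_shiftG v).comp (measurable_pi_apply i)).mul (hk.meas _)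
  have hWi : ∀ v, Integrable (W v) := by
    intro v
    have h1 : ∀ x : Fin N → EucSp d, W v x = ∏ i, if i ∈ A then g (x i) else shiftG g v (x i) := by
      intro x
      simp only [hW]
      rw [Finset.prod_ite]
      congr 1
      · exact Finset.prod_congr (by simp) fun _ _ => rfl
      · exact Finset.prod_congr (by ext; simp) fun _ _ => rfl
    rw [show W v = _ from funext h1, volume_pi]
    refine Integrable.fintype_prod (f := fun i t => if i ∈ A then g t else shiftG g v t) fun i => ?_
    split_ifs
    exacts [hg.int, hg.integrable_shiftG v]
  have hkm : ∀ A : Finset (Fin N), Measurable fun x : Fin N → EucSp d =>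
      k A.card (fun i => x (A.orderEmbOfFin rfl i)) := fun A =>
    (hk.meas _).comp (measurable_pi_lambda _ fun i => measurable_pi_apply _)
  have hi2 : ∀ v, Integrable fun x : Fin N → EucSp d =>
      W v x * (k A.card (fun i => x (A.orderEmbOfFin rfl i)) *
      k Aᶜ.card (fun i => x (Aᶜ.orderEmbOfFin rfl i))) := by
    intro v
    refine (hWi v).mul_bdd (c := ξ ^ A.card * ξ ^ Aᶜ.card)
      ((hkm A).mul (hkm Aᶜ)).aestronglyMeasurable (ae_of_all _ fun x => ?_)
    rw [norm_mul, Real.norm_of_nonneg (hk.nonneg _ _), Real.norm_of_nonneg (hk.nonneg _ _)]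
    exact mul_le_mul (hk.bound _ _) (hk.bound _ _) (hk.nonneg _ _) (pow_nonneg hk.xi_pos.le _)
  have hdiff : Tendsto (fun v => (∫ x, W v x * k N x) -
      corrInt k g A.card * corrInt k (shiftG g v) Aᶜ.card)
      (Bornology.cobounded (EucSp d)) (𝓝 0) := by
    rw [tendsto_zero_iff_enorm_tendsto_zero]
    refine tendsto_of_tendsto_of_tendsto_of_le_of_le tendsto_const_nhds
      (tendsto_mixed_sum hu hg A) (fun _ => zero_le) fun v => ?_
    simp only
    rw [← hprod, ← integral_sub (hk.integrable_term N (hWi v)) (hi2 v)]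
    refine (enorm_integral_le_lintegral_enorm _).trans (le_of_eq ?_)
    refine lintegral_congr fun x => ?_
    rw [← mul_sub, enorm_mul]
  have h2 := hdiff.add ((hk.tendsto_corrInt_shiftG hg Aᶜ.card).const_mul (corrInt k g A.card))
  simpa using h2

lemma CorrData.tendsto_corrInt (hk : CorrData μ k ξ) (hu : UrsellData k u) (hg : MayerFn g)
    (n : ℕ) : Tendsto (fun v => corrInt k (fun x => g x + shiftG g v x) n)
      (Bornology.cobounded (EucSp d))
      (𝓝 (∑ m ∈ Finset.range (n + 1), n.choose m * (corrInt k g m * corrInt k g (n - m)))) := by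
  have hsum : ∑ m ∈ Finset.range (n + 1), n.choose m * (corrInt k g m * corrInt k g (n - m)) =
      ∑ A : Finset (Fin n), corrInt k g A.card * corrInt k g Aᶜ.card := by
    have := Finset.sum_powerset_apply_card (fun m => corrInt k g m * corrInt k g (n - m))
      (x := (Finset.univ : Finset (Fin n)))
    simp only [Finset.card_univ, Fintype.card_fin, nsmul_eq_mul, Finset.powerset_univ] at this
    rw [← this]
    exact Finset.sum_congr rfl fun A _ => by rw [Finset.card_compl, Fintype.card_fin]
  rw [hsum]
  have hW : ∀ v (A : Finset (Fin n)), Integrable fun x : Fin n → EucSp d =>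
      ((∏ i ∈ A, g (x i)) * ∏ i ∈ Aᶜ, shiftG g v (x i)) * k n x := by
    intro v A
    refine hk.integrable_term n ?_
    have h1 : ∀ x : Fin n → EucSp d, (∏ i ∈ A, g (x i)) * ∏ i ∈ Aᶜ, shiftG g v (x i) =
        ∏ i, if i ∈ A then g (x i) else shiftG g v (x i) := by
      intro x
      rw [Finset.prod_ite]
      congr 1
      · exact Finset.prod_congr (by simp) fun _ _ => rfl
      · exact Finset.prod_congr (by ext; simp) fun _ _ => rfl
    simp_rw [h1]
    rw [volume_pi]
    refine Integrable.fintype_prod (f := fun i t => if i ∈ A then g t else shiftG g v t) fun i => ?_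
    split_ifs
    exacts [hg.int, hg.integrable_shiftG v]
  have heq : ∀ v, corrInt k (fun x => g x + shiftG g v x) n = ∑ A : Finset (Fin n),
      ∫ x : Fin n → EucSp d, ((∏ i ∈ A, g (x i)) * ∏ i ∈ Aᶜ, shiftG g v (x i)) * k n x := by
    intro v
    rw [corrInt, ← integral_finsetSum _ fun A _ => hW v A]
    refine integral_congr_ae (ae_of_all _ fun x => ?_)
    simp only
    rw [Fintype.prod_add, Finset.sum_mul]
  simp_rw [heq]
  exact tendsto_finsetSum _ fun A _ => hk.tendsto_corrInt_subset hu hg A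

lemma CorrData.norm_corrInt_le (hk : CorrData μ k ξ) (hgi : Integrable g) (n : ℕ) :
    ‖(n.factorial : ℝ)⁻¹ * corrInt k g n‖ ≤ (n.factorial : ℝ)⁻¹ * (ξ * ∫ x, |g x|) ^ n := by
  rw [norm_mul, norm_inv, RCLike.norm_natCast]
  gcongr
  exact (abs_integral_le_integral_abs).trans (hk.norm_term_le hgi n)

lemma summable_inv_factorial_mul (R : ℝ) : Summable fun n : ℕ => (n.factorial : ℝ)⁻¹ * R ^ n := by
  simpa [div_eq_inv_mul] using NormedSpace.expSeries_div_summable (𝔸 := ℝ) R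

/-- The clustering property for `Zexp`. -/
lemma CorrData.tendsto_Zexp (hk : CorrData μ k ξ) (hu : UrsellData k u) (hg : MayerFn g) :
    Tendsto (fun v => Zexp k fun x => g x + shiftG g v x) (Bornology.cobounded (EucSp d))
      (𝓝 (Zexp k g ^ 2)) := by
  obtain ⟨G, hG0, hG⟩ := hg.bdd
  have hnorm : Summable fun n : ℕ => ‖(n.factorial : ℝ)⁻¹ * corrInt k g n‖ :=
    Summable.of_nonneg_of_le (fun _ => norm_nonneg _) (fun n => hk.norm_corrInt_le hg.int n)
      (summable_inv_factorial_mul _)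
  have hsq : Zexp k g ^ 2 = ∑' n : ℕ, (n.factorial : ℝ)⁻¹ *
      ∑ m ∈ Finset.range (n + 1), n.choose m * (corrInt k g m * corrInt k g (n - m)) := by
    rw [sq]
    refine (tsum_mul_tsum_eq_tsum_sum_range_of_summable_norm hnorm hnorm).trans ?_
    refine tsum_congr fun n => ?_
    rw [Finset.mul_sum]
    refine Finset.sum_congr rfl fun m hm => ?_
    have hmn : m ≤ n := Nat.lt_succ_iff.1 (Finset.mem_range.1 hm)
    rw [Nat.cast_choose ℝ hmn]
    have h1 : (n.factorial : ℝ) ≠ 0 := by positivity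
    have h2 : (m.factorial : ℝ) ≠ 0 := by positivity
    have h3 : ((n - m).factorial : ℝ) ≠ 0 := by positivity
    field_simp
  rw [hsq]
  refine tendsto_tsum_of_dominated_convergence
    (summable_inv_factorial_mul (ξ * ((2 + G) * ∫ x, |g x|)))
    (fun n => (hk.tendsto_corrInt hu hg n).const_mul _) (Eventually.of_forall fun v n => ?_)
  have hint : Integrable fun x => g x + shiftG g v x := hg.int.add (hg.integrable_shiftG v)
  refine (hk.norm_corrInt_le hint n).trans ?_
  have hxi := hk.xi_pos.le
  have h0 : 0 ≤ ∫ x, |g x + shiftG g v x| := integral_nonneg fun _ => abs_nonneg _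
  gcongr
  calc ∫ x, |g x + shiftG g v x| ≤ ∫ x, (|g x| + |shiftG g v x|) :=
        integral_mono hint.abs (hg.int.abs.add (hg.integrable_shiftG v).abs) fun x => abs_add_le _ _
    _ = (∫ x, |g x|) + ∫ x, |shiftG g v x| :=
        integral_add hg.int.abs (hg.integrable_shiftG v).abs
    _ ≤ (2 + G) * ∫ x, |g x| := by
        have := hg.integral_abs_shiftG_le hG v
        linarith

end ClusterLimit

section Potential

variable {d : ℕ}

/-- The real-valued version of a pair potential, with value `0` at the origin. -/
def psi (φ : EucSp d → EReal) (x : EucSp d) : ℝ := if x = 0 then 0 else (φ x).toReal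

/-- A real even potential, bounded below, vanishing and integrable at infinity. -/
structure PotData (ψ : EucSp d → ℝ) : Prop where
  meas : Measurable ψ
  even : ∀ x, ψ (-x) = ψ x
  lb : ∃ b, 0 ≤ b ∧ ∀ x, -b ≤ ψ x
  van : Tendsto ψ (Bornology.cobounded (EucSp d)) (𝓝 0)
  tail : ∃ R, IntegrableOn ψ {x | R ≤ ‖x‖}

lemma exp_neg_sub_one_abs_ge {t : ℝ} (ht : |t| ≤ 1) :
    |t| ≤ Real.exp 1 * |Real.exp (-t) - 1| := by
  obtain ⟨h1, h2⟩ := abs_le.1 ht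
  have he : 1 ≤ Real.exp 1 := Real.one_le_exp zero_le_one
  rcases le_total 0 t with h | h
  · have h3 : Real.exp (-t) ≤ 1 := Real.exp_le_one_iff.2 (by linarith)
    rw [abs_of_nonneg h, abs_of_nonpos (by linarith)]
    have h4 := Real.add_one_le_exp t
    have h5 : Real.exp (-t) * Real.exp t = 1 := by rw [← Real.exp_add]; simp
    have h6 : Real.exp t ≤ Real.exp 1 := Real.exp_le_exp.2 h2
    have h7 := Real.exp_pos (-t)
    have h8 : Real.exp t - 1 = Real.exp t * (1 - Real.exp (-t)) := by linear_combination h5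
    have h9 : 0 ≤ 1 - Real.exp (-t) := by linarith
    nlinarith
  · have h3 : 1 ≤ Real.exp (-t) := Real.one_le_exp (by linarith)
    rw [abs_of_nonpos h, abs_of_nonneg (by linarith)]
    have h4 := Real.add_one_le_exp (-t)
    nlinarith

lemma abs_exp_neg_sub_one_le {c t : ℝ} (hc : 0 ≤ c) (ht : |t| ≤ 1) :
    |Real.exp (-(c * t)) - 1| ≤ c * Real.exp c * |t| := by
  have h1 : ∀ v : ℝ, |v| ≤ c → |Real.exp v - 1| ≤ Real.exp c * |v| := by
    intro v hv
    have h2 := Real.add_one_le_exp v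
    have h3 := Real.add_one_le_exp (-v)
    have h5 : Real.exp (-v) * Real.exp v = 1 := by rw [← Real.exp_add]; simp
    have h6 : Real.exp v ≤ Real.exp c := Real.exp_le_exp.2 ((le_abs_self v).trans hv)
    have h7 : 1 ≤ Real.exp c := Real.one_le_exp hc
    rcases le_total 0 v with h | h
    · rw [abs_of_nonneg h, abs_of_nonneg (by linarith)]
      nlinarith [Real.exp_pos v]
    · have h8 : Real.exp v ≤ 1 := Real.exp_le_one_iff.2 h
      rw [abs_of_nonpos h, abs_of_nonpos (by linarith)]
      nlinarith
  have h2 := h1 (-(c * t)) (by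
    rw [abs_neg, abs_mul, abs_of_nonneg hc]
    exact mul_le_of_le_one_right hc ht)
  rw [abs_neg, abs_mul, abs_of_nonneg hc] at h2
  linarith

lemma volume_lt_norm_compl (R : ℝ) : (volume : Measure (EucSp d)) {x | R ≤ ‖x‖}ᶜ < ⊤ := by
  have : {x : EucSp d | R ≤ ‖x‖}ᶜ = Metric.ball 0 R := by ext x; simp
  rw [this]
  exact measure_ball_lt_top

lemma measurableSet_le_norm (R : ℝ) : MeasurableSet {x : EucSp d | R ≤ ‖x‖} :=
  measurableSet_le measurable_const measurable_norm

lemma exists_le_norm_of_tendsto {g : EucSp d → ℝ}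
    (h : Tendsto g (Bornology.cobounded (EucSp d)) (𝓝 0)) {δ : ℝ} (hδ : 0 < δ) :
    ∃ R, ∀ x, R ≤ ‖x‖ → |g x| ≤ δ := by
  have h1 : ∀ᶠ x in Bornology.cobounded (EucSp d), |g x| ≤ δ := by
    filter_upwards [(Metric.tendsto_nhds.1 h) δ hδ] with x hx
    rw [Real.dist_eq, sub_zero] at hx
    exact hx.le
  obtain ⟨R, -, hR⟩ := (hasBasis_cobounded_norm).eventually_iff.1 h1
  exact ⟨R, fun x hx => hR hx⟩

lemma PotData.mayer {ψ : EucSp d → ℝ} (h : PotData ψ) {c : ℝ} (hc : 0 ≤ c) :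
    MayerFn fun x => Real.exp (-(c * ψ x)) - 1 := by
  have hm : Measurable fun x => Real.exp (-(c * ψ x)) - 1 :=
    ((h.meas.const_mul c).neg.exp).sub_const 1
  obtain ⟨b, hb, hlb⟩ := h.lb
  have hG : ∀ x, |Real.exp (-(c * ψ x)) - 1| ≤ Real.exp (c * b) + 1 := by
    intro x
    have h1 : Real.exp (-(c * ψ x)) ≤ Real.exp (c * b) := by
      apply Real.exp_le_exp.2
      nlinarith [hlb x]
    rw [abs_le]
    constructor <;> linarith [Real.exp_pos (-(c * ψ x)), Real.exp_pos (c * b)]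
  refine ⟨hm, ?_, ⟨_, by positivity, hG⟩, ?_⟩
  · obtain ⟨R₁, h1⟩ := exists_le_norm_of_tendsto h.van one_pos
    obtain ⟨R₂, h2⟩ := h.tail
    set R := max R₁ R₂
    have hA : IntegrableOn (fun x => Real.exp (-(c * ψ x)) - 1) {x : EucSp d | R ≤ ‖x‖} := by
      have h3 : IntegrableOn ψ {x : EucSp d | R ≤ ‖x‖} :=
        h2.mono_set fun x (hx : R ≤ ‖x‖) => (le_max_right R₁ R₂).trans hx
      refine (h3.norm.const_mul (c * Real.exp c)).mono' hm.aestronglyMeasurable ?_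
      refine (ae_restrict_iff' (measurableSet_le_norm R)).2 (ae_of_all _ fun x hx => ?_)
      exact abs_exp_neg_sub_one_le hc (h1 x ((le_max_left R₁ R₂).trans hx))
    have hB : IntegrableOn (fun x => Real.exp (-(c * ψ x)) - 1) {x : EucSp d | R ≤ ‖x‖}ᶜ :=
      Measure.integrableOn_of_bounded (M := Real.exp (c * b) + 1) (volume_lt_norm_compl R).ne
        hm.aestronglyMeasurable (ae_of_all _ fun x => hG x)
    have := hA.union hB
    rwa [union_compl_self, integrableOn_univ] at this
  · have h1 : Tendsto (fun x => Real.exp (-(c * ψ x)) - 1) (Bornology.cobounded (EucSp d))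
        (𝓝 (Real.exp (-(c * 0)) - 1)) :=
      ((Real.continuous_exp.tendsto _).comp (h.van.const_mul c).neg).sub_const 1
    simpa using h1

variable {s z B ξ : ℝ} {φ : EucSp d → EReal} {μ : Measure (Config d)}
  {k u : ∀ n : ℕ, (Fin n → EucSp d) → ℝ}

lemma coe_psi (hp : IsPairPotential φ) {x : EucSp d} (hx : x ≠ 0) : ((psi φ x : ℝ) : EReal) = φ x := by
  rw [psi, if_neg hx, EReal.coe_toReal (hp.finite_off x hx) (hp.ne_bot x)]

lemma measurable_psi (hp : IsPairPotential φ) : Measurable (psi φ) :=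
  Measurable.ite (measurableSet_singleton _) measurable_const hp.meas.ereal_toReal

lemma psi_lb (hp : IsPairPotential φ) (hB : 0 ≤ B) (hst : Stable φ B) (x : EucSp d) :
    -(2 * B) ≤ psi φ x := by
  by_cases hx : x = 0
  · simp [psi, hx, hB]
  · have h1 := hst {0, x}
    have h2 : ({0, x} : Finset (EucSp d)).card = 2 := Finset.card_pair (Ne.symm hx)
    have h3 : ({0, x} : Finset (EucSp d)).offDiag = {(0, x), (x, 0)} := by
      ext ⟨p, q⟩
      simp only [Finset.mem_offDiag, Finset.mem_insert, Finset.mem_singleton, Prod.mk.injEq]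
      constructor
      · rintro ⟨rfl | rfl, rfl | rfl, h⟩ <;> simp_all
      · rintro (⟨rfl, rfl⟩ | ⟨rfl, rfl⟩)
        · exact ⟨Or.inl rfl, Or.inr rfl, Ne.symm hx⟩
        · exact ⟨Or.inr rfl, Or.inl rfl, hx⟩
    rw [h2, h3, Finset.sum_pair (by simp [Ne.symm hx])] at h1
    simp only [zero_sub, sub_zero] at h1
    rw [hp.even x hx, ← coe_psi hp hx, ← EReal.coe_add, EReal.coe_le_coe_iff] at h1
    push_cast at h1
    linarith

lemma Setting.potData (h : Setting d s z B ξ φ μ k u) (hvan : PhiVanishes φ) :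
    PotData (psi φ) := by
  have hm := measurable_psi h.pp
  have hne : ∀ᶠ x in Bornology.cobounded (EucSp d), x ≠ 0 := by
    filter_upwards [(hasBasis_cobounded_norm (E := EucSp d)).mem_of_mem (i := 1) trivial] with x hx
    rintro rfl
    simp at hx
    linarith
  have hvan' : Tendsto (psi φ) (Bornology.cobounded (EucSp d)) (𝓝 0) := by
    have h1 : Tendsto φ (Bornology.cobounded (EucSp d)) (𝓝 0) := by
      rw [Metric.cobounded_eq_cocompact]; exact hvan
    have h2 := (EReal.tendsto_toReal (a := 0) (by simp) (by simp)).comp h1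
    refine (h2.congr' ?_)
    filter_upwards [hne] with x hx
    simp [psi, hx]
  refine ⟨hm, fun x => ?_, ⟨2 * B, by linarith [h.hB], psi_lb h.pp h.hB h.stable⟩, hvan', ?_⟩
  · by_cases hx : x = 0
    · simp [hx]
    · simp [psi, hx, h.pp.even x hx]
  · obtain ⟨R₁, h1⟩ := exists_le_norm_of_tendsto hvan' one_pos
    refine ⟨max R₁ 1, ?_⟩
    have hlint : ∫⁻ x : EucSp d, ENNReal.ofReal (|rexp (-(φ x)) - 1| * z) < ⊤ :=
      h.laht.trans ENNReal.ofReal_lt_top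
    have key : ∀ x ∈ {x : EucSp d | max R₁ 1 ≤ ‖x‖}, ‖psi φ x‖ₑ
        ≤ ENNReal.ofReal (Real.exp 1 / z) * ENNReal.ofReal (|rexp (-(φ x)) - 1| * z) := by
      intro x hx
      have hx0 : x ≠ 0 := by
        rintro rfl
        have : max R₁ 1 ≤ ‖(0 : EucSp d)‖ := hx
        rw [norm_zero] at this
        linarith [le_max_right R₁ 1]
      have h2 := exp_neg_sub_one_abs_ge (h1 x ((le_max_left R₁ 1).trans hx))
      have h3 : rexp (-(φ x)) = Real.exp (-(psi φ x)) := by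
        rw [← coe_psi h.pp hx0, ← EReal.coe_neg, rexp, eexp, if_neg (EReal.coe_ne_top _),
          if_neg (EReal.coe_ne_bot _), EReal.toReal_coe, ENNReal.toReal_ofReal (Real.exp_pos _).le]
      rw [← ENNReal.ofReal_mul (div_nonneg (Real.exp_pos 1).le h.hz.le), h3,
        Real.enorm_eq_ofReal_abs]
      apply ENNReal.ofReal_le_ofReal
      have := h.hz.ne'
      calc _ ≤ _ := h2
        _ = _ := by field_simp
    refine ⟨hm.aestronglyMeasurable, ?_⟩
    refine (setLIntegral_mono' (measurableSet_le_norm _) key).trans_lt ?_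
    refine (setLIntegral_le_lintegral _ _).trans_lt ?_
    rw [lintegral_const_mul' _ _ ENNReal.ofReal_ne_top]
    exact ENNReal.mul_lt_top ENNReal.ofReal_lt_top hlint

/-- The relative energy of a point, as a real sum. -/
def En (ψ : EucSp d → ℝ) (x : EucSp d) (γ : Config d) : ℝ := ∑' y : γ.1, ψ (x - y.1)

/-- `x ∉ γ` and the relative energy converges absolutely. -/
def Good (ψ : EucSp d → ℝ) (x : EucSp d) (γ : Config d) : Prop :=
  x ∉ γ.1 ∧ Summable fun y : γ.1 => ψ (x - y.1)

variable {ψ : EucSp d → ℝ}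

lemma measurable_En (hψ : Measurable ψ) {α : Type*} [MeasurableSpace α] {Γ : α → Config d}
    (hΓ : Measurable Γ) {X : α → EucSp d} (hX : Measurable X) :
    Measurable fun a => En ψ (X a) (Γ a) :=
  measurable_tsum_config_real hΓ (G := fun a y => ψ (X a - y))
    (hψ.comp ((hX.comp measurable_fst).sub measurable_snd))

lemma measurable_cpair {f : EucSp d → ℝ} (hf : Measurable f) {α : Type*} [MeasurableSpace α]
    {Γ : α → Config d} (hΓ : Measurable Γ) : Measurable fun a => cpair f (Γ a) :=
  measurable_tsum_config_real hΓ (G := fun _ y => f y) (hf.comp measurable_snd)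

lemma measurableSet_good (hψ : Measurable ψ) {α : Type*} [MeasurableSpace α] {Γ : α → Config d}
    (hΓ : Measurable Γ) {X : α → EucSp d} (hX : Measurable X) :
    MeasurableSet {a | Good ψ (X a) (Γ a)} := by
  have h1 : MeasurableSet {a | X a ∈ (Γ a).1} := measurableSet_mem_config.preimage (hΓ.prodMk hX)
  exact h1.compl.inter (measurableSet_summable_config hΓ (G := fun a y => ψ (X a - y))
    (hψ.comp ((hX.comp measurable_fst).sub measurable_snd)))

lemma hasSum_ins (γ : Config d) {x : EucSp d} (hx : x ∉ γ.1) {g : EucSp d → ℝ} {r : ℝ}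
    (hg : HasSum (fun y : γ.1 => g y.1) r) : HasSum (fun y : (γ.ins x).1 => g y.1) (g x + r) := by
  have h1 : HasSum (fun y : ({x} : Set (EucSp d)) => g y.1) (g x) := hasSum_unique _
  have := h1.add_disjoint (Set.disjoint_singleton_left.2 hx) hg
  rwa [singleton_union] at this

lemma Good.En_ins {γ : Config d} {x y : EucSp d} (h : Good ψ x γ) (hy : y ∉ γ.1) :
    En ψ x (γ.ins y) = ψ (x - y) + En ψ x γ :=
  (hasSum_ins γ hy (g := fun t => ψ (x - t)) h.2.hasSum).tsum_eq

lemma summable_cpair {f : EucSp d → ℝ} (hf : HasCompactSupport f) (γ : Config d) :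
    Summable fun y : γ.1 => f y.1 := by
  apply summable_of_hasFiniteSupport
  exact ((γ.2 _ hf).preimage Subtype.val_injective.injOn).subset fun y hy =>
    ⟨y.2, subset_tsupport _ hy⟩

lemma cpair_ins {f : EucSp d → ℝ} (hf : HasCompactSupport f) {γ : Config d} {x : EucSp d}
    (hx : x ∉ γ.1) : cpair f (γ.ins x) = f x + cpair f γ :=
  (hasSum_ins γ hx (summable_cpair hf γ).hasSum).tsum_eq

lemma Good.del {γ : Config d} {x : EucSp d} (h : Good ψ x γ) (y : EucSp d) :
    Good ψ x (γ.del y) :=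
  ⟨fun hx => h.1 hx.1, h.2.comp_injective
    (i := fun t : (γ.del y).1 => (⟨t.1, t.2.1⟩ : γ.1)) fun _ _ hab =>
      Subtype.ext (congrArg (fun t : γ.1 => t.1) hab)⟩

lemma Good.energy_eq (hp : IsPairPotential φ) {γ : Config d} {x : EucSp d}
    (h : Good (psi φ) x γ) : energy φ x γ.1 = ((En (psi φ) x γ : ℝ) : EReal) := by
  have hne : ∀ y : γ.1, x - y.1 ≠ 0 := fun y h0 => h.1 (sub_eq_zero.1 h0 ▸ y.2)
  have h1 : (fun y : γ.1 => (φ (x - y.1)).toReal) = fun y : γ.1 => psi φ (x - y.1) := by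
    ext y; rw [psi, if_neg (hne y)]
  rw [energy, h1, if_pos ⟨fun y hy => hp.finite_off _ (hne ⟨y, hy⟩), h.2⟩]
  rfl

lemma Good.totPhi_eq (hp : IsPairPotential φ) (hψ : PotData (psi φ)) {γ : Config d}
    (h : Good (psi φ) 0 γ) : totPhi φ γ.1 = ((En (psi φ) 0 γ : ℝ) : EReal) := by
  have hne : ∀ y : γ.1, y.1 ≠ 0 := fun y h0 => h.1 (h0 ▸ y.2)
  have h1 : (fun y : γ.1 => (φ y.1).toReal) = fun y : γ.1 => psi φ (0 - y.1) := by
    ext y; rw [zero_sub, hψ.even, psi, if_neg (hne y)]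
  rw [totPhi, h1, if_pos ⟨fun y hy => hp.finite_off _ (hne ⟨y, hy⟩), h.2⟩]
  rfl

lemma CorrData.ae_notMem (hk : CorrData μ k ξ) (hd : 0 < d) (x : EucSp d) :
    ∀ᵐ γ ∂μ, x ∉ γ.1 := by
  have h0 := hk.lintegral_tsum (F := ({x} : Set (EucSp d)).indicator 1)
    (measurable_one.indicator (measurableSet_singleton x))
  have : Nontrivial (EucSp d) := by
    have : Nonempty (Fin d) := ⟨⟨0, hd⟩⟩
    infer_instance
  rw [lintegral_indicator (measurableSet_singleton x)] at h0
  simp only [Pi.one_apply, lintegral_const, MeasurableSet.univ, Measure.restrict_apply,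
    univ_inter, measure_singleton, mul_zero, nonpos_iff_eq_zero] at h0
  have h1 := (lintegral_eq_zero_iff (measurable_tsum_config measurable_id
    (G := fun _ y => ({x} : Set (EucSp d)).indicator 1 y)
    ((measurable_one.indicator (measurableSet_singleton x)).comp measurable_snd))).1 h0
  filter_upwards [h1] with γ hγ hx
  have := (ENNReal.tsum_eq_zero.1 hγ) ⟨x, hx⟩
  simp at this

lemma CorrData.ae_good (hk : CorrData μ k ξ) (hd : 0 < d) (hψ : PotData ψ) (x : EucSp d) :
    ∀ᵐ γ ∂μ, Good ψ x γ := by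
  obtain ⟨R, hR⟩ := hψ.tail
  set A : Set (EucSp d) := {y | R ≤ ‖x - y‖}
  have hA : MeasurableSet A := measurableSet_le measurable_const (measurable_const.sub measurable_id).norm
  have hm : Measurable fun y => ‖ψ (x - y)‖ₑ := (hψ.meas.comp (measurable_const.sub measurable_id)).enorm
  have h0 := hk.lintegral_tsum (hm.indicator hA)
  have h1 : ∫⁻ y, A.indicator (fun y => ‖ψ (x - y)‖ₑ) y < ⊤ := by
    have h2 : (fun y => A.indicator (fun y => ‖ψ (x - y)‖ₑ) y)
        = fun y => ({y : EucSp d | R ≤ ‖y‖}.indicator fun y => ‖ψ y‖ₑ) (x - y) := by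
      ext y; simp [Set.indicator, A]
    rw [h2, lintegral_sub_left_eq_self (fun y => ({y : EucSp d | R ≤ ‖y‖}.indicator fun y => ‖ψ y‖ₑ) y) x,
      lintegral_indicator (measurableSet_le_norm R)]
    exact hR.2
  have h3 : ∫⁻ γ : Config d, ∑' y : γ.1, A.indicator (fun y => ‖ψ (x - y)‖ₑ) y.1 ∂μ ≠ ⊤ :=
    (h0.trans_lt (ENNReal.mul_lt_top ENNReal.ofReal_lt_top h1)).ne
  have h4 := ae_lt_top (measurable_tsum_config measurable_id
    (G := fun _ y => A.indicator (fun y => ‖ψ (x - y)‖ₑ) y) ((hm.indicator hA).comp measurable_snd)) h3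
  filter_upwards [h4, hk.ae_notMem hd x] with γ hγ hx
  refine ⟨hx, ?_⟩
  have h5 : Summable fun y : γ.1 => A.indicator (fun y => ψ (x - y)) y.1 := by
    have h6 : Summable fun y : γ.1 => (A.indicator (fun y => ‖ψ (x - y)‖ₑ) y.1).toReal :=
      ENNReal.summable_toReal hγ.ne
    refine Summable.of_norm (h6.congr fun y => ?_)
    by_cases hy : y.1 ∈ A <;> simp [hy]
  have h7 : Summable fun y : γ.1 => Aᶜ.indicator (fun y => ψ (x - y)) y.1 := by
    apply summable_of_hasFiniteSupport
    refine ((γ.2 _ (isCompact_closedBall x R)).preimage Subtype.val_injective.injOn).subset ?_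
    intro y hy
    refine ⟨y.2, ?_⟩
    by_contra hc
    apply hy
    apply Set.indicator_of_notMem
    rw [mem_compl_iff, not_not]
    rw [Metric.mem_closedBall, dist_comm, dist_eq_norm, not_le] at hc
    exact hc.le
  exact (h5.add h7).congr fun y => by
    by_cases hy : y.1 ∈ A <;> simp [hy]

lemma CorrData.ae_ae_good (hk : CorrData μ k ξ) (hd : 0 < d) (hψ : PotData ψ) :
    ∀ᵐ γ ∂μ, ∀ᵐ x : EucSp d, Good ψ x γ := by
  have := hk.prob
  rw [Measure.ae_ae_comm (measurableSet_good hψ.meas measurable_fst measurable_snd)]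
  exact ae_of_all _ fun x => hk.ae_good hd hψ x

end Potential

section Moments

variable {d : ℕ} {ξ : ℝ} {μ : Measure (Config d)}
  {k u : ∀ n : ℕ, (Fin n → EucSp d) → ℝ} {ψ f : EucSp d → ℝ}

lemma Zexp_translate (hk : CorrData μ k ξ) (G : EucSp d → ℝ) (a : EucSp d) :
    Zexp k (fun x => G (x + a)) = Zexp k G := by
  unfold Zexp
  congr 1; ext n; congr 1
  rw [← integral_add_right_eq_self (fun x : Fin n → EucSp d => (∏ i, G (x i)) * k n x)
    (fun _ => a)]
  congr 1; ext x
  have := hk.ti n a x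
  simp only [Pi.add_apply]
  rw [← this]
  rfl

lemma neg_mul_En (c : ℝ) (x : EucSp d) (γ : Config d) :
    -(c * En ψ x γ) = ∑' y : γ.1, -(c * ψ (x - y.1)) := by
  rw [En, tsum_neg, tsum_mul_left]

lemma CorrData.exists_moment_En (hk : CorrData μ k ξ) (hψ : PotData ψ) {c : ℝ} (hc : 0 ≤ c) :
    ∃ C : ℝ≥0∞, C ≠ ⊤ ∧ ∀ x, ∫⁻ γ, ENNReal.ofReal (Real.exp (-(c * En ψ x γ))) ∂μ ≤ C := by
  have hg := hψ.mayer hc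
  refine ⟨ENNReal.ofReal (Real.exp (ξ * ∫ y, |Real.exp (-(c * ψ y)) - 1|)),
    ENNReal.ofReal_ne_top, fun x => ?_⟩
  have h1 := hk.lintegral_exp_le (b := fun y => -(c * ψ (x - y)))
    (((hψ.meas.comp (measurable_const.sub measurable_id)).const_mul c).neg)
    (hg.int.comp_sub_left x)
  simp_rw [neg_mul_En]
  rwa [integral_sub_left_eq_self (fun y => |Real.exp (-(c * ψ y)) - 1|) volume x] at h1

lemma CorrData.exists_moment_cpair (hk : CorrData μ k ξ) (hf : IsC0 f) (m : ℝ) :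
    ∃ C : ℝ≥0∞, C ≠ ⊤ ∧ ∫⁻ γ, ENNReal.ofReal (Real.exp (m * cpair f γ)) ∂μ ≤ C := by
  have h1 := hk.lintegral_exp_le (b := fun y => m * f y) (hf.1.measurable.const_mul m) (by
    refine Continuous.integrable_of_hasCompactSupport ?_ ?_
    · exact (Real.continuous_exp.comp (continuous_const.mul hf.1)).sub continuous_const
    · exact hf.2.comp_left (g := fun t => Real.exp (m * t) - 1) (by simp))
  refine ⟨_, ENNReal.ofReal_ne_top, le_trans (le_of_eq ?_) h1⟩
  simp_rw [cpair, tsum_mul_left]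

lemma exp_sum_le {n : ℕ} [NeZero n] (t : Fin n → ℝ) :
    Real.exp (∑ i, t i) ≤ ∑ i, Real.exp (n * t i) := by
  obtain ⟨i, -, hi⟩ := Finset.exists_max_image Finset.univ t Finset.univ_nonempty
  have h1 : ∑ j, t j ≤ n * t i := by
    have := Finset.sum_le_card_nsmul Finset.univ t (t i) hi
    simpa using this
  exact (Real.exp_le_exp.2 h1).trans
    (Finset.single_le_sum (f := fun j => Real.exp (n * t j))
      (fun j _ => (Real.exp_pos _).le) (Finset.mem_univ i))

lemma exp_mul_le_one_add {c c' t : ℝ} (hc : 0 ≤ c) (hcc : c ≤ c') :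
    Real.exp (c * t) ≤ 1 + Real.exp (c' * t) := by
  rcases le_total 0 t with h | h
  · have : Real.exp (c * t) ≤ Real.exp (c' * t) := Real.exp_le_exp.2 (by nlinarith)
    linarith
  · have : Real.exp (c * t) ≤ 1 := Real.exp_le_one_iff.2 (by nlinarith)
    linarith [Real.exp_pos (c' * t)]

/-- Uniform exponential moments for four relative energies and the pairing with `f`. -/
lemma CorrData.exists_moment (hk : CorrData μ k ξ) (hψ : PotData ψ) (hf : IsC0 f) :
    ∃ C : ℝ≥0∞, C ≠ ⊤ ∧ ∀ (x₁ x₂ x₃ x₄ : EucSp d) (c₁ c₂ c₃ c₄ m : ℝ), c₁ ∈ Icc (0 : ℝ) 4 →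
      c₂ ∈ Icc (0 : ℝ) 4 → c₃ ∈ Icc (0 : ℝ) 4 → c₄ ∈ Icc (0 : ℝ) 4 → m ∈ Icc (0 : ℝ) 4 →
      ∫⁻ γ, ENNReal.ofReal (Real.exp (-(c₁ * En ψ x₁ γ) - c₂ * En ψ x₂ γ - c₃ * En ψ x₃ γ
        - c₄ * En ψ x₄ γ + m * cpair f γ)) ∂μ ≤ C := by
  have := hk.prob
  obtain ⟨C₁, h1, h1'⟩ := hk.exists_moment_En hψ (c := 20) (by norm_num)
  obtain ⟨C₂, h2, h2'⟩ := hk.exists_moment_cpair hf 20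
  refine ⟨4 * (1 + C₁) + (1 + C₂), by finiteness, ?_⟩
  intro x₁ x₂ x₃ x₄ c₁ c₂ c₃ c₄ m hc₁ hc₂ hc₃ hc₄ hm
  have hE : ∀ x, Measurable fun γ : Config d => ENNReal.ofReal (Real.exp (-(20 * En ψ x γ))) :=
    fun x => (((measurable_En hψ.meas measurable_id measurable_const).const_mul 20).neg.exp).ennreal_ofReal
  have hF : Measurable fun γ : Config d => ENNReal.ofReal (Real.exp (20 * cpair f γ)) :=
    (((measurable_cpair hf.1.measurable measurable_id).const_mul 20).exp).ennreal_ofReal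
  have key : ∀ γ, ENNReal.ofReal (Real.exp (-(c₁ * En ψ x₁ γ) - c₂ * En ψ x₂ γ - c₃ * En ψ x₃ γ
        - c₄ * En ψ x₄ γ + m * cpair f γ)) ≤
      (1 + ENNReal.ofReal (Real.exp (-(20 * En ψ x₁ γ)))) +
      (1 + ENNReal.ofReal (Real.exp (-(20 * En ψ x₂ γ)))) +
      (1 + ENNReal.ofReal (Real.exp (-(20 * En ψ x₃ γ)))) +
      (1 + ENNReal.ofReal (Real.exp (-(20 * En ψ x₄ γ)))) +
      (1 + ENNReal.ofReal (Real.exp (20 * cpair f γ))) := by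
    intro γ
    have e1 : ∀ {c t : ℝ}, c ∈ Icc (0 : ℝ) 4 →
        Real.exp (5 * (c * t)) ≤ 1 + Real.exp (20 * t) := by
      intro c t hc
      have := exp_mul_le_one_add (c := 5 * c) (c' := 20) (t := t) (by linarith [hc.1])
        (by linarith [hc.2])
      rwa [mul_assoc] at this
    have e2 := exp_sum_le (n := 5) ![c₁ * -En ψ x₁ γ, c₂ * -En ψ x₂ γ, c₃ * -En ψ x₃ γ, c₄ * -En ψ x₄ γ,
      m * cpair f γ]
    simp only [Fin.sum_univ_five, Nat.cast_ofNat] at e2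
    simp only [Matrix.cons_val] at e2
    rw [← ENNReal.ofReal_one]
    simp only [← ENNReal.ofReal_add zero_le_one (Real.exp_pos _).le]
    have e3 : ∀ t, 0 ≤ 1 + Real.exp t := fun t => by positivity
    rw [← ENNReal.ofReal_add (e3 _) (e3 _), ← ENNReal.ofReal_add (by positivity) (e3 _),
      ← ENNReal.ofReal_add (by positivity) (e3 _), ← ENNReal.ofReal_add (by positivity) (e3 _)]
    apply ENNReal.ofReal_le_ofReal
    have a1 := e1 (t := -En ψ x₁ γ) hc₁
    have a2 := e1 (t := -En ψ x₂ γ) hc₂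
    have a3 := e1 (t := -En ψ x₃ γ) hc₃
    have a4 := e1 (t := -En ψ x₄ γ) hc₄
    have a5 := e1 (t := cpair f γ) hm
    have e5 : -(c₁ * En ψ x₁ γ) - c₂ * En ψ x₂ γ - c₃ * En ψ x₃ γ - c₄ * En ψ x₄ γ + m * cpair f γ
      = c₁ * -En ψ x₁ γ + c₂ * -En ψ x₂ γ + c₃ * -En ψ x₃ γ + c₄ * -En ψ x₄ γ + m * cpair f γ := by
      ring
    rw [e5]
    simp only [mul_neg] at a1 a2 a3 a4 a5 e2 ⊢
    linarith
  refine (lintegral_mono key).trans ?_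
  have hE' : ∀ x, Measurable fun γ : Config d => 1 + ENNReal.ofReal (Real.exp (-(20 * En ψ x γ))) :=
    fun x => (hE x).const_add 1
  have hF' : Measurable fun γ : Config d => 1 + ENNReal.ofReal (Real.exp (20 * cpair f γ)) :=
    hF.const_add 1
  rw [lintegral_add_right _ hF', lintegral_add_right _ (hE' _),
    lintegral_add_right _ (hE' _), lintegral_add_right _ (hE' _), lintegral_add_right _ hF]
  have h3 : ∀ x, ∫⁻ γ, (1 + ENNReal.ofReal (Real.exp (-(20 * En ψ x γ)))) ∂μ ≤ 1 + C₁ := by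
    intro x
    rw [lintegral_add_right _ (hE _), lintegral_const, measure_univ, mul_one]
    exact add_le_add_right (h1' x) 1
  have h4 : ∫⁻ _ : Config d, (1 : ℝ≥0∞) ∂μ = 1 := by simp
  rw [h4]
  calc _ ≤ (1 + C₁) + (1 + C₁) + (1 + C₁) + (1 + C₁) + (1 + C₂) := by
        gcongr <;> exact h3 _
    _ = _ := by ring

lemma MayerFn.add_shiftG_apply {c : ℝ} (t v : EucSp d) :
    (Real.exp (-(c * ψ t)) - 1) + shiftG (fun x => Real.exp (-(c * ψ x)) - 1) v t
      = Real.exp (-(c * ψ t) - c * ψ (t - v)) - 1 := by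
  rw [sub_eq_add_neg (-(c * ψ t)), Real.exp_add, shiftG]
  ring

lemma CorrData.lintegral_exp_En (hk : CorrData μ k ξ) (hd : 0 < d) (hψ : PotData ψ) {c : ℝ}
    (hc : 0 ≤ c) (x : EucSp d) :
    ∫⁻ γ, ENNReal.ofReal (Real.exp (-(c * En ψ x γ))) ∂μ
      = ENNReal.ofReal (Zexp k fun y => Real.exp (-(c * ψ y)) - 1) := by
  have hg := hψ.mayer hc
  have hm : Measurable fun γ : Config d => -(c * En ψ x γ) :=
    ((measurable_En hψ.meas measurable_id measurable_const).const_mul c).neg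
  obtain ⟨C, hC, hC'⟩ := hk.exists_moment_En hψ hc
  rw [← ofReal_integral_eq_lintegral_ofReal
    (integrable_exp_of_lintegral_lt_top hm ((hC' x).trans_lt hC.lt_top))
    (ae_of_all _ fun _ => (Real.exp_pos _).le)]
  congr 1
  simp_rw [neg_mul_En]
  rw [hk.integral_exp_eq (b := fun y => -(c * ψ (x - y)))
    (((hψ.meas.comp (measurable_const.sub measurable_id)).const_mul c).neg)
    (hg.int.comp_sub_left x)
    ((hk.ae_good hd hψ x).mono fun γ hγ => (hγ.2.mul_left c).neg)]
  rw [← Zexp_translate hk _ x]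
  congr 1; ext y
  rw [show x - (y + x) = -y by abel, hψ.even]

lemma CorrData.lintegral_exp_En_two (hk : CorrData μ k ξ) (hd : 0 < d) (hψ : PotData ψ) {c : ℝ}
    (hc : 0 ≤ c) (x x' : EucSp d) :
    ∫⁻ γ, ENNReal.ofReal (Real.exp (-(c * En ψ x γ))) * ENNReal.ofReal (Real.exp (-(c * En ψ x' γ))) ∂μ
      = ENNReal.ofReal (Zexp k fun y => (Real.exp (-(c * ψ y)) - 1) +
          shiftG (fun y => Real.exp (-(c * ψ y)) - 1) (x' - x) y) := by
  have hg := hψ.mayer hc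
  have hm : Measurable fun γ : Config d => -(c * En ψ x γ) - c * En ψ x' γ :=
    ((measurable_En hψ.meas measurable_id measurable_const).const_mul c).neg.sub
      ((measurable_En hψ.meas measurable_id measurable_const).const_mul c)
  have hb : Measurable fun y => -(c * ψ (x - y)) - c * ψ (x' - y) :=
    ((hψ.meas.comp (measurable_const.sub measurable_id)).const_mul c).neg.sub
      ((hψ.meas.comp (measurable_const.sub measurable_id)).const_mul c)
  have hbi : Integrable fun y => Real.exp (-(c * ψ (x - y)) - c * ψ (x' - y)) - 1 := by
    have := ((hg.int.add (hg.integrable_shiftG (x' - x))).comp_sub_right x)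
    refine this.congr (ae_of_all _ fun y => ?_)
    simp only [Pi.add_apply]
    rw [MayerFn.add_shiftG_apply, ← hψ.even (y - x), ← hψ.even (y - x - _)]
    congr 4 <;> [skip; congr 1] <;> abel_nf
  have hsum : ∀ᵐ γ ∂μ, Summable fun y : γ.1 => -(c * ψ (x - y.1)) - c * ψ (x' - y.1) := by
    filter_upwards [hk.ae_good hd hψ x, hk.ae_good hd hψ x'] with γ h1 h2
    exact (h1.2.mul_left c).neg.sub (h2.2.mul_left c)
  have hae : ∀ᵐ γ ∂μ, ∑' y : γ.1, (-(c * ψ (x - y.1)) - c * ψ (x' - y.1))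
      = -(c * En ψ x γ) - c * En ψ x' γ := by
    filter_upwards [hk.ae_good hd hψ x, hk.ae_good hd hψ x'] with γ h1 h2
    rw [Summable.tsum_sub (h1.2.mul_left c).neg (h2.2.mul_left c), ← neg_mul_En, tsum_mul_left]
    rfl
  have h1 : ∫⁻ γ, ENNReal.ofReal (Real.exp (-(c * En ψ x γ))) *
      ENNReal.ofReal (Real.exp (-(c * En ψ x' γ))) ∂μ
      = ∫⁻ γ, ENNReal.ofReal (Real.exp (-(c * En ψ x γ) - c * En ψ x' γ)) ∂μ := by
    congr 1; ext γ
    rw [← ENNReal.ofReal_mul (Real.exp_pos _).le, ← Real.exp_add]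
    rfl
  have hfin : ∫⁻ γ, ENNReal.ofReal (Real.exp (-(c * En ψ x γ) - c * En ψ x' γ)) ∂μ < ⊤ := by
    refine lt_of_le_of_lt (le_of_eq ?_) ((hk.lintegral_exp_le hb hbi).trans_lt ENNReal.ofReal_lt_top)
    exact lintegral_congr_ae (hae.mono fun γ hγ => by simp only [hγ])
  rw [h1, ← ofReal_integral_eq_lintegral_ofReal (integrable_exp_of_lintegral_lt_top hm hfin)
    (ae_of_all _ fun _ => (Real.exp_pos _).le)]
  congr 1
  rw [← integral_congr_ae (hae.mono fun γ hγ => congrArg Real.exp hγ),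
    hk.integral_exp_eq hb hbi hsum, ← Zexp_translate hk _ x]
  congr 1; ext y
  rw [MayerFn.add_shiftG_apply, ← hψ.even y, ← hψ.even (y - _)]
  congr 4 <;> [skip; congr 1] <;> abel_nf

end Moments

section Jump

variable {d : ℕ} {s z ξ : ℝ} {μ : Measure (Config d)}
  {k : ∀ n : ℕ, (Fin n → EucSp d) → ℝ} {ψ f : EucSp d → ℝ} {b p : EucSp d → ℝ≥0∞}

/-- The Georgii–Nguyen–Zessin identity in terms of the real-valued energy. -/
def RealGNZ (z : ℝ) (ψ : EucSp d → ℝ) (μ : Measure (Config d)) : Prop :=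
  ∀ F : Config d → EucSp d → ℝ≥0∞, Measurable (Function.uncurry F) →
    ∫⁻ γ, ∑' x : γ.1, F γ x.1 ∂μ
      = ∫⁻ γ, ∫⁻ x, ENNReal.ofReal z * ENNReal.ofReal (Real.exp (-(En ψ x γ))) * F (γ.ins x) x
          ∂volume ∂μ

lemma eexp_neg_coe (t : ℝ) : eexp (-(t : EReal)) = ENNReal.ofReal (Real.exp (-t)) := by
  rw [← EReal.coe_neg, eexp, if_neg (EReal.coe_ne_top _), if_neg (EReal.coe_ne_bot _),
    EReal.toReal_coe]

lemma Setting.realGNZ {B : ℝ} {φ : EucSp d → EReal} {k u : ∀ n : ℕ, (Fin n → EucSp d) → ℝ}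
    (h : Setting d s z B ξ φ μ k u) (hvan : PhiVanishes φ) : RealGNZ z (psi φ) μ := by
  intro F hF
  rw [h.gnz F hF]
  refine lintegral_congr_ae ?_
  filter_upwards [h.corrData.ae_ae_good h.hd (h.potData hvan)] with γ hγ
  refine lintegral_congr_ae ?_
  filter_upwards [hγ] with x hx
  rw [hx.energy_eq h.pp, eexp_neg_coe]

/-- The exponential weight of a jump between `X.1` and `X.2`. -/
def jumpWt (s : ℝ) (ψ f : EucSp d → ℝ) (X : EucSp d × EucSp d) (γ : Config d) : ℝ≥0∞ :=
  ENNReal.ofReal (Real.exp (-((1 - s) * En ψ X.1 γ) - (1 - s) * En ψ X.2 γ + cpair f γ))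

/-- The total weighted rate of jumps from `x`, for the jump kernel `b` and the weight `p`. -/
def jumpRate (s : ℝ) (ψ f : EucSp d → ℝ) (b p : EucSp d → ℝ≥0∞) (x : EucSp d) (γ : Config d) :
    ℝ≥0∞ :=
  ∫⁻ y, b (x - y) * p y *
    ENNReal.ofReal (Real.exp (s * En ψ x γ - (1 - s) * En ψ y γ + cpair f γ))

/-- The measure `z b(x-y) p(y) dx dy`. -/
def jumpMeas (z : ℝ) (b p : EucSp d → ℝ≥0∞) : Measure (EucSp d × EucSp d) :=
  volume.withDensity fun X => ENNReal.ofReal z * b (X.1 - X.2) * p X.2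

instance : SFinite (jumpMeas z b p) := by unfold jumpMeas; infer_instance

def jumpSum (s : ℝ) (ψ f : EucSp d → ℝ) (b p : EucSp d → ℝ≥0∞) (γ : Config d) : ℝ≥0∞ :=
  ∑' x : γ.1, jumpRate s ψ f b p x.1 (γ.del x.1)

def jumpMean (s z : ℝ) (ψ f : EucSp d → ℝ) (b p : EucSp d → ℝ≥0∞) (γ : Config d) : ℝ≥0∞ :=
  ∫⁻ X, jumpWt s ψ f X γ ∂(jumpMeas z b p)

lemma measurable_jumpWt (hψ : Measurable ψ) (hf : Measurable f) {α : Type*} [MeasurableSpace α]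
    {Γ : α → Config d} (hΓ : Measurable Γ) {X : α → EucSp d × EucSp d} (hX : Measurable X) :
    Measurable fun a => jumpWt s ψ f (X a) (Γ a) :=
  (((((measurable_En hψ hΓ (measurable_fst.comp hX)).const_mul _).neg.sub
    ((measurable_En hψ hΓ (measurable_snd.comp hX)).const_mul _)).add
      (measurable_cpair hf hΓ)).exp).ennreal_ofReal

lemma measurable_jumpRate (hψ : Measurable ψ) (hf : Measurable f) (hb : Measurable b)
    (hp : Measurable p) {α : Type*} [MeasurableSpace α]
    {Γ : α → Config d} (hΓ : Measurable Γ) {x : α → EucSp d} (hx : Measurable x) :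
    Measurable fun a => jumpRate s ψ f b p (x a) (Γ a) := by
  have hΓ' : Measurable fun q : α × EucSp d => Γ q.1 := hΓ.comp measurable_fst
  have hx' : Measurable fun q : α × EucSp d => x q.1 := hx.comp measurable_fst
  refine Measurable.lintegral_prod_right' (f := fun q : α × EucSp d => b (x q.1 - q.2) * p q.2 *
    ENNReal.ofReal (Real.exp (s * En ψ (x q.1) (Γ q.1) - (1 - s) * En ψ q.2 (Γ q.1)
      + cpair f (Γ q.1)))) ?_
  exact ((hb.comp (hx'.sub measurable_snd)).mul (hp.comp measurable_snd)).mul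
    (((((measurable_En hψ hΓ' hx').const_mul _).sub
    ((measurable_En hψ hΓ' measurable_snd).const_mul _)).add
      (measurable_cpair hf hΓ')).exp).ennreal_ofReal

lemma measurable_jumpSum (hψ : Measurable ψ) (hf : Measurable f) (hb : Measurable b)
    (hp : Measurable p) : Measurable (jumpSum s ψ f b p) :=
  measurable_tsum_config measurable_id (G := fun γ x => jumpRate s ψ f b p x (γ.del x))
    (measurable_jumpRate hψ hf hb hp measurable_del measurable_snd)

lemma measurable_jumpMean (hψ : Measurable ψ) (hf : Measurable f) :
    Measurable (jumpMean s z ψ f b p) :=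
  Measurable.lintegral_prod_right' (f := fun q : Config d × (EucSp d × EucSp d) =>
    jumpWt s ψ f q.2 q.1) (measurable_jumpWt hψ hf measurable_fst measurable_snd)

lemma lintegral_jumpMeas (hb : Measurable b) (hp : Measurable p) {G : EucSp d × EucSp d → ℝ≥0∞}
    (hG : Measurable G) :
    ∫⁻ X, G X ∂(jumpMeas z b p)
      = ∫⁻ x, ∫⁻ y, ENNReal.ofReal z * b (x - y) * p y * G (x, y) := by
  have h1 : Measurable fun X : EucSp d × EucSp d => ENNReal.ofReal z * b (X.1 - X.2) * p X.2 :=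
    ((hb.comp (measurable_fst.sub measurable_snd)).const_mul _).mul (hp.comp measurable_snd)
  rw [jumpMeas, lintegral_withDensity_eq_lintegral_mul _ h1 hG, Measure.volume_eq_prod,
    lintegral_prod _ (h1.mul hG).aemeasurable]
  rfl

lemma ae_jumpMeas {P : EucSp d → Prop} (h : ∀ᵐ x, P x) :
    ∀ᵐ X ∂(jumpMeas z b p), P X.1 ∧ P X.2 := by
  refine (withDensity_absolutelyContinuous _ _).ae_le ?_
  rw [Measure.volume_eq_prod]
  filter_upwards [Measure.quasiMeasurePreserving_fst.ae h,
    Measure.quasiMeasurePreserving_snd.ae h] with X h1 h2 using ⟨h1, h2⟩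

lemma lintegral_jumpRate (hψ : Measurable ψ) (hf : Measurable f) (hb : Measurable b)
    (hp : Measurable p) (γ : Config d) {c : EucSp d → EucSp d → ℝ≥0∞}
    (hc : Measurable (Function.uncurry c)) :
    ∫⁻ x, ENNReal.ofReal z * ENNReal.ofReal (Real.exp (-(En ψ x γ))) *
      (∫⁻ y, b (x - y) * p y *
        ENNReal.ofReal (Real.exp (s * En ψ x γ - (1 - s) * En ψ y γ + cpair f γ)) * c x y)
      = ∫⁻ X, jumpWt s ψ f X γ * c X.1 X.2 ∂(jumpMeas z b p) := by
  have hm : Measurable fun X : EucSp d × EucSp d => jumpWt s ψ f X γ * c X.1 X.2 :=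
    (measurable_jumpWt hψ hf measurable_const measurable_id).mul hc
  rw [lintegral_jumpMeas hb hp hm]
  congr 1; ext x
  have hE : Measurable fun y => b (x - y) * p y *
        ENNReal.ofReal (Real.exp (s * En ψ x γ - (1 - s) * En ψ y γ + cpair f γ)) * c x y :=
    (((hb.comp (measurable_const.sub measurable_id)).mul hp).mul
      (((((measurable_En hψ measurable_const measurable_id).const_mul _).const_sub _).add_const
        _).exp).ennreal_ofReal).mul (hc.comp measurable_prodMk_left)
  rw [← lintegral_const_mul _ hE]
  congr 1; ext y
  have : jumpWt s ψ f (x, y) γ = ENNReal.ofReal (Real.exp (-(En ψ x γ))) *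
      ENNReal.ofReal (Real.exp (s * En ψ x γ - (1 - s) * En ψ y γ + cpair f γ)) := by
    rw [← ENNReal.ofReal_mul (Real.exp_pos _).le, ← Real.exp_add, jumpWt]
    congr 2; ring
  rw [this]; ring

lemma lintegral_jumpSum_mul (hG : RealGNZ z ψ μ) (hd : 0 < d) (hψ : Measurable ψ)
    (hf : Measurable f) (hb : Measurable b) (hp : Measurable p) {G : Config d → ℝ≥0∞}
    (hGm : Measurable G) :
    ∫⁻ γ, jumpSum s ψ f b p γ * G γ ∂μ
      = ∫⁻ γ, ∫⁻ X, jumpWt s ψ f X γ * G (γ.ins X.1) ∂(jumpMeas z b p) ∂μ := by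
  simp_rw [jumpSum, ← ENNReal.tsum_mul_right]
  rw [hG (fun γ x => jumpRate s ψ f b p x (γ.del x) * G γ)
    ((measurable_jumpRate hψ hf hb hp measurable_del measurable_snd).mul
      (hGm.comp measurable_fst))]
  congr 1; ext γ
  rw [← lintegral_jumpRate hψ hf hb hp γ (c := fun x _ => G (γ.ins x))
    (hGm.comp (measurable_ins.comp (measurable_const.prodMk measurable_fst)))]
  refine lintegral_congr_ae ?_
  filter_upwards [ae_notMem_config hd γ] with x hx
  rw [del_ins γ hx, jumpRate, ← lintegral_mul_const]
  exact (((hb.comp (measurable_const.sub measurable_id)).mul hp).mul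
      (((((measurable_En hψ measurable_const measurable_id).const_mul _).const_sub _).add_const
        _).exp).ennreal_ofReal)

/-- The factor by which the weight of the jump `X'` changes when the point `X.1` is added. -/
def crossOne (s : ℝ) (ψ f : EucSp d → ℝ) (X X' : EucSp d × EucSp d) : ℝ :=
  Real.exp (-((1 - s) * ψ (X'.1 - X.1)) - (1 - s) * ψ (X'.2 - X.1) + f X.1)

def crossTwo (s : ℝ) (ψ f : EucSp d → ℝ) (X X' : EucSp d × EucSp d) : ℝ :=
  Real.exp (-((1 - 2 * s) * ψ (X.1 - X'.1)) - (1 - s) * ψ (X.2 - X'.1) - (1 - s) * ψ (X'.2 - X.1)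
    + f X'.1 + f X.1)

lemma jumpWt_ins (hf : HasCompactSupport f) {γ : Config d} {x : EucSp d} (hx : x ∉ γ.1)
    {X : EucSp d × EucSp d} (h1 : Good ψ X.1 γ) (h2 : Good ψ X.2 γ) :
    jumpWt s ψ f X (γ.ins x) = jumpWt s ψ f X γ *
      ENNReal.ofReal (Real.exp (-((1 - s) * ψ (X.1 - x)) - (1 - s) * ψ (X.2 - x) + f x)) := by
  rw [jumpWt, jumpWt, ← ENNReal.ofReal_mul (Real.exp_pos _).le, ← Real.exp_add,
    h1.En_ins hx, h2.En_ins hx, cpair_ins hf hx]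
  congr 2; ring

lemma jumpRate_ins (hf : HasCompactSupport f) {γ : Config d} {x x' : EucSp d}
    (hx : x ∉ γ.1) (h1 : Good ψ x' γ) (h2 : ∀ᵐ y, Good ψ y γ) :
    jumpRate s ψ f b p x' (γ.ins x) = ∫⁻ y, b (x' - y) * p y *
      ENNReal.ofReal (Real.exp (s * En ψ x' γ - (1 - s) * En ψ y γ + cpair f γ)) *
      ENNReal.ofReal (Real.exp (s * ψ (x' - x) - (1 - s) * ψ (y - x) + f x)) := by
  refine lintegral_congr_ae ?_
  filter_upwards [h2] with y hy
  rw [mul_assoc (b (x' - y) * p y), ← ENNReal.ofReal_mul (Real.exp_pos _).le, ← Real.exp_add,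
    h1.En_ins hx, hy.En_ins hx, cpair_ins hf hx]
  congr 3; ring

lemma lintegral_jumpSum_mul_jumpMean (hk : CorrData μ k ξ) (hG : RealGNZ z ψ μ) (hd : 0 < d)
    (hψ : PotData ψ) (hf : IsC0 f) (hb : Measurable b) (hp : Measurable p) :
    ∫⁻ γ, jumpSum s ψ f b p γ * jumpMean s z ψ f b p γ ∂μ
      = ∫⁻ γ, ∫⁻ X, ∫⁻ X', jumpWt s ψ f X γ * jumpWt s ψ f X' γ *
          ENNReal.ofReal (crossOne s ψ f X X') ∂(jumpMeas z b p) ∂(jumpMeas z b p) ∂μ := by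
  rw [lintegral_jumpSum_mul hG hd hψ.meas hf.1.measurable hb hp
    (measurable_jumpMean hψ.meas hf.1.measurable)]
  refine lintegral_congr_ae ?_
  filter_upwards [hk.ae_ae_good hd hψ] with γ hγ
  have hγ' := ae_jumpMeas (z := z) (b := b) (p := p) hγ
  refine lintegral_congr_ae ?_
  filter_upwards [hγ'] with X hX
  rw [jumpMean, ← lintegral_const_mul' _ _ (by unfold jumpWt; finiteness)]
  refine lintegral_congr_ae ?_
  filter_upwards [hγ'] with X' hX'
  rw [jumpWt_ins hf.2 hX.1.1 hX'.1 hX'.2, crossOne, mul_assoc]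

lemma jumpSum_ins {γ : Config d} {x : EucSp d} (hx : x ∉ γ.1) :
    jumpSum s ψ f b p (γ.ins x) = jumpRate s ψ f b p x γ +
      ∑' x' : γ.1, jumpRate s ψ f b p x'.1 ((γ.del x'.1).ins x) := by
  rw [jumpSum, tsum_ins γ hx (fun y => jumpRate s ψ f b p y ((γ.ins x).del y)), del_ins γ hx]
  congr 1
  refine tsum_congr fun y => ?_
  rw [ins_del_of_ne]
  rintro rfl
  exact hx y.2

lemma lintegral_jumpSum_sq (hk : CorrData μ k ξ) (hG : RealGNZ z ψ μ) (hd : 0 < d)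
    (hψ : PotData ψ) (hf : IsC0 f) (hb : Measurable b) (hp : Measurable p) :
    ∫⁻ γ, jumpSum s ψ f b p γ * jumpSum s ψ f b p γ ∂μ
      = ∫⁻ γ, ∫⁻ X, jumpWt s ψ f X γ * jumpRate s ψ f b p X.1 γ ∂(jumpMeas z b p) ∂μ
      + ∫⁻ γ, ∫⁻ X, ∫⁻ X', jumpWt s ψ f X γ * jumpWt s ψ f X' γ *
          ENNReal.ofReal (crossTwo s ψ f X X') ∂(jumpMeas z b p) ∂(jumpMeas z b p) ∂μ := by
  have hfm := hf.1.measurable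
  have := hk.prob
  rw [lintegral_jumpSum_mul hG hd hψ.meas hfm hb hp (measurable_jumpSum hψ.meas hfm hb hp)]
  have hm1 : ∀ {α : Type} [MeasurableSpace α] {Γ : α → Config d} (_ : Measurable Γ)
      {X : α → EucSp d × EucSp d} (_ : Measurable X),
      Measurable fun a => jumpWt s ψ f (X a) (Γ a) * jumpRate s ψ f b p (X a).1 (Γ a) :=
    fun hΓ _ hX => (measurable_jumpWt hψ.meas hfm hΓ hX).mul
      (measurable_jumpRate hψ.meas hfm hb hp hΓ (measurable_fst.comp hX))
  set F : Config d → EucSp d → ℝ≥0∞ := fun γ x' => ∫⁻ X, jumpWt s ψ f X γ *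
    jumpRate s ψ f b p x' ((γ.del x').ins X.1) ∂(jumpMeas z b p) with hFdef
  have hmF0 : Measurable fun q : (Config d × EucSp d) × (EucSp d × EucSp d) =>
      jumpWt s ψ f q.2 q.1.1 * jumpRate s ψ f b p q.1.2 ((q.1.1.del q.1.2).ins q.2.1) :=
    (measurable_jumpWt hψ.meas hfm (measurable_fst.comp measurable_fst) measurable_snd).mul
      (measurable_jumpRate hψ.meas hfm hb hp
        (measurable_ins.comp ((measurable_del.comp measurable_fst).prodMk
          (measurable_fst.comp measurable_snd))) (measurable_snd.comp measurable_fst))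
  have hmF : Measurable (Function.uncurry F) := Measurable.lintegral_prod_right' hmF0
  have hsplit : ∀ᵐ γ ∂μ, ∫⁻ X, jumpWt s ψ f X γ * jumpSum s ψ f b p (γ.ins X.1) ∂(jumpMeas z b p)
      = ∫⁻ X, jumpWt s ψ f X γ * jumpRate s ψ f b p X.1 γ ∂(jumpMeas z b p)
        + ∑' x' : γ.1, F γ x'.1 := by
    refine ae_of_all _ fun γ => ?_
    have hm2 : Measurable fun X => jumpWt s ψ f X γ * jumpRate s ψ f b p X.1 γ :=
      hm1 measurable_const measurable_id
    rw [← lintegral_tsum, ← lintegral_add_left hm2]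
    · refine lintegral_congr_ae ?_
      filter_upwards [ae_jumpMeas (z := z) (b := b) (p := p) (ae_notMem_config hd γ)] with X hX
      rw [jumpSum_ins hX.1, mul_add, ENNReal.tsum_mul_left]
    · intro x'
      exact (hmF0.comp ((measurable_const (a := (γ, x'.1))).prodMk measurable_id)).aemeasurable
  rw [lintegral_congr_ae hsplit, lintegral_add_left]
  swap
  · exact Measurable.lintegral_prod_right' (f := fun q : Config d × (EucSp d × EucSp d) =>
      jumpWt s ψ f q.2 q.1 * jumpRate s ψ f b p q.2.1 q.1) (hm1 measurable_fst measurable_snd)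
  congr 1
  rw [hG F hmF]
  refine lintegral_congr_ae ?_
  filter_upwards [hk.ae_ae_good hd hψ] with γ hγ
  have hγ' := ae_jumpMeas (z := z) (b := b) (p := p) hγ
  have hmI : Measurable (Function.uncurry fun (x' : EucSp d) (X : EucSp d × EucSp d) =>
      ENNReal.ofReal z * ENNReal.ofReal (Real.exp (-(En ψ x' γ))) *
      (jumpWt s ψ f X (γ.ins x') * jumpRate s ψ f b p x' (γ.ins X.1))) := by
    refine ((((measurable_En hψ.meas measurable_const measurable_fst).neg.exp).ennreal_ofReal).const_mul
      _).mul ?_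
    exact (measurable_jumpWt hψ.meas hfm (measurable_ins.comp
      (measurable_const.prodMk measurable_fst)) measurable_snd).mul
      (measurable_jumpRate hψ.meas hfm hb hp (measurable_ins.comp
      (measurable_const.prodMk (measurable_fst.comp measurable_snd))) measurable_fst)
  have hstep : ∀ᵐ x' : EucSp d, ENNReal.ofReal z * ENNReal.ofReal (Real.exp (-(En ψ x' γ))) *
      F (γ.ins x') x' = ∫⁻ X, ENNReal.ofReal z * ENNReal.ofReal (Real.exp (-(En ψ x' γ))) *
      (jumpWt s ψ f X (γ.ins x') * jumpRate s ψ f b p x' (γ.ins X.1)) ∂(jumpMeas z b p) := by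
    filter_upwards [ae_notMem_config hd γ] with x' hx'
    rw [lintegral_const_mul' _ _ (by finiteness)]
    simp only [hFdef]
    rw [del_ins γ hx']
  rw [lintegral_congr_ae hstep, lintegral_lintegral_swap hmI.aemeasurable]
  refine lintegral_congr_ae ?_
  filter_upwards [hγ'] with X hX
  have hc : Measurable (Function.uncurry fun x' y' : EucSp d => jumpWt s ψ f X γ *
      ENNReal.ofReal (crossTwo s ψ f X (x', y'))) := by
    refine Measurable.const_mul (Measurable.ennreal_ofReal (Measurable.exp ?_)) _
    have hψm := hψ.meas
    fun_prop
  have := lintegral_jumpRate (s := s) (z := z) hψ.meas hfm hb hp γ hc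
  have e1 : ∫⁻ X', jumpWt s ψ f X γ * jumpWt s ψ f X' γ * ENNReal.ofReal (crossTwo s ψ f X X')
      ∂(jumpMeas z b p) = ∫⁻ X', jumpWt s ψ f X' γ * (jumpWt s ψ f X γ *
        ENNReal.ofReal (crossTwo s ψ f X (X'.1, X'.2))) ∂(jumpMeas z b p) := by
    congr 1; ext X'; ring
  rw [e1, ← this]
  refine lintegral_congr_ae ?_
  filter_upwards [hγ] with x' hx'
  congr 1
  rw [jumpRate_ins hf.2 hX.1.1 hx' hγ, jumpWt_ins hf.2 hx'.1 hX.1 hX.2,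
    ← lintegral_const_mul' _ _ (by unfold jumpWt; finiteness)]
  congr 1; ext y
  rw [mul_comm, mul_assoc (b (x' - y) * p y * _), mul_left_comm (ENNReal.ofReal _),
    ← ENNReal.ofReal_mul (Real.exp_pos _).le, ← Real.exp_add]
  congr 4
  rw [← hψ.even (x' - X.1), neg_sub]
  ring

end Jump

/-- The squared distance in `[0,∞]`. -/
def sqd (a b : ℝ≥0∞) : ℝ≥0∞ := ((a - b) + (b - a)) * ((a - b) + (b - a))

lemma sqd_add_two_mul (a b : ℝ≥0∞) : sqd a b + 2 * (a * b) = a * a + b * b := by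
  have key : ∀ a c : ℝ≥0∞, sqd a (a + c) + 2 * (a * (a + c)) = a * a + (a + c) * (a + c) := by
    intro a c
    by_cases ha : a = ⊤
    · simp [ha]
    · rw [sqd, tsub_eq_zero_of_le le_self_add, ENNReal.add_sub_cancel_left ha]
      ring
  rcases le_total a b with h | h
  · obtain ⟨c, rfl⟩ := exists_add_of_le h
    exact key a c
  · obtain ⟨c, rfl⟩ := exists_add_of_le h
    have := key b c
    rw [sqd, add_comm (_ - _)] at this
    rw [sqd, mul_comm (b + c) b, this, add_comm]

lemma add_mul_self_le (a b : ℝ≥0∞) : (a + b) * (a + b) ≤ 2 * (a * a) + 2 * (b * b) := by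
  have h1 : 2 * (a * b) ≤ a * a + b * b := by
    rw [← sqd_add_two_mul]; exact le_add_self
  calc (a + b) * (a + b) = a * a + b * b + 2 * (a * b) := by ring
    _ ≤ a * a + b * b + (a * a + b * b) := by gcongr
    _ = _ := by ring

lemma sqd_le (a b c : ℝ≥0∞) : sqd a c ≤ 2 * sqd a b + 2 * sqd b c := by
  have h1 : (a - c) + (c - a) ≤ ((a - b) + (b - a)) + ((b - c) + (c - b)) := by
    calc (a - c) + (c - a) ≤ ((a - b) + (b - c)) + ((c - b) + (b - a)) := by
          gcongr <;> exact tsub_le_tsub_add_tsub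
      _ = _ := by ring
  exact (mul_le_mul' h1 h1).trans (add_mul_self_le _ _)

lemma sqd_le_add (a b : ℝ≥0∞) : sqd a b ≤ a * a + b * b := by
  rw [← sqd_add_two_mul]; exact le_self_add

lemma measurable_sqd {α : Type*} [MeasurableSpace α] {F G : α → ℝ≥0∞} (hF : Measurable F)
    (hG : Measurable G) : Measurable fun a => sqd (F a) (G a) :=
  ((hF.sub hG).add (hG.sub hF)).mul ((hF.sub hG).add (hG.sub hF))

lemma ofReal_sub_sq {a b : ℝ≥0∞} (ha : a ≠ ⊤) (hb : b ≠ ⊤) :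
    ENNReal.ofReal ((a.toReal - b.toReal) ^ 2) = sqd a b := by
  have key : ∀ a b : ℝ≥0∞, a ≠ ⊤ → b ≠ ⊤ → a ≤ b →
      ENNReal.ofReal ((b.toReal - a.toReal) ^ 2) = (b - a) * (b - a) := by
    intro a b ha hb hab
    rw [← ENNReal.toReal_sub_of_le hab hb, sq, ENNReal.ofReal_mul ENNReal.toReal_nonneg,
      ENNReal.ofReal_toReal (by finiteness)]
  rcases le_total a b with h | h
  · rw [sqd, tsub_eq_zero_of_le h, zero_add, ← key a b ha hb h]
    congr 1; ring
  · rw [sqd, tsub_eq_zero_of_le h, add_zero, ← key b a hb ha h]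

lemma lintegral_sqd_le {α : Type*} [MeasurableSpace α] (μ : Measure α) {S T : α → ℝ≥0∞}
    (hS : Measurable S) (hT : Measurable T) {D₁ D₂ : ℝ≥0∞}
    (h1 : ∫⁻ a, S a * S a ∂μ ≤ ∫⁻ a, T a * T a ∂μ + D₁)
    (h2 : ∫⁻ a, T a * T a ∂μ ≤ ∫⁻ a, S a * T a ∂μ + D₂) (hfin : ∫⁻ a, T a * T a ∂μ ≠ ⊤) :
    ∫⁻ a, sqd (S a) (T a) ∂μ ≤ D₁ + 2 * D₂ := by
  by_cases hD : D₁ = ⊤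
  · simp [hD]
  have e1 : ∫⁻ a, sqd (S a) (T a) ∂μ + 2 * ∫⁻ a, S a * T a ∂μ
      = ∫⁻ a, S a * S a ∂μ + ∫⁻ a, T a * T a ∂μ := by
    have hST : Measurable fun a => S a * T a := hS.mul hT
    have hSS : Measurable fun a => S a * S a := hS.mul hS
    rw [← lintegral_const_mul _ hST, ← lintegral_add_left (measurable_sqd hS hT),
      ← lintegral_add_left hSS]
    exact lintegral_congr fun a => sqd_add_two_mul _ _
  have hST : 2 * ∫⁻ a, S a * T a ∂μ ≠ ⊤ := by
    refine ne_top_of_le_ne_top ?_ (le_add_self.trans e1.le)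
    exact ENNReal.add_ne_top.2 ⟨ne_top_of_le_ne_top (ENNReal.add_ne_top.2 ⟨hfin, hD⟩) h1, hfin⟩
  refine (ENNReal.add_le_add_iff_right hST).1 ?_
  rw [e1]
  calc _ ≤ (∫⁻ a, T a * T a ∂μ + D₁) + ∫⁻ a, T a * T a ∂μ := by gcongr
    _ ≤ ((∫⁻ a, S a * T a ∂μ + D₂) + D₁) + (∫⁻ a, S a * T a ∂μ + D₂) := by gcongr
    _ = _ := by ring

lemma lintegral_mul_self_le {α : Type*} [MeasurableSpace α] (ρ : Measure α) {Q : α → ℝ≥0∞}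
    (hQ : AEMeasurable Q ρ) :
    (∫⁻ a, Q a ∂ρ) * (∫⁻ a, Q a ∂ρ) ≤ 2 * ρ univ * ∫⁻ a, Q a * Q a ∂ρ := by
  have hQ2 : AEMeasurable (fun a => Q a * Q a) ρ := hQ.mul hQ
  calc (∫⁻ a, Q a ∂ρ) * (∫⁻ a, Q a ∂ρ) = ∫⁻ a, ∫⁻ a', Q a * Q a' ∂ρ ∂ρ := by
        rw [← lintegral_mul_const'' _ hQ]
        exact lintegral_congr fun a => (lintegral_const_mul'' _ hQ).symm
    _ ≤ ∫⁻ a, ∫⁻ a', (Q a * Q a + Q a' * Q a') ∂ρ ∂ρ := by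
        refine lintegral_mono fun a => lintegral_mono fun a' => ?_
        simp only
        rw [← sqd_add_two_mul, two_mul]
        exact le_self_add.trans le_add_self
    _ = ∫⁻ a, (Q a * Q a * ρ univ + ∫⁻ a', Q a' * Q a' ∂ρ) ∂ρ := by
        refine lintegral_congr fun a => ?_
        rw [lintegral_add_left' aemeasurable_const, lintegral_const]
    _ = _ := by
        rw [lintegral_add_left' (hQ2.mul_const _), lintegral_mul_const'' _ hQ2, lintegral_const]
        ring

lemma sqd_lintegral_le {α : Type*} [MeasurableSpace α] (ρ : Measure α) {g A : α → ℝ≥0∞}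
    (hg : AEMeasurable g ρ) (hA : AEMeasurable A ρ) :
    sqd (∫⁻ a, g a * A a ∂ρ) (∫⁻ a, g a ∂ρ)
      ≤ 2 * ρ univ * ∫⁻ a, g a * g a * sqd (A a) 1 ∂ρ := by
  set X : α → ℝ≥0∞ := fun a => (A a - 1) + (1 - A a)
  have hX : AEMeasurable X ρ := (hA.sub_const 1).add (aemeasurable_const.sub hA)
  have h1 : (∫⁻ a, g a * A a ∂ρ - ∫⁻ a, g a ∂ρ) + (∫⁻ a, g a ∂ρ - ∫⁻ a, g a * A a ∂ρ)
      ≤ ∫⁻ a, g a * X a ∂ρ := by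
    have e1 : ∫⁻ a, g a * A a ∂ρ ≤ ∫⁻ a, g a * (A a - 1) ∂ρ + ∫⁻ a, g a ∂ρ := by
      rw [← lintegral_add_right' _ hg]
      refine lintegral_mono fun a => ?_
      simp only
      calc g a * A a ≤ g a * ((A a - 1) + 1) := by gcongr; exact le_tsub_add
        _ = _ := by ring
    have e2 : ∫⁻ a, g a ∂ρ ≤ ∫⁻ a, g a * (1 - A a) ∂ρ + ∫⁻ a, g a * A a ∂ρ := by
      have hgA : AEMeasurable (fun a => g a * A a) ρ := hg.mul hA
      rw [← lintegral_add_right' _ hgA]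
      refine lintegral_mono fun a => ?_
      simp only
      calc g a = g a * 1 := (mul_one _).symm
        _ ≤ g a * ((1 - A a) + A a) := by gcongr; exact le_tsub_add
        _ = _ := by ring
    calc _ ≤ ∫⁻ a, g a * (A a - 1) ∂ρ + ∫⁻ a, g a * (1 - A a) ∂ρ :=
          add_le_add (tsub_le_iff_right.2 e1) (tsub_le_iff_right.2 e2)
      _ = _ := by
          have hgA : AEMeasurable (fun a => g a * (A a - 1)) ρ := hg.mul (hA.sub_const 1)
          rw [← lintegral_add_left' hgA]
          exact lintegral_congr fun a => (mul_add _ _ _).symm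
  refine (mul_le_mul' h1 h1).trans ((lintegral_mul_self_le ρ (hg.mul hX)).trans (le_of_eq ?_))
  congr 2; ext a
  simp only [sqd, X, Pi.mul_apply]
  ring

lemma lintegral_triple_le {α β : Type*} [MeasurableSpace α] [MeasurableSpace β] {μ : Measure α}
    {ν : Measure β} [SFinite μ] [SFinite ν] {J : β → α → ℝ≥0∞} {W : β → β → ℝ≥0∞} {C : ℝ≥0∞}
    (hJ : Measurable fun q : α × β => J q.2 q.1) (hW : Measurable (Function.uncurry W))
    (hC : ∀ X X', ∫⁻ γ, J X γ * J X' γ ∂μ ≤ C) (hWt : ∀ X X', W X X' ≠ ⊤) :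
    ∫⁻ γ, ∫⁻ X, ∫⁻ X', J X γ * J X' γ * W X X' ∂ν ∂ν ∂μ ≤ C * ∫⁻ X, ∫⁻ X', W X X' ∂ν ∂ν := by
  have hm0 : Measurable fun q : (α × β) × β => J q.1.2 q.1.1 * J q.2 q.1.1 * W q.1.2 q.2 :=
    ((hJ.comp measurable_fst).mul
      (hJ.comp ((measurable_fst.comp measurable_fst).prodMk measurable_snd))).mul
      (hW.comp ((measurable_snd.comp measurable_fst).prodMk measurable_snd))
  have hm1 : Measurable (Function.uncurry fun (γ : α) (X : β) =>
      ∫⁻ X', J X γ * J X' γ * W X X' ∂ν) := hm0.lintegral_prod_right'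
  have hWi : Measurable fun X => ∫⁻ X', W X X' ∂ν := hW.lintegral_prod_right'
  rw [lintegral_lintegral_swap hm1.aemeasurable, ← lintegral_const_mul _ hWi]
  refine lintegral_mono fun X => ?_
  have hm2 : Measurable (Function.uncurry fun (γ : α) (X' : β) => J X γ * J X' γ * W X X') :=
    hm0.comp ((measurable_fst.prodMk measurable_const).prodMk measurable_snd)
  simp only
  rw [lintegral_lintegral_swap hm2.aemeasurable]
  have hW' : Measurable fun X' => W X X' := hW.comp (measurable_const.prodMk measurable_id)
  rw [← lintegral_const_mul _ hW']
  refine lintegral_mono fun X' => ?_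
  simp only
  rw [lintegral_mul_const' _ _ (hWt X X')]
  exact mul_le_mul_left (hC X X') _

lemma lintegral_add_triple {α β : Type*} [MeasurableSpace α] [MeasurableSpace β] {μ : Measure α}
    {ν : Measure β} [SFinite μ] [SFinite ν] {J : β → α → ℝ≥0∞} {V W : β → β → ℝ≥0∞}
    (hJ : Measurable fun q : α × β => J q.2 q.1) (hV : Measurable (Function.uncurry V)) :
    ∫⁻ γ, ∫⁻ X, ∫⁻ X', J X γ * J X' γ * (V X X' + W X X') ∂ν ∂ν ∂μ
      = ∫⁻ γ, ∫⁻ X, ∫⁻ X', J X γ * J X' γ * V X X' ∂ν ∂ν ∂μ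
      + ∫⁻ γ, ∫⁻ X, ∫⁻ X', J X γ * J X' γ * W X X' ∂ν ∂ν ∂μ := by
  have hm0 : Measurable fun q : (α × β) × β => J q.1.2 q.1.1 * J q.2 q.1.1 * V q.1.2 q.2 :=
    ((hJ.comp measurable_fst).mul
      (hJ.comp ((measurable_fst.comp measurable_fst).prodMk measurable_snd))).mul
      (hV.comp ((measurable_snd.comp measurable_fst).prodMk measurable_snd))
  have hm1 : Measurable (fun q : α × β => ∫⁻ X', J q.2 q.1 * J X' q.1 * V q.2 X' ∂ν) :=
    hm0.lintegral_prod_right'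
  have hm2 : Measurable (fun γ : α => ∫⁻ X, ∫⁻ X', J X γ * J X' γ * V X X' ∂ν ∂ν) :=
    hm1.lintegral_prod_right'
  rw [← lintegral_add_left hm2]
  refine lintegral_congr fun γ => ?_
  have hm3 : Measurable fun X => ∫⁻ X', J X γ * J X' γ * V X X' ∂ν :=
    hm1.comp measurable_prodMk_left
  rw [← lintegral_add_left hm3]
  refine lintegral_congr fun X => ?_
  have hm4 : Measurable fun X' => J X γ * J X' γ * V X X' :=
    hm0.comp (measurable_prodMk_left (x := (γ, X)))
  rw [← lintegral_add_left hm4]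
  simp only [mul_add]

section Comparison

variable {d : ℕ} {s z ξ : ℝ} {μ : Measure (Config d)}
  {k : ∀ n : ℕ, (Fin n → EucSp d) → ℝ} {ψ f : EucSp d → ℝ} {b p : EucSp d → ℝ≥0∞}

lemma jumpMean_mul_self (hψ : PotData ψ) (hf : IsC0 f) (γ : Config d) :
    jumpMean s z ψ f b p γ * jumpMean s z ψ f b p γ
      = ∫⁻ X, ∫⁻ X', jumpWt s ψ f X γ * jumpWt s ψ f X' γ ∂(jumpMeas z b p) ∂(jumpMeas z b p) := by
  have hm : Measurable fun X => jumpWt s ψ f X γ :=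
    measurable_jumpWt hψ.meas hf.1.measurable measurable_const measurable_id
  rw [jumpMean, ← lintegral_mul_const _ hm]
  exact lintegral_congr fun X => (lintegral_const_mul _ hm).symm

lemma one_le_ofReal_add (c : ℝ) : 1 ≤ ENNReal.ofReal c + ENNReal.ofReal |c - 1| := by
  rw [← ENNReal.ofReal_one]
  refine (ENNReal.ofReal_le_ofReal ?_).trans ENNReal.ofReal_add_le
  have := neg_abs_le (c - 1); linarith

lemma ofReal_le_one_add (c : ℝ) : ENNReal.ofReal c ≤ 1 + ENNReal.ofReal |c - 1| := by
  rw [← ENNReal.ofReal_one]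
  refine (ENNReal.ofReal_le_ofReal ?_).trans ENNReal.ofReal_add_le
  have := le_abs_self (c - 1); linarith

lemma measurable_cross (hψ : Measurable ψ) (hf : Measurable f) :
    Measurable (Function.uncurry (crossOne s ψ f)) ∧ Measurable (Function.uncurry (crossTwo s ψ f)) := by
  constructor
  · refine Measurable.exp ?_
    fun_prop
  · refine Measurable.exp ?_
    fun_prop

lemma lintegral_sqd_jumpSum_le (hk : CorrData μ k ξ) (hG : RealGNZ z ψ μ) (hd : 0 < d)
    (hψ : PotData ψ) (hf : IsC0 f) (hb : Measurable b) (hp : Measurable p) {C : ℝ≥0∞} (hCt : C ≠ ⊤)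
    (hC : ∀ X X' : EucSp d × EucSp d, ∫⁻ γ, jumpWt s ψ f X γ * jumpWt s ψ f X' γ ∂μ ≤ C)
    (hfin : jumpMeas z b p univ ≠ ⊤) :
    ∫⁻ γ, sqd (jumpSum s ψ f b p γ) (jumpMean s z ψ f b p γ) ∂μ
      ≤ (∫⁻ γ, ∫⁻ X, jumpWt s ψ f X γ * jumpRate s ψ f b p X.1 γ ∂(jumpMeas z b p) ∂μ
        + C * ∫⁻ X, ∫⁻ X', ENNReal.ofReal |crossTwo s ψ f X X' - 1|
          ∂(jumpMeas z b p) ∂(jumpMeas z b p))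
        + 2 * (C * ∫⁻ X, ∫⁻ X', ENNReal.ofReal |crossOne s ψ f X X' - 1|
          ∂(jumpMeas z b p) ∂(jumpMeas z b p)) := by
  have := hk.prob
  have hfm := hf.1.measurable
  obtain ⟨hc1, hc2⟩ := measurable_cross (s := s) hψ.meas hfm
  have hone : Measurable (Function.uncurry
      fun _ _ : EucSp d × EucSp d => (1 : ℝ≥0∞)) := measurable_const
  have hc1' : Measurable (Function.uncurry fun X X' : EucSp d × EucSp d =>
      ENNReal.ofReal (crossOne s ψ f X X')) := hc1.ennreal_ofReal
  have habs1 : Measurable (Function.uncurry fun X X' : EucSp d × EucSp d =>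
      ENNReal.ofReal |crossOne s ψ f X X' - 1|) := (hc1.sub_const 1).abs.ennreal_ofReal
  have habs2 : Measurable (Function.uncurry fun X X' : EucSp d × EucSp d =>
      ENNReal.ofReal |crossTwo s ψ f X X' - 1|) := (hc2.sub_const 1).abs.ennreal_ofReal
  have hJ : Measurable fun q : Config d × (EucSp d × EucSp d) => jumpWt s ψ f q.2 q.1 :=
    measurable_jumpWt hψ.meas hfm measurable_fst measurable_snd
  have hT2 : ∫⁻ γ, jumpMean s z ψ f b p γ * jumpMean s z ψ f b p γ ∂μ
      = ∫⁻ γ, ∫⁻ X, ∫⁻ X', jumpWt s ψ f X γ * jumpWt s ψ f X' γ * 1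
        ∂(jumpMeas z b p) ∂(jumpMeas z b p) ∂μ := by
    simp_rw [jumpMean_mul_self hψ hf, mul_one]
  refine lintegral_sqd_le μ (measurable_jumpSum hψ.meas hfm hb hp)
    (measurable_jumpMean hψ.meas hfm) ?_ ?_ ?_
  · rw [lintegral_jumpSum_sq hk hG hd hψ hf hb hp, hT2, add_left_comm]
    gcongr
    refine le_trans ?_ (add_le_add_right (lintegral_triple_le hJ habs2 hC
      fun _ _ => ENNReal.ofReal_ne_top) _)
    rw [← lintegral_add_triple hJ hone]
    gcongr
    exact ofReal_le_one_add _
  · rw [lintegral_jumpSum_mul_jumpMean hk hG hd hψ hf hb hp, hT2]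
    refine le_trans ?_ (add_le_add_right (lintegral_triple_le hJ habs1 hC
      fun _ _ => ENNReal.ofReal_ne_top) _)
    rw [← lintegral_add_triple hJ hc1']
    gcongr
    exact one_le_ofReal_add _
  · rw [hT2]
    refine ne_top_of_le_ne_top ?_ (lintegral_triple_le hJ hone hC fun _ _ => ENNReal.one_ne_top)
    simp only [lintegral_const, one_mul]
    finiteness

end Comparison

section Scaling

variable {d : ℕ} {s z ξ ε : ℝ} {μ : Measure (Config d)}
  {k : ∀ n : ℕ, (Fin n → EucSp d) → ℝ} {ψ f a : EucSp d → ℝ} {p : EucSp d → ℝ≥0∞}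

lemma tendsto_far (t : EucSp d) {w : EucSp d} (hw : w ≠ 0) :
    Tendsto (fun ε : ℝ => t + ε⁻¹ • w) (𝓝[>] 0) (Bornology.cobounded (EucSp d)) := by
  refine (tendsto_add_cobounded t).comp ?_
  rw [← tendsto_norm_atTop_iff_cobounded]
  have : Tendsto (fun ε : ℝ => |ε⁻¹| * ‖w‖) (𝓝[>] 0) atTop :=
    (tendsto_abs_atTop_atTop.comp tendsto_inv_nhdsGT_zero).atTop_mul_const (norm_pos_iff.2 hw)
  simpa [norm_smul] using this

lemma lintegral_aScaled (ha : Measurable a) (hε : 0 < ε) {H : EucSp d → ℝ≥0∞}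
    (hH : Measurable H) :
    ∫⁻ x, ENNReal.ofReal (aScaled a ε x) * H x = ∫⁻ w, ENNReal.ofReal (a w) * H (ε⁻¹ • w) := by
  have hm : Measurable fun w : EucSp d => ENNReal.ofReal (a w) * H (ε⁻¹ • w) :=
    ha.ennreal_ofReal.mul (hH.comp (measurable_const_smul _))
  have hd : 0 < ε ^ d := pow_pos hε d
  have h1 := lintegral_map hm (measurable_const_smul (α := EucSp d) ε)
    (μ := (volume : Measure (EucSp d)))
  rw [show (fun x : EucSp d => ε • x) = (ε • ·) from rfl,
    Measure.map_addHaar_smul volume hε.ne', lintegral_smul_measure] at h1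
  simp only [finrank_euclideanSpace_fin, smul_eq_mul, inv_smul_smul₀ hε.ne'] at h1
  have h2 : ∫⁻ x, ENNReal.ofReal (aScaled a ε x) * H x
      = ENNReal.ofReal (ε ^ d) * ∫⁻ x, ENNReal.ofReal (a (ε • x)) * H x := by
    rw [← lintegral_const_mul' _ _ ENNReal.ofReal_ne_top]
    refine lintegral_congr fun x => ?_
    rw [aScaled, ENNReal.ofReal_mul hd.le, mul_assoc]
  rw [h2, ← h1, ← mul_assoc, ← ENNReal.ofReal_mul hd.le, abs_of_pos (inv_pos.2 hd),
    mul_inv_cancel₀ hd.ne', ENNReal.ofReal_one, one_mul]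

/-- The measure with density `a`. -/
def kernMeas (a : EucSp d → ℝ) : Measure (EucSp d) :=
  volume.withDensity fun w => ENNReal.ofReal (a w)

/-- The measure with density `z p`. -/
def birthMeas (z : ℝ) (p : EucSp d → ℝ≥0∞) : Measure (EucSp d) :=
  volume.withDensity fun y => ENNReal.ofReal z * p y

instance : SFinite (kernMeas a) := by unfold kernMeas; infer_instance

instance : SFinite (birthMeas z p) := by unfold birthMeas; infer_instance

lemma kernMeas_univ (ha : GoodA a) : kernMeas a univ = ENNReal.ofReal (∫ x, a x) := by
  rw [kernMeas, withDensity_apply _ MeasurableSet.univ, setLIntegral_univ,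
    ofReal_integral_eq_lintegral_ofReal ha.int (ae_of_all _ ha.nonneg)]

lemma ae_kernMeas {P : EucSp d → Prop} (h : ∀ᵐ w, P w) : ∀ᵐ w ∂(kernMeas a), P w :=
  (withDensity_absolutelyContinuous _ _).ae_le h

lemma ae_ne_kernMeas (hd : 0 < d) (v : EucSp d) : ∀ᵐ w ∂(kernMeas a), w ≠ v := by
  have : Nonempty (Fin d) := ⟨⟨0, hd⟩⟩
  exact ae_kernMeas (by simp [ae_iff])

/-- The pair of the endpoints of a jump of scaled length `w` arriving at `y`. -/
def farPair (ε : ℝ) (q : EucSp d × EucSp d) : EucSp d × EucSp d := (q.1 + ε⁻¹ • q.2, q.1)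

lemma measurable_farPair : Measurable (farPair (d := d) ε) :=
  Measurable.prodMk (f := fun q : EucSp d × EucSp d => q.1 + ε⁻¹ • q.2)
    (measurable_fst.add (measurable_snd.const_smul ε⁻¹)) measurable_fst

lemma jumpMeas_aScaled (ha : GoodA a) (hp : Measurable p) (hε : 0 < ε) :
    jumpMeas z (fun x => ENNReal.ofReal (aScaled a ε x)) p
      = ((birthMeas z p).prod (kernMeas a)).map (farPair ε) := by
  have hb : Measurable fun x => ENNReal.ofReal (aScaled a ε x) :=
    ((ha.meas.comp (measurable_const_smul ε)).const_mul (ε ^ d)).ennreal_ofReal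
  refine Measure.ext_of_lintegral _ fun G hG => ?_
  have hGf : Measurable fun q => G (farPair ε q) := hG.comp measurable_farPair
  have hzp : Measurable fun y => ENNReal.ofReal z * p y := hp.const_mul _
  have hGi : Measurable fun y => ∫⁻ w, G (farPair ε (y, w)) ∂(kernMeas a) :=
    hGf.lintegral_prod_right'
  rw [lintegral_jumpMeas hb hp hG, lintegral_map hG measurable_farPair,
    lintegral_prod _ hGf.aemeasurable, birthMeas,
    lintegral_withDensity_eq_lintegral_mul _ hzp hGi,
    lintegral_lintegral_swap]
  · refine lintegral_congr fun y => ?_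
    have hGy : Measurable fun x => G (y + x, y) :=
      hG.comp ((measurable_const.add measurable_id).prodMk measurable_const)
    have hGy' : Measurable fun w : EucSp d => G (y + ε⁻¹ • w, y) :=
      hGy.comp (measurable_const_smul (ε⁻¹))
    simp only [Pi.mul_apply, farPair]
    rw [kernMeas, lintegral_withDensity_eq_lintegral_mul _ ha.meas.ennreal_ofReal hGy']
    simp only [Pi.mul_apply]
    have hbG : Measurable fun x => ENNReal.ofReal (aScaled a ε x) * G (y + x, y) := hb.mul hGy
    rw [← lintegral_aScaled ha.meas hε hGy, ← lintegral_const_mul _ hbG,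
      ← lintegral_add_right_eq_self _ y]
    refine lintegral_congr fun x => ?_
    rw [add_comm x y, add_sub_cancel_left]
    ring
  · exact Measurable.aemeasurable (((measurable_const.mul
      (hb.comp (measurable_fst.sub measurable_snd))).mul (hp.comp measurable_snd)).mul hG)

lemma jumpMeas_aScaled_univ (ha : GoodA a) (hp : Measurable p) (hε : 0 < ε) :
    jumpMeas z (fun x => ENNReal.ofReal (aScaled a ε x)) p univ
      = birthMeas z p univ * kernMeas a univ := by
  rw [jumpMeas_aScaled ha hp hε, Measure.map_apply measurable_farPair MeasurableSet.univ,
    preimage_univ, ← univ_prod_univ, Measure.prod_prod]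

end Scaling

section CrossLimit

variable {d : ℕ} {s z ξ ε : ℝ} {μ : Measure (Config d)}
  {k : ∀ n : ℕ, (Fin n → EucSp d) → ℝ} {ψ f a : EucSp d → ℝ} {p : EucSp d → ℝ≥0∞}

lemma kernMeas_univ_ne_top (ha : GoodA a) : kernMeas a univ ≠ ⊤ := by
  rw [kernMeas_univ ha]; exact ENNReal.ofReal_ne_top

lemma tendsto_lintegral_cross (hd : 0 < d) (ha : GoodA a) (hp : Measurable p)
    (hfin : birthMeas z p univ ≠ ⊤) {H : EucSp d × EucSp d → EucSp d × EucSp d → ℝ}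
    (hH : Measurable (Function.uncurry H)) {K : ℝ} (hK : ∀ X X', |H X X' - 1| ≤ K)
    (hlim : ∀ q q' : EucSp d × EucSp d, q.2 ≠ 0 → q'.2 ≠ 0 → q.2 ≠ q'.2 →
      Tendsto (fun ε => H (farPair ε q) (farPair ε q')) (𝓝[>] 0) (𝓝 1)) :
    Tendsto (fun ε => ∫⁻ X, ∫⁻ X', ENNReal.ofReal |H X X' - 1|
        ∂(jumpMeas z (fun x => ENNReal.ofReal (aScaled a ε x)) p)
        ∂(jumpMeas z (fun x => ENNReal.ofReal (aScaled a ε x)) p)) (𝓝[>] 0) (𝓝 0) := by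
  set Q := (birthMeas z p).prod (kernMeas a) with hQ
  have hQu : (Q.prod Q) univ ≠ ⊤ := by
    have := kernMeas_univ_ne_top ha
    simp only [← univ_prod_univ, Measure.prod_prod, hQ]
    finiteness
  have hHm : Measurable fun r : (EucSp d × EucSp d) × (EucSp d × EucSp d) =>
      ENNReal.ofReal |H r.1 r.2 - 1| := (hH.sub_const 1).abs.ennreal_ofReal
  have hfar : ∀ ε : ℝ, Measurable fun r : (EucSp d × EucSp d) × (EucSp d × EucSp d) =>
      (farPair ε r.1, farPair ε r.2) := fun ε =>
    (measurable_farPair.comp measurable_fst).prodMk (measurable_farPair.comp measurable_snd)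
  have hHe : ∀ ε : ℝ, Measurable fun r : (EucSp d × EucSp d) × (EucSp d × EucSp d) =>
      ENNReal.ofReal |H (farPair ε r.1) (farPair ε r.2) - 1| := fun ε => hHm.comp (hfar ε)
  have key : Tendsto (fun ε => ∫⁻ r : (EucSp d × EucSp d) × (EucSp d × EucSp d),
      ENNReal.ofReal |H (farPair ε r.1) (farPair ε r.2) - 1| ∂(Q.prod Q)) (𝓝[>] 0)
      (𝓝 (∫⁻ _, 0 ∂(Q.prod Q))) := by
    refine tendsto_lintegral_filter_of_dominated_convergence (fun _ => ENNReal.ofReal K)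
      (Eventually.of_forall hHe)
      (Eventually.of_forall fun ε => ae_of_all _ fun r => ENNReal.ofReal_le_ofReal (hK _ _)) ?_ ?_
    · rw [lintegral_const]; finiteness
    · have h0 : ∀ v : EucSp d, ∀ᵐ q ∂Q, q.2 ≠ v := fun v =>
        Measure.quasiMeasurePreserving_snd.ae (ae_ne_kernMeas hd v)
      have h3 : ∀ᵐ r ∂(Q.prod Q), r.1.2 ≠ r.2.2 := by
        refine (Measure.ae_prod_iff_ae_ae ?_).2 (ae_of_all _ fun q => ?_)
        · exact (measurableSet_eq_fun (measurable_snd.comp measurable_fst)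
            (measurable_snd.comp measurable_snd)).compl
        · filter_upwards [h0 q.2] with q' hq' using hq'.symm
      filter_upwards [Measure.quasiMeasurePreserving_fst.ae (h0 0),
        Measure.quasiMeasurePreserving_snd.ae (h0 0), h3] with r h1 h2 h3
      have := ENNReal.tendsto_ofReal ((hlim r.1 r.2 h1 h2 h3).sub_const 1).abs
      simpa using this
  rw [lintegral_zero] at key
  refine key.congr' ?_
  filter_upwards [self_mem_nhdsWithin] with ε hε
  rw [jumpMeas_aScaled ha hp hε, lintegral_prod _ (hHe ε).aemeasurable]
  have hi : Measurable fun X => ∫⁻ X', ENNReal.ofReal |H X X' - 1| ∂(Q.map (farPair ε)) :=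
    hHm.lintegral_prod_right'
  rw [lintegral_map hi measurable_farPair]
  refine lintegral_congr fun q => ?_
  have hj : Measurable fun X' => ENNReal.ofReal |H (farPair ε q) X' - 1| :=
    hHm.comp measurable_prodMk_left
  rw [lintegral_map hj measurable_farPair]

lemma IsC0.van (hf : IsC0 f) : Tendsto f (Bornology.cobounded (EucSp d)) (𝓝 0) := by
  rw [Metric.cobounded_eq_cocompact]
  exact hf.2.is_zero_at_infty

lemma IsC0.bdd (hf : IsC0 f) : ∃ M, 0 ≤ M ∧ ∀ x, |f x| ≤ M := by
  obtain ⟨M, hM⟩ := hf.2.exists_bound_of_continuous hf.1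
  exact ⟨M, (norm_nonneg _).trans (hM 0), hM⟩

lemma crossOne_bdd (hs0 : 0 ≤ s) (hs1 : s ≤ 1 / 2) (hψ : PotData ψ) (hf : IsC0 f) :
    ∃ K, ∀ X X', |crossOne s ψ f X X' - 1| ≤ K := by
  obtain ⟨b, hb, hlb⟩ := hψ.lb
  obtain ⟨M, hM, hfM⟩ := hf.bdd
  refine ⟨Real.exp (2 * b + M) + 1, fun X X' => ?_⟩
  have h1 : crossOne s ψ f X X' ≤ Real.exp (2 * b + M) := by
    refine Real.exp_le_exp.2 ?_
    have h1 := hlb (X'.1 - X.1)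
    have h2 := hlb (X'.2 - X.1)
    have h3 := (abs_le.1 (hfM X.1)).2
    nlinarith
  rw [abs_le]
  have h2 : 0 < crossOne s ψ f X X' := Real.exp_pos _
  have h3 := Real.exp_pos (2 * b + M)
  constructor <;> linarith

lemma crossTwo_bdd (hs0 : 0 ≤ s) (hs1 : s ≤ 1 / 2) (hψ : PotData ψ) (hf : IsC0 f) :
    ∃ K, ∀ X X', |crossTwo s ψ f X X' - 1| ≤ K := by
  obtain ⟨b, hb, hlb⟩ := hψ.lb
  obtain ⟨M, hM, hfM⟩ := hf.bdd
  refine ⟨Real.exp (3 * b + 2 * M) + 1, fun X X' => ?_⟩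
  have h1 : crossTwo s ψ f X X' ≤ Real.exp (3 * b + 2 * M) := by
    refine Real.exp_le_exp.2 ?_
    have h1 := hlb (X.1 - X'.1)
    have h2 := hlb (X'.2 - X.1)
    have h4 := hlb (X.2 - X'.1)
    have h3 := (abs_le.1 (hfM X.1)).2
    have h5 := (abs_le.1 (hfM X'.1)).2
    have e1 : -((1 - 2 * s) * ψ (X.1 - X'.1)) ≤ b := by nlinarith
    have e2 : -((1 - s) * ψ (X.2 - X'.1)) ≤ b := by nlinarith
    have e3 : -((1 - s) * ψ (X'.2 - X.1)) ≤ b := by nlinarith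
    linarith
  rw [abs_le]
  have h2 : 0 < crossTwo s ψ f X X' := Real.exp_pos _
  have h3 := Real.exp_pos (3 * b + 2 * M)
  constructor <;> linarith

lemma tendsto_psi_far (hψ : PotData ψ) (t : EucSp d) {w : EucSp d} (hw : w ≠ 0) :
    Tendsto (fun ε : ℝ => ψ (t + ε⁻¹ • w)) (𝓝[>] 0) (𝓝 0) :=
  hψ.van.comp (tendsto_far t hw)

lemma tendsto_crossOne (hψ : PotData ψ) (hf : IsC0 f) (q q' : EucSp d × EucSp d) (h1 : q.2 ≠ 0)
    (h3 : q.2 ≠ q'.2) :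
    Tendsto (fun ε => crossOne s ψ f (farPair ε q) (farPair ε q')) (𝓝[>] 0) (𝓝 1) := by
  have e1 := tendsto_psi_far hψ (q'.1 - q.1) (sub_ne_zero.2 h3.symm)
  have e2 := tendsto_psi_far hψ (q'.1 - q.1) (neg_ne_zero.2 h1)
  have e3 := hf.van.comp (tendsto_far q.1 h1)
  have := (Real.continuous_exp.tendsto _).comp
    (((e1.const_mul (1 - s)).neg.sub (e2.const_mul (1 - s))).add e3)
  simp only [mul_zero, neg_zero, sub_zero, add_zero, Real.exp_zero] at this
  refine this.congr fun ε => ?_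
  simp only [Function.comp_def, crossOne, farPair]
  congr 6 <;> module

lemma tendsto_crossTwo (hψ : PotData ψ) (hf : IsC0 f) (q q' : EucSp d × EucSp d) (h1 : q.2 ≠ 0)
    (h2 : q'.2 ≠ 0) (h3 : q.2 ≠ q'.2) :
    Tendsto (fun ε => crossTwo s ψ f (farPair ε q) (farPair ε q')) (𝓝[>] 0) (𝓝 1) := by
  have e1 := tendsto_psi_far hψ (q.1 - q'.1) (sub_ne_zero.2 h3)
  have e2 := tendsto_psi_far hψ (q.1 - q'.1) (neg_ne_zero.2 h2)
  have e3 := tendsto_psi_far hψ (q'.1 - q.1) (neg_ne_zero.2 h1)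
  have e4 := hf.van.comp (tendsto_far q'.1 h2)
  have e5 := hf.van.comp (tendsto_far q.1 h1)
  have := (Real.continuous_exp.tendsto _).comp
    (((((e1.const_mul (1 - 2 * s)).neg.sub (e2.const_mul (1 - s))).sub
      (e3.const_mul (1 - s))).add e4).add e5)
  simp only [mul_zero, neg_zero, sub_zero, add_zero, Real.exp_zero] at this
  refine this.congr fun ε => ?_
  simp only [Function.comp_def, crossTwo, farPair]
  rw [show q.1 - q'.1 + ε⁻¹ • (q.2 - q'.2) = q.1 + ε⁻¹ • q.2 - (q'.1 + ε⁻¹ • q'.2) by module,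
    show q.1 - q'.1 + ε⁻¹ • -q'.2 = q.1 - (q'.1 + ε⁻¹ • q'.2) by module,
    show q'.1 - q.1 + ε⁻¹ • -q.2 = q'.1 - (q.1 + ε⁻¹ • q.2) by module]

end CrossLimit

lemma lintegral_lintegral_mul_le {α β δ : Type*} [MeasurableSpace α] [MeasurableSpace β]
    [MeasurableSpace δ] {μ : Measure α} {ν : Measure β} {ρ : Measure δ} [SFinite μ] [SFinite ν]
    [SFinite ρ] {J : β → α → ℝ≥0∞} {c : β → δ → ℝ≥0∞} {L : β → δ → α → ℝ≥0∞} {C D : ℝ≥0∞}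
    (hJ : Measurable fun q : α × β => J q.2 q.1) (hc : Measurable (Function.uncurry c))
    (hL : Measurable fun q : (α × β) × δ => L q.1.2 q.2 q.1.1)
    (hC : ∀ X y, ∫⁻ γ, J X γ * L X y γ ∂μ ≤ C) (hD : ∀ X, ∫⁻ y, c X y ∂ρ ≤ D) :
    ∫⁻ γ, ∫⁻ X, J X γ * ∫⁻ y, c X y * L X y γ ∂ρ ∂ν ∂μ ≤ D * C * ν univ := by
  have hcL : Measurable fun q : (α × β) × δ => c q.1.2 q.2 * L q.1.2 q.2 q.1.1 :=
    (hc.comp ((measurable_snd.comp measurable_fst).prodMk measurable_snd)).mul hL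
  have hm : Measurable (Function.uncurry fun (γ : α) (X : β) =>
      J X γ * ∫⁻ y, c X y * L X y γ ∂ρ) := hJ.mul hcL.lintegral_prod_right'
  rw [lintegral_lintegral_swap hm.aemeasurable, ← lintegral_const]
  refine lintegral_mono fun X => ?_
  simp only
  have hJX : Measurable fun γ => J X γ := hJ.comp measurable_prodMk_right
  have hX : Measurable fun q : α × δ => ((q.1, X), q.2) := by fun_prop
  have hJL : Measurable fun q : α × δ => J X q.1 * L X q.2 q.1 :=
    (hJX.comp measurable_fst).mul (hL.comp hX)
  have hcX : Measurable fun y => c X y := hc.comp measurable_prodMk_left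
  have hE : Measurable (Function.uncurry fun (γ : α) (y : δ) => c X y * (J X γ * L X y γ)) :=
    (hcX.comp measurable_snd).mul hJL
  have e1 : ∀ γ, J X γ * ∫⁻ y, c X y * L X y γ ∂ρ = ∫⁻ y, c X y * (J X γ * L X y γ) ∂ρ := by
    intro γ
    have hy : Measurable fun y => c X y * L X y γ :=
      hcL.comp (measurable_prodMk_left (x := (γ, X)))
    rw [← lintegral_const_mul _ hy]
    exact lintegral_congr fun y => mul_left_comm _ _ _
  simp_rw [e1]
  rw [lintegral_lintegral_swap hE.aemeasurable]
  calc _ ≤ ∫⁻ y, c X y * C ∂ρ := by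
        refine lintegral_mono fun y => ?_
        simp only
        have hy : Measurable fun γ => J X γ * L X y γ := hJL.comp measurable_prodMk_right
        rw [lintegral_const_mul _ hy]
        exact mul_le_mul' le_rfl (hC _ _)
    _ ≤ D * C := by
        rw [lintegral_mul_const _ hcX]
        exact mul_le_mul' (hD _) le_rfl

section DiagLimit

variable {d : ℕ} {s z ξ : ℝ} {μ : Measure (Config d)}
  {k : ∀ n : ℕ, (Fin n → EucSp d) → ℝ} {ψ f a : EucSp d → ℝ} {b p : EucSp d → ℝ≥0∞}

lemma birthMeas_univ : birthMeas z p univ = ENNReal.ofReal z * ∫⁻ y, p y := by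
  rw [birthMeas, withDensity_apply _ MeasurableSet.univ, setLIntegral_univ,
    lintegral_const_mul' _ _ ENNReal.ofReal_ne_top]

lemma lintegral_jumpWt_mul_jumpRate_le [SFinite μ] (hψ : PotData ψ) (hf : IsC0 f)
    (hb : Measurable b) (hp : Measurable p) {C β : ℝ≥0∞}
    (hC : ∀ x y y', ∫⁻ γ, ENNReal.ofReal (Real.exp (-((1 - 2 * s) * En ψ x γ)
      - (1 - s) * En ψ y γ - (1 - s) * En ψ y' γ + 2 * cpair f γ)) ∂μ ≤ C)
    (hβ : ∀ x, b x ≤ β) :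
    ∫⁻ γ, ∫⁻ X, jumpWt s ψ f X γ * jumpRate s ψ f b p X.1 γ ∂(jumpMeas z b p) ∂μ
      ≤ β * (∫⁻ y, p y) * C * jumpMeas z b p univ := by
  have hfm := hf.1.measurable
  refine lintegral_lintegral_mul_le (J := jumpWt s ψ f) (c := fun X y => b (X.1 - y) * p y)
    (L := fun X y γ => ENNReal.ofReal (Real.exp (s * En ψ X.1 γ - (1 - s) * En ψ y γ + cpair f γ)))
    (measurable_jumpWt hψ.meas hfm measurable_fst measurable_snd)
    ((hb.comp ((measurable_fst.comp measurable_fst).sub measurable_snd)).mul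
      (hp.comp measurable_snd)) ?_ (fun X y => ?_) fun X => ?_
  · have h1 : Measurable fun q : (Config d × (EucSp d × EucSp d)) × EucSp d => q.1.1 := by fun_prop
    have h2 : Measurable fun q : (Config d × (EucSp d × EucSp d)) × EucSp d => q.1.2.1 := by
      fun_prop
    exact (((((measurable_En hψ.meas h1 h2).const_mul _).sub
      ((measurable_En hψ.meas h1 measurable_snd).const_mul _)).add
      (measurable_cpair hfm h1)).exp).ennreal_ofReal
  · refine le_trans (le_of_eq (lintegral_congr fun γ => ?_)) (hC X.1 X.2 y)
    rw [jumpWt, ← ENNReal.ofReal_mul (Real.exp_pos _).le, ← Real.exp_add]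
    congr 2; ring
  · rw [← lintegral_const_mul _ hp]
    exact lintegral_mono fun y => mul_le_mul' (hβ _) le_rfl

lemma CorrData.exists_moment_jumpWt (hk : CorrData μ k ξ) (hs0 : 0 ≤ s) (hs1 : s ≤ 1 / 2)
    (hψ : PotData ψ) (hf : IsC0 f) :
    ∃ C : ℝ≥0∞, C ≠ ⊤ ∧ (∀ X X' : EucSp d × EucSp d,
      ∫⁻ γ, jumpWt s ψ f X γ * jumpWt s ψ f X' γ ∂μ ≤ C) ∧
      ∀ x y y', ∫⁻ γ, ENNReal.ofReal (Real.exp (-((1 - 2 * s) * En ψ x γ)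
        - (1 - s) * En ψ y γ - (1 - s) * En ψ y' γ + 2 * cpair f γ)) ∂μ ≤ C := by
  obtain ⟨C, hC, h⟩ := hk.exists_moment hψ hf
  have m1 : 1 - s ∈ Icc (0 : ℝ) 4 := ⟨by linarith, by linarith⟩
  refine ⟨C, hC, fun X X' => ?_, fun x y y' => ?_⟩
  · refine le_trans (le_of_eq (lintegral_congr fun γ => ?_))
      (h X.1 X.2 X'.1 X'.2 _ _ _ _ 2 m1 m1 m1 m1 (by norm_num))
    rw [jumpWt, jumpWt, ← ENNReal.ofReal_mul (Real.exp_pos _).le, ← Real.exp_add]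
    congr 2; ring
  · refine le_trans (le_of_eq (lintegral_congr fun γ => ?_))
      (h x y y' 0 (1 - 2 * s) _ _ 0 2 ⟨by linarith, by linarith⟩ m1 m1 (by norm_num) (by norm_num))
    congr 2; ring

lemma tendsto_lintegral_sqd_jumpSum (hk : CorrData μ k ξ) (hG : RealGNZ z ψ μ) (hd : 0 < d)
    (hs0 : 0 ≤ s) (hs1 : s ≤ 1 / 2) (hψ : PotData ψ) (hf : IsC0 f) (ha : GoodA a)
    (hp : Measurable p) (hpt : ∫⁻ y, p y ≠ ⊤) :
    Tendsto (fun ε => ∫⁻ γ, sqd (jumpSum s ψ f (fun x => ENNReal.ofReal (aScaled a ε x)) p γ)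
      (jumpMean s z ψ f (fun x => ENNReal.ofReal (aScaled a ε x)) p γ) ∂μ) (𝓝[>] 0) (𝓝 0) := by
  have := hk.prob
  have hfin : birthMeas z p univ ≠ ⊤ := by rw [birthMeas_univ]; finiteness
  have hafin := kernMeas_univ_ne_top ha
  obtain ⟨C, hCt, hC1, hC2⟩ := hk.exists_moment_jumpWt hs0 hs1 hψ hf
  obtain ⟨hc1, hc2⟩ := measurable_cross (s := s) hψ.meas hf.1.measurable
  obtain ⟨K₁, hK1⟩ := crossOne_bdd hs0 hs1 hψ hf
  obtain ⟨K₂, hK2⟩ := crossTwo_bdd hs0 hs1 hψ hf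
  obtain ⟨A, hA⟩ := ha.bdd
  have l1 := tendsto_lintegral_cross hd ha hp hfin hc1 hK1
    fun q q' h1 _ h3 => tendsto_crossOne hψ hf q q' h1 h3
  have l2 := tendsto_lintegral_cross hd ha hp hfin hc2 hK2
    fun q q' h1 h2 h3 => tendsto_crossTwo hψ hf q q' h1 h2 h3
  have l3 : Tendsto (fun ε : ℝ => ENNReal.ofReal (ε ^ d * A) *
      ((∫⁻ y, p y) * C * (birthMeas z p univ * kernMeas a univ))) (𝓝[>] 0) (𝓝 0) := by
    have h0 : Tendsto (fun ε : ℝ => ε ^ d * A) (𝓝[>] 0) (𝓝 0) := by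
      have : ContinuousAt (fun ε : ℝ => ε ^ d * A) 0 := by fun_prop
      simpa [ContinuousAt, hd.ne'] using this.tendsto.mono_left nhdsWithin_le_nhds
    have := ENNReal.Tendsto.mul_const (ENNReal.tendsto_ofReal h0)
      (b := (∫⁻ y, p y) * C * (birthMeas z p univ * kernMeas a univ)) (Or.inr (by finiteness))
    simpa using this
  have l4 := (l3.add (ENNReal.Tendsto.const_mul l2 (Or.inr hCt))).add
    (ENNReal.Tendsto.const_mul (ENNReal.Tendsto.const_mul l1 (Or.inr hCt))
      (Or.inr ENNReal.ofNat_ne_top) (a := 2))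
  simp only [mul_zero, add_zero] at l4
  refine tendsto_of_tendsto_of_tendsto_of_le_of_le' tendsto_const_nhds l4
    (Eventually.of_forall fun _ => zero_le) ?_
  filter_upwards [self_mem_nhdsWithin] with ε hε
  have hε' : 0 < ε := hε
  have hb : Measurable fun x => ENNReal.ofReal (aScaled a ε x) :=
    ((ha.meas.comp (measurable_const_smul ε)).const_mul (ε ^ d)).ennreal_ofReal
  have hmass := jumpMeas_aScaled_univ (z := z) ha hp hε'
  refine (lintegral_sqd_jumpSum_le hk hG hd hψ hf hb hp hCt hC1
    (by rw [hmass]; finiteness)).trans ?_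
  gcongr
  refine (lintegral_jumpWt_mul_jumpRate_le hψ hf hb hp hC2 (β := ENNReal.ofReal (ε ^ d * A))
    fun x => ENNReal.ofReal_le_ofReal
      (mul_le_mul_of_nonneg_left (hA _) (pow_nonneg hε'.le d))).trans (le_of_eq ?_)
  rw [hmass]; ring

end DiagLimit

section Averages

variable {α β δ : Type*} [MeasurableSpace α] [MeasurableSpace β] [MeasurableSpace δ]
  {μ : Measure α} {ρ : Measure β} {ν : Measure δ} [SFinite μ] [SFinite ρ] [SFinite ν]

lemma lintegral_lintegral_comm_mul {h : α → ℝ≥0∞} {e : δ → α → ℝ≥0∞} (hh : Measurable h)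
    (he : Measurable fun q : α × δ => e q.2 q.1) :
    ∫⁻ γ, h γ * ∫⁻ w, e w γ ∂ν ∂μ = ∫⁻ w, ∫⁻ γ, h γ * e w γ ∂μ ∂ν := by
  have hm : Measurable (Function.uncurry fun (γ : α) (w : δ) => h γ * e w γ) :=
    (hh.comp measurable_fst).mul he
  rw [← lintegral_lintegral_swap hm.aemeasurable]
  refine lintegral_congr fun γ => ?_
  have hw : Measurable fun w => e w γ := he.comp measurable_prodMk_left
  rw [lintegral_const_mul _ hw]

lemma lintegral_mul_lintegral_sq {h : α → ℝ≥0∞} {e : δ → α → ℝ≥0∞} (hh : Measurable h)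
    (he : Measurable fun q : α × δ => e q.2 q.1) :
    ∫⁻ γ, h γ * ((∫⁻ w, e w γ ∂ν) * ∫⁻ w, e w γ ∂ν) ∂μ
      = ∫⁻ w, ∫⁻ w', ∫⁻ γ, h γ * (e w γ * e w' γ) ∂μ ∂ν ∂ν := by
  have hA : Measurable fun γ => ∫⁻ w, e w γ ∂ν := he.lintegral_prod_right'
  have hhA : Measurable fun γ => h γ * ∫⁻ w, e w γ ∂ν := hh.mul hA
  simp_rw [← mul_assoc]
  rw [lintegral_lintegral_comm_mul hhA he, lintegral_congr fun w => ?_]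
  have hew : Measurable fun γ => e w γ := he.comp measurable_prodMk_right
  have hhe : Measurable fun γ => h γ * e w γ := hh.mul hew
  rw [← lintegral_lintegral_comm_mul hhe he]
  exact lintegral_congr fun γ => by ring

lemma mul_self_le_add_inv (g l : ℝ≥0∞) (h0 : l ≠ 0) (ht : l ≠ ⊤) :
    g * g ≤ l * (g * g * (g * g)) + l⁻¹ := by
  rcases le_total (g * g) l⁻¹ with h | h
  · exact h.trans le_add_self
  · refine le_trans ?_ le_self_add
    calc g * g = l * l⁻¹ * (g * g) := by rw [ENNReal.mul_inv_cancel h0 ht, one_mul]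
      _ ≤ l * (g * g) * (g * g) := by gcongr
      _ = _ := mul_assoc _ _ _

lemma lintegral_sqd_average_le {g A : β → α → ℝ≥0∞} {K v l : ℝ≥0∞}
    (hg : Measurable fun q : α × β => g q.2 q.1) (hA : Measurable fun q : α × β => A q.2 q.1)
    (h0 : l ≠ 0) (ht : l ≠ ⊤)
    (hK : ∀ y, ∫⁻ γ, g y γ * g y γ * (g y γ * g y γ) * sqd (A y γ) 1 ∂μ ≤ K)
    (hv : ∀ y, ∫⁻ γ, sqd (A y γ) 1 ∂μ ≤ v) :
    ∫⁻ γ, sqd (∫⁻ y, g y γ * A y γ ∂ρ) (∫⁻ y, g y γ ∂ρ) ∂μ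
      ≤ 2 * ρ univ * ((l * K + l⁻¹ * v) * ρ univ) := by
  have hS : Measurable fun q : α × β => sqd (A q.2 q.1) 1 := measurable_sqd hA measurable_const
  have hggS : Measurable fun q : α × β => g q.2 q.1 * g q.2 q.1 * sqd (A q.2 q.1) 1 :=
    (hg.mul hg).mul hS
  calc _ ≤ ∫⁻ γ, 2 * ρ univ * ∫⁻ y, g y γ * g y γ * sqd (A y γ) 1 ∂ρ ∂μ :=
        lintegral_mono fun γ => sqd_lintegral_le ρ (hg.comp measurable_prodMk_left).aemeasurable
          (hA.comp measurable_prodMk_left).aemeasurable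
    _ = 2 * ρ univ * ∫⁻ y, ∫⁻ γ, g y γ * g y γ * sqd (A y γ) 1 ∂μ ∂ρ := by
        have hi : Measurable fun γ => ∫⁻ y, g y γ * g y γ * sqd (A y γ) 1 ∂ρ :=
          hggS.lintegral_prod_right'
        rw [lintegral_const_mul _ hi, lintegral_lintegral_swap hggS.aemeasurable]
    _ ≤ 2 * ρ univ * ∫⁻ _, (l * K + l⁻¹ * v) ∂ρ := by
        refine mul_le_mul' le_rfl (lintegral_mono fun y => ?_)
        have hgy : Measurable fun γ => g y γ := hg.comp measurable_prodMk_right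
        have hSy : Measurable fun γ => sqd (A y γ) 1 := hS.comp measurable_prodMk_right
        have h4 : Measurable fun γ => g y γ * g y γ * (g y γ * g y γ) * sqd (A y γ) 1 :=
          ((hgy.mul hgy).mul (hgy.mul hgy)).mul hSy
        have h5 : Measurable fun γ => l * (g y γ * g y γ * (g y γ * g y γ) * sqd (A y γ) 1) :=
          h4.const_mul _
        calc _ ≤ ∫⁻ γ, (l * (g y γ * g y γ * (g y γ * g y γ) * sqd (A y γ) 1)
              + l⁻¹ * sqd (A y γ) 1) ∂μ := by
              refine lintegral_mono fun γ => ?_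
              simp only
              rw [← mul_assoc l, ← add_mul]
              exact mul_le_mul' (mul_self_le_add_inv _ _ h0 ht) le_rfl
          _ ≤ _ := by
              rw [lintegral_add_left h5, lintegral_const_mul _ h4, lintegral_const_mul _ hSy]
              exact add_le_add (mul_le_mul' le_rfl (hK y)) (mul_le_mul' le_rfl (hv y))
    _ = _ := by rw [lintegral_const]

end Averages

section MeanLimit

variable {d : ℕ} {s z ξ c ε : ℝ} {μ : Measure (Config d)}
  {k u : ∀ n : ℕ, (Fin n → EucSp d) → ℝ} {ψ f a : EucSp d → ℝ} {p : EucSp d → ℝ≥0∞}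

/-- The weight `exp[-(1-s) E(y,γ) + ⟨f,γ⟩]`. -/
def birthWt (s : ℝ) (ψ f : EucSp d → ℝ) (y : EucSp d) (γ : Config d) : ℝ≥0∞ :=
  ENNReal.ofReal (Real.exp (-((1 - s) * En ψ y γ) + cpair f γ))

/-- The birth rate of the limiting Glauber dynamics. -/
def birthMean (s z : ℝ) (ψ f : EucSp d → ℝ) (p : EucSp d → ℝ≥0∞) (γ : Config d) : ℝ≥0∞ :=
  ∫⁻ y, birthWt s ψ f y γ ∂(birthMeas z p)

/-- The average of `exp[-c E(·,γ)]` around `y` against the kernel `a_ε`. -/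
def farMean (ε c : ℝ) (ψ a : EucSp d → ℝ) (y : EucSp d) (γ : Config d) : ℝ≥0∞ :=
  ∫⁻ w, ENNReal.ofReal (Real.exp (-(c * En ψ (y + ε⁻¹ • w) γ))) ∂(kernMeas a)

lemma measurable_birthWt (hψ : Measurable ψ) (hf : Measurable f) :
    Measurable fun q : Config d × EucSp d => birthWt s ψ f q.2 q.1 :=
  (((measurable_En hψ measurable_fst measurable_snd).const_mul _).neg.add
    (measurable_cpair hf measurable_fst)).exp.ennreal_ofReal

lemma measurable_farMean (hψ : Measurable ψ) {α : Type*} [MeasurableSpace α]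
    {Γ : α → Config d} (hΓ : Measurable Γ) {X : α → EucSp d} (hX : Measurable X) :
    Measurable fun q => farMean ε c ψ a (X q) (Γ q) :=
  Measurable.lintegral_prod_right' (f := fun q : α × EucSp d =>
    ENNReal.ofReal (Real.exp (-(c * En ψ (X q.1 + ε⁻¹ • q.2) (Γ q.1)))))
    ((measurable_En hψ (hΓ.comp measurable_fst) ((hX.comp measurable_fst).add
      (measurable_snd.const_smul ε⁻¹))).const_mul c).neg.exp.ennreal_ofReal

lemma measurable_birthMean (hψ : Measurable ψ) (hf : Measurable f) :
    Measurable fun γ : Config d => birthMean s z ψ f p γ :=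
  (measurable_birthWt hψ hf).lintegral_prod_right'

lemma jumpMean_aScaled (hψ : Measurable ψ) (hf : Measurable f) (ha : GoodA a) (hp : Measurable p)
    (hε : 0 < ε) (γ : Config d) :
    jumpMean s z ψ f (fun x => ENNReal.ofReal (aScaled a ε x)) p γ
      = ∫⁻ y, birthWt s ψ f y γ * farMean ε (1 - s) ψ a y γ ∂(birthMeas z p) := by
  have hJ : Measurable fun X => jumpWt s ψ f X γ :=
    measurable_jumpWt hψ hf measurable_const measurable_id
  rw [jumpMean, jumpMeas_aScaled ha hp hε, lintegral_map hJ measurable_farPair]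
  have hJ2 : Measurable fun q => jumpWt s ψ f (farPair ε q) γ :=
    measurable_jumpWt hψ hf measurable_const measurable_farPair
  rw [lintegral_prod _ hJ2.aemeasurable]
  refine lintegral_congr fun y => ?_
  have hw : Measurable fun w => ENNReal.ofReal (Real.exp (-((1 - s) * En ψ (y + ε⁻¹ • w) γ))) :=
    ((measurable_En hψ measurable_const ((measurable_id.const_smul ε⁻¹).const_add y)).const_mul
      (1 - s)).neg.exp.ennreal_ofReal
  rw [farMean, ← lintegral_const_mul _ hw]
  refine lintegral_congr fun w => ?_
  rw [jumpWt, birthWt, ← ENNReal.ofReal_mul (Real.exp_pos _).le, ← Real.exp_add]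
  congr 2
  simp only [farPair]
  ring

lemma CorrData.exists_moment_birthWt (hk : CorrData μ k ξ) (hs0 : 0 ≤ s) (hs1 : s ≤ 1 / 2)
    (hψ : PotData ψ) (hf : IsC0 f) (ha : GoodA a) :
    ∃ K, K ≠ ⊤ ∧ ∀ ε y, ∫⁻ γ, birthWt s ψ f y γ * birthWt s ψ f y γ *
      (birthWt s ψ f y γ * birthWt s ψ f y γ) * sqd (farMean ε (1 - s) ψ a y γ) 1 ∂μ ≤ K := by
  have := hk.prob
  obtain ⟨C, hC, h⟩ := hk.exists_moment hψ hf
  have hafin := kernMeas_univ_ne_top ha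
  have m1 : 1 - s ∈ Icc (0 : ℝ) 4 := ⟨by linarith, by linarith⟩
  refine ⟨C * kernMeas a univ * kernMeas a univ + C, by finiteness, fun ε y => ?_⟩
  set h4 : Config d → ℝ≥0∞ := fun γ => ENNReal.ofReal
    (Real.exp (-(4 * (1 - s) * En ψ y γ) + 4 * cpair f γ)) with hh4
  have hm4 : Measurable h4 :=
    (((measurable_En hψ.meas measurable_id measurable_const).const_mul _).neg.add
      ((measurable_cpair hf.1.measurable measurable_id).const_mul 4)).exp.ennreal_ofReal
  have e4 : ∀ γ, birthWt s ψ f y γ * birthWt s ψ f y γ *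
      (birthWt s ψ f y γ * birthWt s ψ f y γ) = h4 γ := by
    intro γ
    simp only [birthWt, hh4]
    simp_rw [← ENNReal.ofReal_mul (Real.exp_pos _).le]
    rw [← ENNReal.ofReal_mul (by positivity)]
    simp_rw [← Real.exp_add]
    congr 2; ring
  have hA : Measurable fun γ => farMean ε (1 - s) ψ a y γ :=
    measurable_farMean hψ.meas measurable_id measurable_const
  have hAA : Measurable fun γ => h4 γ * (farMean ε (1 - s) ψ a y γ * farMean ε (1 - s) ψ a y γ) :=
    hm4.mul (hA.mul hA)
  have he : Measurable fun q : Config d × EucSp d =>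
      ENNReal.ofReal (Real.exp (-((1 - s) * En ψ (y + ε⁻¹ • q.2) q.1))) :=
    ((measurable_En hψ.meas measurable_fst
      ((measurable_snd.const_smul ε⁻¹).const_add y)).const_mul (1 - s)).neg.exp.ennreal_ofReal
  calc _ ≤ ∫⁻ γ, (h4 γ * (farMean ε (1 - s) ψ a y γ * farMean ε (1 - s) ψ a y γ) + h4 γ) ∂μ := by
        refine lintegral_mono fun γ => ?_
        simp only [e4]
        calc _ ≤ h4 γ * (farMean ε (1 - s) ψ a y γ * farMean ε (1 - s) ψ a y γ + 1 * 1) :=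
              mul_le_mul' le_rfl (sqd_le_add _ _)
          _ = _ := by rw [mul_add, one_mul, mul_one]
    _ ≤ _ := by
        rw [lintegral_add_left hAA]
        refine add_le_add ?_ ?_
        · simp only [farMean]
          rw [lintegral_mul_lintegral_sq (μ := μ) (ν := kernMeas a) (e := fun w γ =>
            ENNReal.ofReal (Real.exp (-((1 - s) * En ψ (y + ε⁻¹ • w) γ)))) hm4 he]
          calc _ ≤ ∫⁻ _, ∫⁻ _, C ∂(kernMeas a) ∂(kernMeas a) := by
                refine lintegral_mono fun w => lintegral_mono fun w' => ?_
                refine le_trans (le_of_eq (lintegral_congr fun γ => ?_))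
                  (h y (y + ε⁻¹ • w) (y + ε⁻¹ • w') 0 (4 * (1 - s)) _ _ 0 4
                    ⟨by linarith, by linarith⟩ m1 m1 (by norm_num) (by norm_num))
                simp only [hh4]
                simp_rw [← ENNReal.ofReal_mul (Real.exp_pos _).le]
                simp_rw [← Real.exp_add]
                congr 2; ring
            _ = _ := by simp only [lintegral_const]
        · refine le_trans (le_of_eq (lintegral_congr fun γ => ?_))
            (h y 0 0 0 (4 * (1 - s)) 0 0 0 4 ⟨by linarith, by linarith⟩ (by norm_num)
              (by norm_num) (by norm_num) (by norm_num))
          simp only [hh4]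
          congr 2; ring

end MeanLimit

section MeanLimit

variable {d : ℕ} {s z ξ c ε : ℝ} {μ : Measure (Config d)}
  {k u : ∀ n : ℕ, (Fin n → EucSp d) → ℝ} {ψ f a : EucSp d → ℝ} {p : EucSp d → ℝ≥0∞}

lemma measurable_exp_En_far (hψ : Measurable ψ) (y : EucSp d) :
    Measurable fun q : Config d × EucSp d =>
      ENNReal.ofReal (Real.exp (-(c * En ψ (y + ε⁻¹ • q.2) q.1))) :=
  ((measurable_En hψ measurable_fst
    ((measurable_snd.const_smul ε⁻¹).const_add y)).const_mul c).neg.exp.ennreal_ofReal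

lemma CorrData.lintegral_farMean (hk : CorrData μ k ξ) (hd : 0 < d) (hψ : PotData ψ)
    (hc : 0 ≤ c) (y : EucSp d) :
    ∫⁻ γ, farMean ε c ψ a y γ ∂μ
      = ENNReal.ofReal (Zexp k fun y => Real.exp (-(c * ψ y)) - 1) * kernMeas a univ := by
  have := hk.prob
  have e := lintegral_lintegral_comm_mul (μ := μ) (ν := kernMeas a) (h := fun _ => 1)
    (e := fun w γ => ENNReal.ofReal (Real.exp (-(c * En ψ (y + ε⁻¹ • w) γ))))
    measurable_const (measurable_exp_En_far hψ.meas y)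
  simp only [one_mul] at e
  simp only [farMean]
  rw [e, ← lintegral_const]
  exact lintegral_congr fun w => hk.lintegral_exp_En hd hψ hc _

lemma CorrData.lintegral_farMean_sq (hk : CorrData μ k ξ) (hd : 0 < d) (hψ : PotData ψ)
    (hc : 0 ≤ c) (y : EucSp d) :
    ∫⁻ γ, farMean ε c ψ a y γ * farMean ε c ψ a y γ ∂μ
      = ∫⁻ w, ∫⁻ w', ENNReal.ofReal (Zexp k fun y => (Real.exp (-(c * ψ y)) - 1)
        + shiftG (fun y => Real.exp (-(c * ψ y)) - 1) (0 + ε⁻¹ • (w' - w)) y)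
        ∂(kernMeas a) ∂(kernMeas a) := by
  have := hk.prob
  have e := lintegral_mul_lintegral_sq (μ := μ) (ν := kernMeas a) (h := fun _ => 1)
    (e := fun w γ => ENNReal.ofReal (Real.exp (-(c * En ψ (y + ε⁻¹ • w) γ))))
    measurable_const (measurable_exp_En_far hψ.meas y)
  simp only [one_mul] at e
  simp only [farMean]
  rw [e]
  refine lintegral_congr fun w => lintegral_congr fun w' => ?_
  rw [hk.lintegral_exp_En_two hd hψ hc,
    show y + ε⁻¹ • w' - (y + ε⁻¹ • w) = 0 + ε⁻¹ • (w' - w) by module]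

lemma CorrData.measurable_Zexp_two (hk : CorrData μ k ξ) (hd : 0 < d) (hψ : PotData ψ)
    (hc : 0 ≤ c) :
    Measurable fun v : EucSp d => ENNReal.ofReal (Zexp k fun y => (Real.exp (-(c * ψ y)) - 1)
        + shiftG (fun y => Real.exp (-(c * ψ y)) - 1) v y) := by
  have := hk.prob
  have e : ∀ v : EucSp d, ENNReal.ofReal (Zexp k fun y => (Real.exp (-(c * ψ y)) - 1)
        + shiftG (fun y => Real.exp (-(c * ψ y)) - 1) v y)
      = ∫⁻ γ, ENNReal.ofReal (Real.exp (-(c * En ψ 0 γ)))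
        * ENNReal.ofReal (Real.exp (-(c * En ψ v γ))) ∂μ := by
    intro v
    rw [hk.lintegral_exp_En_two hd hψ hc, sub_zero]
  simp_rw [e]
  refine Measurable.lintegral_prod_right' (f := fun q : EucSp d × Config d =>
    ENNReal.ofReal (Real.exp (-(c * En ψ 0 q.2))) * ENNReal.ofReal (Real.exp (-(c * En ψ q.1 q.2))))
    ?_
  exact (((measurable_En hψ.meas measurable_snd measurable_const).const_mul c).neg.exp.ennreal_ofReal).mul
    (((measurable_En hψ.meas measurable_snd measurable_fst).const_mul c).neg.exp.ennreal_ofReal)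

lemma CorrData.tendsto_lintegral_Zexp (hk : CorrData μ k ξ) (hu : UrsellData k u) (hd : 0 < d)
    (hψ : PotData ψ) (hc : 0 ≤ c) (hc2 : c ≤ 4) (ha : GoodA a) :
    Tendsto (fun ε : ℝ => ∫⁻ w, ∫⁻ w', ENNReal.ofReal (Zexp k fun y => (Real.exp (-(c * ψ y)) - 1)
        + shiftG (fun y => Real.exp (-(c * ψ y)) - 1) (0 + ε⁻¹ • (w' - w)) y)
        ∂(kernMeas a) ∂(kernMeas a)) (𝓝[>] 0)
      (𝓝 (ENNReal.ofReal ((Zexp k fun y => Real.exp (-(c * ψ y)) - 1) ^ 2)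
        * (kernMeas a univ * kernMeas a univ))) := by
  have := hk.prob
  set ν := kernMeas a with hν
  have hνt : ν univ ≠ ⊤ := kernMeas_univ_ne_top ha
  set Q : EucSp d → ℝ≥0∞ := fun v => ENNReal.ofReal (Zexp k fun y => (Real.exp (-(c * ψ y)) - 1)
        + shiftG (fun y => Real.exp (-(c * ψ y)) - 1) v y) with hQ
  have hQm : Measurable Q := hk.measurable_Zexp_two hd hψ hc
  obtain ⟨C, hC, hmom⟩ := hk.exists_moment (f := fun _ => 0) hψ
    ⟨continuous_const, HasCompactSupport.zero⟩
  have hQC : ∀ v, Q v ≤ C := by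
    intro v
    simp only [hQ]
    have e := hk.lintegral_exp_En_two hd hψ hc 0 v
    rw [sub_zero] at e
    rw [← e]
    refine le_trans (le_of_eq (lintegral_congr fun γ => ?_))
      (hmom 0 v 0 0 c c 0 0 0 ⟨hc, hc2⟩ ⟨hc, hc2⟩ (by norm_num) (by norm_num) (by norm_num))
    rw [← ENNReal.ofReal_mul (Real.exp_pos _).le, ← Real.exp_add]
    congr 2; ring
  have hQe : ∀ ε : ℝ, Measurable fun r : EucSp d × EucSp d => Q (0 + ε⁻¹ • (r.2 - r.1)) :=
    fun ε => hQm.comp (((measurable_snd.sub measurable_fst).const_smul ε⁻¹).const_add 0)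
  have e1 : ∀ ε : ℝ, ∫⁻ w, ∫⁻ w', Q (0 + ε⁻¹ • (w' - w)) ∂ν ∂ν
      = ∫⁻ r : EucSp d × EucSp d, Q (0 + ε⁻¹ • (r.2 - r.1)) ∂(ν.prod ν) := fun ε =>
    (lintegral_prod _ (hQe ε).aemeasurable).symm
  have e2 : ENNReal.ofReal ((Zexp k fun y => Real.exp (-(c * ψ y)) - 1) ^ 2) * (ν univ * ν univ)
      = ∫⁻ _, ENNReal.ofReal ((Zexp k fun y => Real.exp (-(c * ψ y)) - 1) ^ 2) ∂(ν.prod ν) := by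
    rw [lintegral_const, ← univ_prod_univ, Measure.prod_prod]
  rw [e2]
  refine Tendsto.congr (fun ε => (e1 ε).symm) ?_
  refine tendsto_lintegral_filter_of_dominated_convergence (fun _ => C)
    (Eventually.of_forall hQe) (Eventually.of_forall fun ε => ae_of_all _ fun r => hQC _) ?_ ?_
  · rw [lintegral_const, ← univ_prod_univ, Measure.prod_prod]; finiteness
  · have h3 : ∀ᵐ r ∂(ν.prod ν), r.1 ≠ r.2 := by
      refine (Measure.ae_prod_iff_ae_ae ?_).2 (ae_of_all _ fun q => ?_)
      · exact (measurableSet_eq_fun measurable_fst measurable_snd).compl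
      · filter_upwards [ae_ne_kernMeas hd q] with q' hq' using hq'.symm
    filter_upwards [h3] with r hr
    exact ENNReal.tendsto_ofReal ((hk.tendsto_Zexp hu (hψ.mayer hc)).comp
      (tendsto_far 0 (sub_ne_zero.2 hr.symm)))

/-- The mean square deviation of `farMean` from `1` is independent of the centre and vanishes. -/
lemma CorrData.exists_tendsto_sqd_farMean (hk : CorrData μ k ξ) (hu : UrsellData k u) (hd : 0 < d)
    (hψ : PotData ψ) (hc : 0 ≤ c) (hc2 : c ≤ 4) (ha : GoodA a)
    (hZ : ENNReal.ofReal (Zexp k fun y => Real.exp (-(c * ψ y)) - 1) * kernMeas a univ = 1) :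
    ∃ v : ℝ → ℝ≥0∞, Tendsto v (𝓝[>] 0) (𝓝 0) ∧
      ∀ ε y, ∫⁻ γ, sqd (farMean ε c ψ a y γ) 1 ∂μ ≤ v ε := by
  have := hk.prob
  have hl := hk.tendsto_lintegral_Zexp hu hd hψ hc hc2 ha
  have h1 : ENNReal.ofReal ((Zexp k fun y => Real.exp (-(c * ψ y)) - 1) ^ 2)
        * (kernMeas a univ * kernMeas a univ) = 1 := by
    have hpos : 0 ≤ Zexp k fun y => Real.exp (-(c * ψ y)) - 1 := by
      by_contra hneg
      rw [ENNReal.ofReal_of_nonpos (not_le.1 hneg).le, zero_mul] at hZ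
      exact zero_ne_one hZ
    rw [sq, ENNReal.ofReal_mul hpos, mul_mul_mul_comm, hZ, one_mul]
  rw [h1] at hl
  refine ⟨fun ε => (∫⁻ w, ∫⁻ w', ENNReal.ofReal (Zexp k fun y => (Real.exp (-(c * ψ y)) - 1)
        + shiftG (fun y => Real.exp (-(c * ψ y)) - 1) (0 + ε⁻¹ • (w' - w)) y)
        ∂(kernMeas a) ∂(kernMeas a)) + 1 - 2, ?_, fun ε y => ?_⟩
  rotate_left
  · refine le_of_eq ?_
    have hA : Measurable fun γ => farMean ε c ψ a y γ :=
      measurable_farMean hψ.meas measurable_id measurable_const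
    have hS : Measurable fun γ => sqd (farMean ε c ψ a y γ) 1 :=
      measurable_sqd hA measurable_const
    have hAA : Measurable fun γ => farMean ε c ψ a y γ * farMean ε c ψ a y γ := hA.mul hA
    have hadd : ∫⁻ γ, sqd (farMean ε c ψ a y γ) 1 ∂μ + 2 =
        (∫⁻ γ, farMean ε c ψ a y γ * farMean ε c ψ a y γ ∂μ) + 1 := by
      have e2 : (2 : ℝ≥0∞) = ∫⁻ γ, 2 * farMean ε c ψ a y γ ∂μ := by
        rw [lintegral_const_mul _ hA, hk.lintegral_farMean hd hψ hc, hZ, mul_one]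
      have e3 : (1 : ℝ≥0∞) = ∫⁻ _, 1 ∂μ := by simp
      rw [e2]
      conv_rhs => rw [e3]
      rw [← lintegral_add_left hS, ← lintegral_add_left hAA]
      refine lintegral_congr fun γ => ?_
      have := sqd_add_two_mul (farMean ε c ψ a y γ) 1
      rwa [mul_one, mul_one] at this
    rw [hk.lintegral_farMean_sq hd hψ hc] at hadd
    exact ENNReal.eq_sub_of_add_eq ENNReal.ofNat_ne_top hadd
  · have := ENNReal.Tendsto.sub (hl.add (tendsto_const_nhds (x := (1 : ℝ≥0∞))))
      (tendsto_const_nhds (x := (2 : ℝ≥0∞))) (Or.inr ENNReal.ofNat_ne_top)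
    rwa [one_add_one_eq_two, tsub_self] at this

lemma tendsto_zero_of_forall_le {ι : Type*} {l : Filter ι} {G v : ι → ℝ≥0∞} {R K : ℝ≥0∞}
    (hR : R ≠ ⊤) (hK : K ≠ ⊤) (hv : Tendsto v l (𝓝 0))
    (h : ∀ᶠ i in l, ∀ t, t ≠ 0 → t ≠ ⊤ → G i ≤ R * (t * K + t⁻¹ * v i)) :
    Tendsto G l (𝓝 0) := by
  rw [ENNReal.tendsto_nhds_zero]
  intro η hη
  by_cases hηt : η = ⊤
  · exact Eventually.of_forall fun _ => hηt ▸ le_top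
  have h2 : η / 2 ≠ 0 := by simpa using hη.ne'
  have hR1 : R + 1 ≠ ⊤ := by finiteness
  have hK1 : K + 1 ≠ ⊤ := by finiteness
  set t := η / 2 / ((R + 1) * (K + 1)) with ht
  have ht0 : t ≠ 0 := (ENNReal.div_pos h2 (by finiteness)).ne'
  have htt : t ≠ ⊤ := ENNReal.div_ne_top (ENNReal.div_ne_top hηt (by norm_num))
    (by simp)
  have htv : Tendsto (fun i => R * (t⁻¹ * v i)) l (𝓝 0) := by
    have := ENNReal.Tendsto.const_mul (ENNReal.Tendsto.const_mul hv
      (Or.inr (ENNReal.inv_ne_top.2 ht0))) (Or.inr hR)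
    simpa using this
  filter_upwards [h, ENNReal.tendsto_nhds_zero.1 htv (η / 2) (pos_iff_ne_zero.2 h2)] with i hi hvi
  refine (hi t ht0 htt).trans ?_
  rw [mul_add, ← ENNReal.add_halves η]
  refine add_le_add ?_ hvi
  calc R * (t * K) = t * (R * K) := by ring
    _ ≤ t * ((R + 1) * (K + 1)) := by gcongr <;> exact le_self_add
    _ ≤ η / 2 := ENNReal.mul_le_of_le_div le_rfl

lemma tendsto_lintegral_sqd_jumpMean (hk : CorrData μ k ξ) (hu : UrsellData k u) (hd : 0 < d)
    (hs0 : 0 ≤ s) (hs1 : s ≤ 1 / 2) (hψ : PotData ψ) (hf : IsC0 f) (ha : GoodA a)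
    (hp : Measurable p) (hpt : ∫⁻ y, p y ≠ ⊤)
    (hZ : ENNReal.ofReal (Zexp k fun y => Real.exp (-((1 - s) * ψ y)) - 1) * kernMeas a univ = 1) :
    Tendsto (fun ε => ∫⁻ γ, sqd
      (jumpMean s z ψ f (fun x => ENNReal.ofReal (aScaled a ε x)) p γ)
      (birthMean s z ψ f p γ) ∂μ) (𝓝[>] 0) (𝓝 0) := by
  have := hk.prob
  have hfin : birthMeas z p univ ≠ ⊤ := by rw [birthMeas_univ]; finiteness
  obtain ⟨v, hv, hvb⟩ := hk.exists_tendsto_sqd_farMean hu hd hψ (c := 1 - s) (by linarith)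
    (by linarith) ha hZ
  obtain ⟨K, hK, hKb⟩ := hk.exists_moment_birthWt hs0 hs1 hψ hf ha
  refine tendsto_zero_of_forall_le (R := 2 * birthMeas z p univ * birthMeas z p univ)
    (by finiteness) hK hv ?_
  filter_upwards [self_mem_nhdsWithin] with ε hε t ht0 htt
  have hε' : 0 < ε := hε
  simp_rw [jumpMean_aScaled hψ.meas hf.1.measurable ha hp hε', birthMean]
  refine (lintegral_sqd_average_le (measurable_birthWt hψ.meas hf.1.measurable)
    (measurable_farMean hψ.meas measurable_fst measurable_snd) ht0 htt (hKb ε) (hvb ε)).trans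
    (le_of_eq ?_)
  ring

end MeanLimit

lemma ne_top_of_sqd_ne_top {a b : ℝ≥0∞} (h : sqd a b ≠ ⊤) (hb : b ≠ ⊤) : a ≠ ⊤ := by
  rintro rfl
  exact h (by simp [sqd, ENNReal.top_sub hb])

lemma integral_mul_eq_toReal_sub {α : Type*} [MeasurableSpace α] {ν : Measure α} {w h : α → ℝ}
    (hw : Measurable w) (hh : Measurable h) (hw0 : ∀ x, 0 ≤ w x)
    (hP : ∫⁻ x, ENNReal.ofReal (w x) * ENNReal.ofReal (h x) ∂ν ≠ ⊤)
    (hN : ∫⁻ x, ENNReal.ofReal (w x) * ENNReal.ofReal (-h x) ∂ν ≠ ⊤) :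
    ∫ x, w x * h x ∂ν = (∫⁻ x, ENNReal.ofReal (w x) * ENNReal.ofReal (h x) ∂ν).toReal
      - (∫⁻ x, ENNReal.ofReal (w x) * ENNReal.ofReal (-h x) ∂ν).toReal := by
  have hm : Measurable fun x => ENNReal.ofReal (w x) * ENNReal.ofReal (h x) :=
    hw.ennreal_ofReal.mul hh.ennreal_ofReal
  have hi : Integrable (fun x => w x * h x) ν := by
    refine ⟨(hw.mul hh).aestronglyMeasurable, ?_⟩
    rw [HasFiniteIntegral]
    have hlt := lt_top_iff_ne_top.2 (ENNReal.add_ne_top.2 ⟨hP, hN⟩)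
    rw [← lintegral_add_left hm] at hlt
    refine lt_of_le_of_lt (lintegral_mono fun x => ?_) hlt
    rw [← mul_add, enorm_mul, Real.enorm_of_nonneg (hw0 x), Real.enorm_eq_ofReal_abs]
    refine mul_le_mul' le_rfl ?_
    rcases le_total 0 (h x) with h0 | h0
    · rw [abs_of_nonneg h0]; exact le_self_add
    · rw [abs_of_nonpos h0]; exact le_add_self
  rw [integral_eq_lintegral_pos_part_sub_lintegral_neg_part hi]
  congr 2
  · exact lintegral_congr fun x => ENNReal.ofReal_mul (hw0 x)
  · refine lintegral_congr fun x => ?_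
    rw [← mul_neg, ENNReal.ofReal_mul (hw0 x)]

lemma tsum_toReal_sub {ι : Type*} {P N : ι → ℝ≥0∞} (hP : ∑' i, P i ≠ ⊤) (hN : ∑' i, N i ≠ ⊤) :
    ∑' i, ((P i).toReal - (N i).toReal) = (∑' i, P i).toReal - (∑' i, N i).toReal := by
  rw [(ENNReal.summable_toReal hP).tsum_sub (ENNReal.summable_toReal hN),
    ENNReal.tsum_toReal_eq (ENNReal.ne_top_of_tsum_ne_top hP),
    ENNReal.tsum_toReal_eq (ENNReal.ne_top_of_tsum_ne_top hN)]

lemma rexp_coe (t : ℝ) : rexp (t : EReal) = Real.exp t := by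
  rw [rexp, eexp, if_neg (EReal.coe_ne_top _), if_neg (EReal.coe_ne_bot _), EReal.toReal_coe,
    ENNReal.toReal_ofReal (Real.exp_pos _).le]

section Identify

variable {d : ℕ} {s z ξ ε : ℝ} {μ : Measure (Config d)} {φ : EucSp d → EReal}
  {k u : ∀ n : ℕ, (Fin n → EucSp d) → ℝ} {ψ f a : EucSp d → ℝ} {p : EucSp d → ℝ≥0∞}

/-- The positive part of `e^f - 1`. -/
def gainPos (f : EucSp d → ℝ) (y : EucSp d) : ℝ≥0∞ := ENNReal.ofReal (Real.exp (f y) - 1)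

/-- The negative part of `e^f - 1`. -/
def gainNeg (f : EucSp d → ℝ) (y : EucSp d) : ℝ≥0∞ := ENNReal.ofReal (-(Real.exp (f y) - 1))

lemma measurable_gainPos (hf : IsC0 f) : Measurable (gainPos f) :=
  (hf.1.measurable.exp.sub_const 1).ennreal_ofReal

lemma measurable_gainNeg (hf : IsC0 f) : Measurable (gainNeg f) :=
  (hf.1.measurable.exp.sub_const 1).neg.ennreal_ofReal

lemma lintegral_gain_ne_top (hf : IsC0 f) :
    ∫⁻ y, gainPos f y ≠ ⊤ ∧ ∫⁻ y, gainNeg f y ≠ ⊤ := by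
  have hc : Continuous fun y => Real.exp (f y) - 1 := by have := hf.1; fun_prop
  have hs : HasCompactSupport fun y => Real.exp (f y) - 1 :=
    hf.2.comp_left (g := fun t => Real.exp t - 1) (by simp)
  have hi := hc.integrable_of_hasCompactSupport (μ := volume) hs
  exact ⟨hi.lintegral_lt_top.ne, hi.neg.lintegral_lt_top.ne⟩

lemma Dplus_exp_cpair (hf : IsC0 f) {γ : Config d} {y : EucSp d} (hy : y ∉ γ.1) :
    Dplus (fun γ' => Real.exp (cpair f γ')) y γ
      = Real.exp (cpair f γ) * (Real.exp (f y) - 1) := by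
  simp only [Dplus]
  rw [cpair_ins hf.2 hy, Real.exp_add]
  ring

lemma RealGNZ.ae_good_del (hG : RealGNZ z ψ μ) (hψ : PotData ψ)
    (hgood : ∀ᵐ γ ∂μ, ∀ᵐ x, Good ψ x γ) : ∀ᵐ γ ∂μ, ∀ x : γ.1, Good ψ x.1 (γ.del x.1) := by
  have hset : MeasurableSet {q : Config d × EucSp d | ¬ Good ψ q.2 (q.1.del q.2)} :=
    (measurableSet_good hψ.meas measurable_del measurable_snd).compl
  set F : Config d → EucSp d → ℝ≥0∞ := fun γ x =>
    {q : Config d × EucSp d | ¬ Good ψ q.2 (q.1.del q.2)}.indicator 1 (γ, x) with hF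
  have hFm : Measurable (Function.uncurry F) := measurable_one.indicator hset
  have h0 : ∫⁻ γ, ∑' x : γ.1, F γ x.1 ∂μ = 0 := by
    rw [hG F hFm]
    refine (lintegral_congr_ae (g := fun _ => 0) ?_).trans lintegral_zero
    filter_upwards [hgood] with γ hγ
    refine (lintegral_congr_ae (g := fun _ => 0) ?_).trans lintegral_zero
    filter_upwards [hγ] with x hx
    have : F (γ.ins x) x = 0 := by
      simp only [hF]
      refine indicator_of_notMem ?_ _
      simp only [mem_ofPred_eq, not_not]
      rw [del_ins γ hx.1]
      exact hx
    rw [this, mul_zero]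
  have hm : Measurable fun γ : Config d => ∑' x : γ.1, F γ x.1 :=
    measurable_tsum_config measurable_id (G := F) hFm
  filter_upwards [(lintegral_eq_zero_iff hm).1 h0] with γ hγ x
  have h1 := ENNReal.tsum_eq_zero.1 hγ x
  by_contra hx
  have h2 : F γ x.1 = 1 := indicator_of_mem (s := {q : Config d × EucSp d |
    ¬ Good ψ q.2 (q.1.del q.2)}) (a := (γ, x.1)) hx 1
  rw [h2] at h1
  exact one_ne_zero h1

lemma integral_jump_eq (hp : IsPairPotential φ) (hψ : PotData (psi φ)) (hf : IsC0 f) (ha : GoodA a)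
    (hε : 0 < ε) {γ : Config d} {x : EucSp d} (hx : Good (psi φ) x γ)
    (hy : ∀ᵐ y, Good (psi φ) y γ)
    (hP : jumpRate s (psi φ) f (fun x => ENNReal.ofReal (aScaled a ε x)) (gainPos f) x γ ≠ ⊤)
    (hN : jumpRate s (psi φ) f (fun x => ENNReal.ofReal (aScaled a ε x)) (gainNeg f) x γ ≠ ⊤) :
    ∫ y, aScaled a ε (x - y) * rexp ((s : EReal) * energy φ x γ.1 +
        ((s - 1 : ℝ) : EReal) * energy φ y γ.1) * Dplus (fun γ' => Real.exp (cpair f γ')) y γ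
      = (jumpRate s (psi φ) f (fun x => ENNReal.ofReal (aScaled a ε x)) (gainPos f) x γ).toReal
        - (jumpRate s (psi φ) f (fun x => ENNReal.ofReal (aScaled a ε x)) (gainNeg f) x γ).toReal := by
  set w : EucSp d → ℝ := fun y => aScaled a ε (x - y) *
    Real.exp (s * En (psi φ) x γ - (1 - s) * En (psi φ) y γ + cpair f γ) with hw
  have ham : Measurable fun y => aScaled a ε (x - y) :=
    (ha.meas.comp ((measurable_id.const_sub x).const_smul ε)).const_mul (ε ^ d)
  have ha0 : ∀ y, 0 ≤ aScaled a ε y := fun y => mul_nonneg (by positivity) (ha.nonneg _)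
  have hwm : Measurable w := ham.mul
    ((((measurable_En hψ.meas measurable_const measurable_id).const_mul (1 - s)).const_sub _).add_const
      _).exp
  have hw0 : ∀ y, 0 ≤ w y := fun y => mul_nonneg (ha0 _) (Real.exp_pos _).le
  have e : ∀ g : EucSp d → ℝ≥0∞, ∫⁻ y, ENNReal.ofReal (w y) * g y
      = jumpRate s (psi φ) f (fun x => ENNReal.ofReal (aScaled a ε x)) g x γ := by
    intro g
    refine lintegral_congr fun y => ?_
    rw [hw, ENNReal.ofReal_mul (ha0 _)]
    ring
  have key := integral_mul_eq_toReal_sub (ν := volume) hwm (hf.1.measurable.exp.sub_const 1) hw0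
    (by exact (e (gainPos f)).trans_ne hP) (by exact (e (gainNeg f)).trans_ne hN)
  rw [← e, ← e]
  refine Eq.trans (integral_congr_ae ?_) key
  filter_upwards [hy] with y hgy
  rw [hx.energy_eq hp, hgy.energy_eq hp, Dplus_exp_cpair hf hgy.1, ← EReal.coe_mul, ← EReal.coe_mul,
    ← EReal.coe_add, rexp_coe, hw]
  simp only
  rw [Real.exp_add (s * En (psi φ) x γ - (1 - s) * En (psi φ) y γ) (cpair f γ),
    show s * En (psi φ) x γ + (s - 1) * En (psi φ) y γ
      = s * En (psi φ) x γ - (1 - s) * En (psi φ) y γ by ring]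
  ring

lemma HepsPlus_eq (hp : IsPairPotential φ) (hψ : PotData (psi φ)) (hf : IsC0 f) (ha : GoodA a)
    (hε : 0 < ε) {γ : Config d} (hx : ∀ x : γ.1, Good (psi φ) x.1 (γ.del x.1))
    (hy : ∀ᵐ y, Good (psi φ) y γ)
    (hP : jumpSum s (psi φ) f (fun x => ENNReal.ofReal (aScaled a ε x)) (gainPos f) γ ≠ ⊤)
    (hN : jumpSum s (psi φ) f (fun x => ENNReal.ofReal (aScaled a ε x)) (gainNeg f) γ ≠ ⊤) :
    HepsPlus s (aScaled a ε) φ (fun γ' => Real.exp (cpair f γ')) γ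
      = -((jumpSum s (psi φ) f (fun x => ENNReal.ofReal (aScaled a ε x)) (gainPos f) γ).toReal
        - (jumpSum s (psi φ) f (fun x => ENNReal.ofReal (aScaled a ε x)) (gainNeg f) γ).toReal) := by
  rw [jumpSum] at hP hN
  have key := fun x : γ.1 => integral_jump_eq hp hψ hf ha hε (hx x) (hy.mono fun y h => h.del x.1)
    (ENNReal.ne_top_of_tsum_ne_top hP x) (ENNReal.ne_top_of_tsum_ne_top hN x)
  have hsum := (tsum_congr key).trans (tsum_toReal_sub hP hN)
  rw [HepsPlus, jumpSum, jumpSum]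
  exact congrArg Neg.neg hsum

lemma H0Plus_eq (hp : IsPairPotential φ) (hψ : PotData (psi φ)) (hf : IsC0 f) (hz : 0 ≤ z)
    {γ : Config d} (hy : ∀ᵐ y, Good (psi φ) y γ)
    (hP : birthMean s z (psi φ) f (gainPos f) γ ≠ ⊤)
    (hN : birthMean s z (psi φ) f (gainNeg f) γ ≠ ⊤) :
    H0Plus s z φ (fun γ' => Real.exp (cpair f γ')) γ
      = -((birthMean s z (psi φ) f (gainPos f) γ).toReal
        - (birthMean s z (psi φ) f (gainNeg f) γ).toReal) := by
  set w : EucSp d → ℝ := fun y => z *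
    Real.exp (-((1 - s) * En (psi φ) y γ) + cpair f γ) with hw
  have hEm : Measurable fun y => Real.exp (-((1 - s) * En (psi φ) y γ) + cpair f γ) :=
    (((measurable_En hψ.meas measurable_const measurable_id).const_mul (1 - s)).neg.add_const _).exp
  have hwm : Measurable w := hEm.const_mul z
  have hw0 : ∀ y, 0 ≤ w y := fun y => mul_nonneg hz (Real.exp_pos _).le
  have e : ∀ g : EucSp d → ℝ≥0∞, Measurable g → ∫⁻ y, ENNReal.ofReal (w y) * g y
      = birthMean s z (psi φ) f g γ := by
    intro g hg
    have hzg : Measurable fun y => ENNReal.ofReal z * g y := hg.const_mul _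
    have hb : Measurable fun y => birthWt s (psi φ) f y γ := hEm.ennreal_ofReal
    rw [birthMean, birthMeas, lintegral_withDensity_eq_lintegral_mul _ hzg hb]
    refine lintegral_congr fun y => ?_
    simp only [Pi.mul_apply, birthWt]
    rw [hw, ENNReal.ofReal_mul hz]
    ring
  have eP := e _ (measurable_gainPos hf)
  have eN := e _ (measurable_gainNeg hf)
  have key := integral_mul_eq_toReal_sub (ν := volume) hwm (hf.1.measurable.exp.sub_const 1) hw0
    (by exact eP.trans_ne hP) (by exact eN.trans_ne hN)
  rw [← eP, ← eN, H0Plus]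
  refine congrArg Neg.neg (Eq.trans (integral_congr_ae ?_) key)
  filter_upwards [hy] with y hgy
  rw [hgy.energy_eq hp, Dplus_exp_cpair hf hgy.1, ← EReal.coe_mul, rexp_coe, hw]
  simp only
  rw [Real.exp_add (-((1 - s) * En (psi φ) y γ)) (cpair f γ),
    show (s - 1) * En (psi φ) y γ = -((1 - s) * En (psi φ) y γ) by ring]
  ring

end Identify

lemma ofReal_sub_sq_le {a b c e : ℝ≥0∞} (ha : a ≠ ⊤) (hb : b ≠ ⊤) (hc : c ≠ ⊤) (he : e ≠ ⊤) :
    ENNReal.ofReal ((-(a.toReal - b.toReal) - -(c.toReal - e.toReal)) ^ 2)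
      ≤ 2 * sqd a c + 2 * sqd b e := by
  rw [← ofReal_sub_sq ha hc, ← ofReal_sub_sq hb he,
    show (2 : ℝ≥0∞) = ENNReal.ofReal 2 by simp, ← ENNReal.ofReal_mul zero_le_two,
    ← ENNReal.ofReal_mul zero_le_two, ← ENNReal.ofReal_add (by positivity) (by positivity)]
  refine ENNReal.ofReal_le_ofReal ?_
  nlinarith [sq_nonneg (a.toReal - c.toReal + (b.toReal - e.toReal))]

lemma tendsto_integral_sq_of_le {α : Type*} [MeasurableSpace α] {μ : Measure α} {l : Filter ℝ}
    {D : ℝ → α → ℝ} {G : ℝ → ℝ≥0∞} (hG : Tendsto G l (𝓝 0))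
    (h : ∀ᶠ ε in l, ∫⁻ γ, ENNReal.ofReal (D ε γ ^ 2) ∂μ ≤ G ε) :
    Tendsto (fun ε => ∫ γ, D ε γ ^ 2 ∂μ) l (𝓝 0) := by
  have hr : Tendsto (fun ε => (G ε).toReal) l (𝓝 0) := by
    have := (ENNReal.tendsto_toReal ENNReal.zero_ne_top).comp hG
    rwa [ENNReal.toReal_zero] at this
  refine tendsto_of_tendsto_of_tendsto_of_le_of_le' tendsto_const_nhds hr
    (Eventually.of_forall fun ε => integral_nonneg fun γ => sq_nonneg _) ?_
  filter_upwards [h, hG.eventually_lt_const ENNReal.zero_lt_top] with ε hε hlt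
  refine (Real.le_norm_self _).trans ((norm_integral_le_lintegral_norm _).trans ?_)
  simp only [Real.norm_eq_abs, abs_sq]
  exact ENNReal.toReal_mono hlt.ne hε

section Conclusion

variable {d : ℕ} {s z ξ B : ℝ} {μ : Measure (Config d)} {φ : EucSp d → EReal}
  {k u : ∀ n : ℕ, (Fin n → EucSp d) → ℝ} {ψ f a : EucSp d → ℝ} {p : EucSp d → ℝ≥0∞}

lemma CorrData.ae_birthMean_ne_top (hk : CorrData μ k ξ) (hs0 : 0 ≤ s) (hs1 : s ≤ 1 / 2)
    (hψ : PotData ψ) (hf : IsC0 f) (hpt : ∫⁻ y, p y ≠ ⊤) :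
    ∀ᵐ γ ∂μ, birthMean s z ψ f p γ ≠ ⊤ := by
  have := hk.prob
  have hfin : birthMeas z p univ ≠ ⊤ := by rw [birthMeas_univ]; finiteness
  obtain ⟨C, hC, h⟩ := hk.exists_moment hψ hf
  have hm := measurable_birthMean (s := s) (z := z) (p := p) hψ.meas hf.1.measurable
  have hle : ∫⁻ γ, birthMean s z ψ f p γ ∂μ ≤ C * birthMeas z p univ := by
    simp only [birthMean]
    rw [lintegral_lintegral_swap (measurable_birthWt hψ.meas hf.1.measurable).aemeasurable,
      ← lintegral_const]
    refine lintegral_mono fun y => le_trans (le_of_eq (lintegral_congr fun γ => ?_))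
      (h y 0 0 0 (1 - s) 0 0 0 1 ⟨by linarith, by linarith⟩ (by norm_num)
        (by norm_num) (by norm_num) (by norm_num))
    rw [birthWt]
    congr 2; ring
  have hne : ∫⁻ γ, birthMean s z ψ f p γ ∂μ ≠ ⊤ := (hle.trans_lt (by finiteness)).ne
  filter_upwards [ae_lt_top hm hne] with γ hγ using hγ.ne

lemma Setting.normalization (h : Setting d s z B ξ φ μ k u) (hvan : PhiVanishes φ) (ha : GoodA a)
    (hnorm : NormalizedA s a φ μ) :
    ENNReal.ofReal (Zexp (normK k) fun y => Real.exp (-((1 - s) * psi φ y)) - 1)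
      * kernMeas a univ = 1 := by
  have := h.prob
  have hk := h.corrData
  have hψ := h.potData hvan
  have hs : 0 ≤ 1 - s := by linarith [h.hs1]
  have hm : Measurable fun γ : Config d => Real.exp (-((1 - s) * En (psi φ) 0 γ)) :=
    ((measurable_En hψ.meas measurable_id measurable_const).const_mul _).neg.exp
  have e1 : ∫ γ, rexp (((s - 1 : ℝ) : EReal) * totPhi φ γ.1) ∂μ
      = ∫ γ, Real.exp (-((1 - s) * En (psi φ) 0 γ)) ∂μ := by
    refine integral_congr_ae ?_
    filter_upwards [hk.ae_good h.hd hψ 0] with γ hγ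
    rw [hγ.totPhi_eq h.pp hψ, ← EReal.coe_mul, rexp_coe]
    congr 1; ring
  have e2 := hk.lintegral_exp_En h.hd hψ hs 0
  have hi : Integrable (fun γ => Real.exp (-((1 - s) * En (psi φ) 0 γ))) μ := by
    refine ⟨hm.aestronglyMeasurable, ?_⟩
    rw [hasFiniteIntegral_iff_ofReal (ae_of_all _ fun γ => (Real.exp_pos _).le), e2]
    exact ENNReal.ofReal_lt_top
  have e3 := ofReal_integral_eq_lintegral_ofReal hi (ae_of_all _ fun γ => (Real.exp_pos _).le)
  have hpos : 0 < ∫ γ, Real.exp (-((1 - s) * En (psi φ) 0 γ)) ∂μ := integral_exp_pos hi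
  rw [← e2, ← e3, kernMeas_univ ha, hnorm, e1, ← ENNReal.ofReal_mul hpos.le,
    mul_inv_cancel₀ hpos.ne', ENNReal.ofReal_one]

lemma Setting.tendsto_lintegral_sqd (h : Setting d s z B ξ φ μ k u) (hvan : PhiVanishes φ)
    (ha : GoodA a) (hnorm : NormalizedA s a φ μ) (hf : IsC0 f) (hp : Measurable p)
    (hpt : ∫⁻ y, p y ≠ ⊤) :
    Tendsto (fun ε => ∫⁻ γ, sqd
      (jumpSum s (psi φ) f (fun x => ENNReal.ofReal (aScaled a ε x)) p γ)
      (birthMean s z (psi φ) f p γ) ∂μ) (𝓝[>] 0) (𝓝 0) := by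
  have hψ := h.potData hvan
  have t1 := tendsto_lintegral_sqd_jumpSum (s := s) h.corrData (h.realGNZ hvan) h.hd h.hs0 h.hs1
    hψ hf ha hp hpt
  have t2 := tendsto_lintegral_sqd_jumpMean (z := z) h.corrData h.ursellData h.hd h.hs0 h.hs1 hψ
    hf ha hp hpt (h.normalization hvan ha hnorm)
  have t3 := (ENNReal.Tendsto.const_mul t1 (a := 2) (Or.inr ENNReal.ofNat_ne_top)).add
    (ENNReal.Tendsto.const_mul t2 (a := 2) (Or.inr ENNReal.ofNat_ne_top))
  simp only [mul_zero, add_zero] at t3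
  refine tendsto_of_tendsto_of_tendsto_of_le_of_le tendsto_const_nhds t3
    (fun _ => zero_le) fun ε => ?_
  have hb : Measurable fun x => ENNReal.ofReal (aScaled a ε x) :=
    ((ha.meas.comp (measurable_const_smul ε)).const_mul (ε ^ d)).ennreal_ofReal
  have mS := measurable_jumpSum (s := s) hψ.meas hf.1.measurable hb hp
  have mM := measurable_jumpMean (s := s) (z := z) (p := p) (f := f)
    (b := fun x => ENNReal.ofReal (aScaled a ε x)) hψ.meas hf.1.measurable
  have mT := measurable_birthMean (s := s) (z := z) (p := p) hψ.meas hf.1.measurable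
  have m1 := measurable_sqd mS mM
  have m2 := measurable_sqd mM mT
  have m1' := m1.const_mul 2
  rw [← lintegral_const_mul _ m1, ← lintegral_const_mul _ m2, ← lintegral_add_left m1']
  exact lintegral_mono fun γ => sqd_le _ _ _

lemma Setting.ae_jumpSum_ne_top (h : Setting d s z B ξ φ μ k u) (hvan : PhiVanishes φ)
    (ha : GoodA a) (hf : IsC0 f) (hp : Measurable p) (hpt : ∫⁻ y, p y ≠ ⊤) {ε : ℝ}
    (hlt : ∫⁻ γ, sqd (jumpSum s (psi φ) f (fun x => ENNReal.ofReal (aScaled a ε x)) p γ)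
      (birthMean s z (psi φ) f p γ) ∂μ ≠ ⊤) :
    ∀ᵐ γ ∂μ, jumpSum s (psi φ) f (fun x => ENNReal.ofReal (aScaled a ε x)) p γ ≠ ⊤ := by
  have hψ := h.potData hvan
  have hb : Measurable fun x => ENNReal.ofReal (aScaled a ε x) :=
    ((ha.meas.comp (measurable_const_smul ε)).const_mul (ε ^ d)).ennreal_ofReal
  have mS := measurable_jumpSum (s := s) hψ.meas hf.1.measurable hb hp
  have mT := measurable_birthMean (s := s) (z := z) (p := p) hψ.meas hf.1.measurable
  have hT := h.corrData.ae_birthMean_ne_top (z := z) h.hs0 h.hs1 hψ hf hpt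
  filter_upwards [ae_lt_top (measurable_sqd mS mT) hlt, hT] with γ h1 h2
  exact ne_top_of_sqd_ne_top h1.ne h2

lemma Setting.lintegral_sq_HepsPlus_le (h : Setting d s z B ξ φ μ k u) (hvan : PhiVanishes φ)
    (ha : GoodA a) (hf : IsC0 f) {ε : ℝ} (hε : 0 < ε)
    (hP : ∫⁻ γ, sqd (jumpSum s (psi φ) f (fun x => ENNReal.ofReal (aScaled a ε x)) (gainPos f) γ)
      (birthMean s z (psi φ) f (gainPos f) γ) ∂μ ≠ ⊤)
    (hN : ∫⁻ γ, sqd (jumpSum s (psi φ) f (fun x => ENNReal.ofReal (aScaled a ε x)) (gainNeg f) γ)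
      (birthMean s z (psi φ) f (gainNeg f) γ) ∂μ ≠ ⊤) :
    ∫⁻ γ, ENNReal.ofReal ((HepsPlus s (aScaled a ε) φ (fun γ' => Real.exp (cpair f γ')) γ -
        H0Plus s z φ (fun γ' => Real.exp (cpair f γ')) γ) ^ 2) ∂μ
      ≤ 2 * (∫⁻ γ, sqd
        (jumpSum s (psi φ) f (fun x => ENNReal.ofReal (aScaled a ε x)) (gainPos f) γ)
        (birthMean s z (psi φ) f (gainPos f) γ) ∂μ)
      + 2 * (∫⁻ γ, sqd
        (jumpSum s (psi φ) f (fun x => ENNReal.ofReal (aScaled a ε x)) (gainNeg f) γ)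
        (birthMean s z (psi φ) f (gainNeg f) γ) ∂μ) := by
  have hψ := h.potData hvan
  obtain ⟨gP, gN⟩ := lintegral_gain_ne_top hf
  have mp := measurable_gainPos hf
  have mn := measurable_gainNeg hf
  have hb : Measurable fun x => ENNReal.ofReal (aScaled a ε x) :=
    ((ha.meas.comp (measurable_const_smul ε)).const_mul (ε ^ d)).ennreal_ofReal
  have m1 := measurable_sqd (measurable_jumpSum (s := s) hψ.meas hf.1.measurable hb mp)
    (measurable_birthMean (s := s) (z := z) (p := gainPos f) hψ.meas hf.1.measurable)
  have m2 := measurable_sqd (measurable_jumpSum (s := s) hψ.meas hf.1.measurable hb mn)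
    (measurable_birthMean (s := s) (z := z) (p := gainNeg f) hψ.meas hf.1.measurable)
  have m1' := m1.const_mul 2
  rw [← lintegral_const_mul _ m1, ← lintegral_const_mul _ m2, ← lintegral_add_left m1']
  have hgood := h.corrData.ae_ae_good h.hd hψ
  refine lintegral_mono_ae ?_
  filter_upwards [hgood, (h.realGNZ hvan).ae_good_del hψ hgood,
    h.ae_jumpSum_ne_top hvan ha hf mp gP hP, h.ae_jumpSum_ne_top hvan ha hf mn gN hN,
    h.corrData.ae_birthMean_ne_top (z := z) h.hs0 h.hs1 hψ hf gP,
    h.corrData.ae_birthMean_ne_top (z := z) h.hs0 h.hs1 hψ hf gN] with γ hy hx s1 s2 t1 t2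
  rw [HepsPlus_eq h.pp hψ hf ha hε hx hy s1 s2, H0Plus_eq h.pp hψ hf h.hz.le hy t1 t2]
  exact ofReal_sub_sq_le s1 s2 t1 t2

end Conclusion

/-- under the normalization of `a` and `φ → 0` at infinity, for every
`f ∈ C_0(ℝ^d)`, with `F = e^{⟨f,·⟩}`, one has `H_ε^+ F → H_0^+ F` in `L²(Γ,μ)`
as `ε → 0+`. -/
theorem statement12 (d : ℕ) (s z B ξ : ℝ) (φ : EucSp d → EReal) (μ : Measure (Config d))
    (k u : ∀ n : ℕ, (Fin n → EucSp d) → ℝ) (hset : Setting d s z B ξ φ μ k u)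
    (hvan : PhiVanishes φ)
    (a : EucSp d → ℝ) (ha : GoodA a) (hnorm : NormalizedA s a φ μ)
    (f : EucSp d → ℝ) (hf : IsC0 f) :
    Tendsto (fun ε : ℝ => ∫ γ,
        (HepsPlus s (aScaled a ε) φ (fun γ' => Real.exp (cpair f γ')) γ -
          H0Plus s z φ (fun γ' => Real.exp (cpair f γ')) γ) ^ 2 ∂μ)
      (nhdsWithin (0 : ℝ) (Set.Ioi 0)) (nhds 0) := by
  obtain ⟨gP, gN⟩ := lintegral_gain_ne_top hf
  have tP := hset.tendsto_lintegral_sqd hvan ha hnorm hf (measurable_gainPos hf) gP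
  have tN := hset.tendsto_lintegral_sqd hvan ha hnorm hf (measurable_gainNeg hf) gN
  have t := (ENNReal.Tendsto.const_mul tP (a := 2) (Or.inr ENNReal.ofNat_ne_top)).add
    (ENNReal.Tendsto.const_mul tN (a := 2) (Or.inr ENNReal.ofNat_ne_top))
  simp only [mul_zero, add_zero] at t
  refine tendsto_integral_sq_of_le t ?_
  filter_upwards [self_mem_nhdsWithin, tP.eventually_lt_const ENNReal.zero_lt_top,
    tN.eventually_lt_const ENNReal.zero_lt_top] with ε hε hP hN
  exact hset.lintegral_sq_HepsPlus_le hvan ha hf hε hP.ne hN.ne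

end
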